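/- Define φ₀(τ) := (1/2)·( η_g(τ/2)/η_g(τ) − η_{−g}(τ/2)/η_{−g}(τ) + 729·η_g(τ) + η_{−g}(τ) ) and φ₁(τ) := (1/2)·( −η_g(τ/2)/η_g(τ) + η_{−g}(τ/2)/η_{−g}(τ) + 729·η_g(τ) + η_{−g}(τ) ), where η_g(τ) = η(3τ)^{12}/η(τ)^{12} and η_{−g}(τ) = η(τ)^{12} η(6τ)^{12}/(η(2τ)^{12} η(3τ)^{12}). Let A_s(n) (s ∈ {0,1}, n a nonnegative integer) be the Fourier coefficients of (φ₀ + (−1)^s φ₁)/2, and let C_{0,0}(n), C_{0,1}(n) be the Fourier coefficients of F_{0,0} = (f_NS − f̃_NS)/2 and F_{0,1} = −(f_R + 24)/2 respectively. For integers n ≥ 0, k ∈ {0,1,2} and s ∈ {0,1} set Ĉ_s(n,k) := (1/3)·( C_{0,s}(n) + (3·[k = 0] − 1)·A_s(n) ), where [·] is 1 if the condition holds and 0 otherwise. Then there exists Y > 0 such that for all σ, τ in the upper half-plane with Im σ > Y and Im τ > Y, the product converges absolutely and p^{-1} · ∏_{d=1}^∞ ∏_{k=0}^{2} ∏_{r=0}^∞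 (1 − exp(2πik/3)·p^d·q^r)^{Ĉ_0(rd,k)} · (1 + exp(2πik/3)·p^d·q^r)^{Ĉ_1(rd,k)} = η(2σ)^{12} η(3σ)^{12}/(η(σ)^{12} η(6σ)^{12}) − 12 − φ₁(τ), where for a possibly non-integer exponent β one sets w^β := exp(β·Log w) with the principal logarithm. (This is the g-twisted denominator identity of the Conway Borcherds–Kac–Moody superalgebra for the class 3A of Co₀.) -/

import Mathlib

open scoped Real

/-- The Dedekind eta function `η(τ) = e^{πiτ/12} ∏_{n=1}^∞ (1 - e^{2πinτ})`. -/
noncomputable def eta (τ : ℂ) : ℂ :=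
  Complex.exp (Real.pi * Complex.I * τ / 12) *
    ∏' n : ℕ, (1 - Complex.exp (2 * Real.pi * Complex.I * (n + 1) * τ))

/-- `f_NS(τ) = η(τ)^48/(η(τ/2)^24 η(2τ)^24) − 24`. -/
noncomputable def fNS (τ : ℂ) : ℂ :=
  eta τ ^ 48 / (eta (τ / 2) ^ 24 * eta (2 * τ) ^ 24) - 24

/-- `f̃_NS(τ) = η(τ/2)^24/η(τ)^24 + 24`. -/
noncomputable def ftNS (τ : ℂ) : ℂ :=
  eta (τ / 2) ^ 24 / eta τ ^ 24 + 24

/-- `f_R(τ) = 2^12 η(2τ)^24/η(τ)^24 + 24`. -/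
noncomputable def fR (τ : ℂ) : ℂ :=
  2 ^ 12 * eta (2 * τ) ^ 24 / eta τ ^ 24 + 24

/-- The eta product `η_g(τ) = η(3τ)^{12}/η(τ)^{12}` for the class 3A (Frame shape 3¹²/1¹²). -/
noncomputable def etaG3A (τ : ℂ) : ℂ := eta (3 * τ) ^ 12 / eta τ ^ 12

/-- The dual eta product `η_{−g}(τ) = η(τ)^{12} η(6τ)^{12}/(η(2τ)^{12} η(3τ)^{12})`. -/
noncomputable def etaMG3A (τ : ℂ) : ℂ :=
  eta τ ^ 12 * eta (6 * τ) ^ 12 / (eta (2 * τ) ^ 12 * eta (3 * τ) ^ 12)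

/-- `φ₀(τ) = ½(η_g(τ/2)/η_g(τ) − η_{−g}(τ/2)/η_{−g}(τ) + 729 η_g(τ) + η_{−g}(τ))`. -/
noncomputable def phi0 (τ : ℂ) : ℂ :=
  (1 / 2) * (etaG3A (τ / 2) / etaG3A τ - etaMG3A (τ / 2) / etaMG3A τ
    + 729 * etaG3A τ + etaMG3A τ)

/-- `φ₁(τ) = ½(−η_g(τ/2)/η_g(τ) + η_{−g}(τ/2)/η_{−g}(τ) + 729 η_g(τ) + η_{−g}(τ))`. -/
noncomputable def phi1 (τ : ℂ) : ℂ :=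
  (1 / 2) * (-(etaG3A (τ / 2) / etaG3A τ) + etaMG3A (τ / 2) / etaMG3A τ
    + 729 * etaG3A τ + etaMG3A τ)

/-- `Ĉ_s(n,k) = (1/3)(C_{0,s}(n) + (3·[k=0] − 1)·A_s(n))`. -/
noncomputable def Chat (Cs As : ℕ → ℂ) (n : ℕ) (k : Fin 3) : ℂ :=
  (1 / 3) * (Cs n + (3 * (if k = 0 then 1 else 0) - 1) * As n)


namespace C3A
open Complex UpperHalfPlane ModularForm

/-- bounded near `i∞` -/
def BI (G : ℂ → ℂ) : Prop := ∃ K Y : ℝ, 0 < Y ∧ ∀ τ : ℂ, Y < τ.im → ‖G τ‖ ≤ K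

lemma BI.const (c : ℂ) : BI (fun _ => c) := ⟨‖c‖, 1, one_pos, fun _ _ => le_rfl⟩

lemma BI.add {f g : ℂ → ℂ} (hf : BI f) (hg : BI g) : BI (fun z => f z + g z) := by
  obtain ⟨K, Y, hY, h⟩ := hf
  obtain ⟨K', Y', hY', h'⟩ := hg
  refine ⟨K + K', max Y Y', lt_max_of_lt_left hY, fun τ ht => ?_⟩
  exact (norm_add_le _ _).trans (add_le_add (h τ (lt_of_le_of_lt (le_max_left _ _) ht))
    (h' τ (lt_of_le_of_lt (le_max_right _ _) ht)))

lemma BI.mul {f g : ℂ → ℂ} (hf : BI f) (hg : BI g) : BI (fun z => f z * g z) := by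
  obtain ⟨K, Y, hY, h⟩ := hf
  obtain ⟨K', Y', hY', h'⟩ := hg
  refine ⟨K * K', max Y Y', lt_max_of_lt_left hY, fun τ ht => ?_⟩
  rw [norm_mul]
  have h1 := h τ (lt_of_le_of_lt (le_max_left _ _) ht)
  exact mul_le_mul h1 (h' τ (lt_of_le_of_lt (le_max_right _ _) ht)) (norm_nonneg _)
    ((norm_nonneg _).trans h1)

lemma BI.neg {f : ℂ → ℂ} (hf : BI f) : BI (fun z => - f z) := by
  obtain ⟨K, Y, hY, h⟩ := hf
  exact ⟨K, Y, hY, fun τ ht => by simpa using h τ ht⟩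

lemma BI.sub {f g : ℂ → ℂ} (hf : BI f) (hg : BI g) : BI (fun z => f z - g z) := by
  simpa [sub_eq_add_neg] using hf.add hg.neg

lemma BI.pow {f : ℂ → ℂ} (hf : BI f) (n : ℕ) : BI (fun z => f z ^ n) := by
  induction n with
  | zero => simpa using BI.const 1
  | succ n ih => simpa [pow_succ] using ih.mul hf

lemma BI.sum {ι : Type*} (s : Finset ι) {f : ι → ℂ → ℂ} (hf : ∀ i ∈ s, BI (f i)) :
    BI (fun z => ∑ i ∈ s, f i z) := by
  classical
  induction s using Finset.induction_on with
  | empty => simpa using BI.const 0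
  | insert a s ha ih =>
    simp only [Finset.sum_insert ha]
    exact (hf a (by simp)).add (ih fun i hi => hf i (by simp [hi]))

lemma BI.congr {f g : ℂ → ℂ} (hf : BI f) (h : ∀ z : ℂ, 0 < z.im → g z = f z) : BI g := by
  obtain ⟨K, Y, hY, h'⟩ := hf
  exact ⟨K, Y, hY, fun τ ht => by rw [h τ (hY.trans ht)]; exact h' τ ht⟩

/-- affine substitution -/
lemma BI.comp {f : ℂ → ℂ} (hf : BI f) (s : ℝ) (hs : 0 < s) (w : ℂ → ℂ)
    (hw : ∀ z, (w z).im = s * z.im) : BI (fun z => f (w z)) := by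
  obtain ⟨K, Y, hY, h⟩ := hf
  refine ⟨K, Y / s, by positivity, fun τ ht => h _ ?_⟩
  rw [hw]
  rw [div_lt_iff₀ hs] at ht
  linarith [mul_comm s τ.im]

/-- Moebius action -/
noncomputable def mob (A B C D : ℤ) (τ : ℂ) : ℂ := (A * τ + B) / (C * τ + D)

lemma den_ne {A B C D : ℤ} (h : A * D - B * C = 1) {τ : ℂ} (ht : 0 < τ.im) :
    (C : ℂ) * τ + D ≠ 0 := by
  intro h0
  have h1 := congrArg Complex.im h0
  have h2 := congrArg Complex.re h0
  simp at h1 h2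
  rcases h1 with h1 | h1
  · subst h1
    simp at h2
    subst h2
    simp at h
  · linarith

/-- SL2 element -/
def mkSL (A B C D : ℤ) (h : A * D - B * C = 1) : Matrix.SpecialLinearGroup (Fin 2) ℤ :=
  ⟨!![A, B; C, D], by simp [Matrix.det_fin_two, h]⟩

lemma mkSL_smul (A B C D : ℤ) (h : A * D - B * C = 1) (z : ℍ) :
    ((mkSL A B C D h • z : ℍ) : ℂ) = mob A B C D z := by
  rw [UpperHalfPlane.specialLinearGroup_apply]
  simp [mkSL, mob]

lemma mob_im_pos {A B C D : ℤ} (h : A * D - B * C = 1) {τ : ℂ} (ht : 0 < τ.im) :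
    0 < (mob A B C D τ).im := by
  have := mkSL_smul A B C D h ⟨τ, ht⟩
  have h2 := (mkSL A B C D h • (⟨τ, ht⟩ : ℍ)).2
  change 0 < ((mkSL A B C D h • (⟨τ, ht⟩ : ℍ) : ℍ) : ℂ).im at h2
  rw [this] at h2
  exact h2

lemma const_of_bdd (F : ℂ → ℂ) (N : ℕ) (hN : N ≠ 0)
    (hol : DifferentiableOn ℂ F {z | 0 < z.im})
    (inv : ∀ A B C D : ℤ, A * D - B * C = 1 → (N : ℤ) ∣ A - 1 → (N : ℤ) ∣ B → (N : ℤ) ∣ C →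
      (N : ℤ) ∣ D - 1 → ∀ τ : ℂ, 0 < τ.im → F (mob A B C D τ) = F τ)
    (bdd : ∀ A B C D : ℤ, A * D - B * C = 1 → BI (fun τ => F (mob A B C D τ))) :
    ∃ c, ∀ τ : ℂ, 0 < τ.im → F τ = c := by
  have : NeZero N := ⟨hN⟩
  let Γ := (CongruenceSubgroup.Gamma N).map (Matrix.SpecialLinearGroup.mapGL ℝ)
  let f : ModularForm Γ 0 :=
    { toFun := fun z => F z
      slash_action_eq' := by
        rintro γ ⟨g, hg, rfl⟩
        ext z
        change ((fun z : ℍ => F z) ∣[(0 : ℤ)] g) z = F z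
        rw [ModularForm.SL_slash_apply]
        simp only [neg_zero, zpow_zero, mul_one]
        have hdet := g.det_coe
        rw [Matrix.det_fin_two] at hdet
        have hg' := (CongruenceSubgroup.Gamma_mem).1 hg
        have e : g = mkSL (g 0 0) (g 0 1) (g 1 0) (g 1 1) hdet := by
          ext i j; fin_cases i <;> fin_cases j <;> rfl
        rw [e, mkSL_smul]
        refine inv _ _ _ _ hdet ?_ ?_ ?_ ?_ z z.2
        · rw [← ZMod.intCast_zmod_eq_zero_iff_dvd]; push_cast; rw [hg'.1]; simp
        · rw [← ZMod.intCast_zmod_eq_zero_iff_dvd]; exact hg'.2.1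
        · rw [← ZMod.intCast_zmod_eq_zero_iff_dvd]; exact hg'.2.2.1
        · rw [← ZMod.intCast_zmod_eq_zero_iff_dvd]; push_cast; rw [hg'.2.2.2]; simp
      holo' := by
        rw [UpperHalfPlane.mdifferentiable_iff]
        refine hol.congr ?_
        intro z hz
        simp [UpperHalfPlane.ofComplex_apply_of_im_pos hz]
      bdd_at_cusps' := by
        intro c hc
        have hc' : IsCusp c (Matrix.SpecialLinearGroup.mapGL ℝ : _ →* GL (Fin 2) ℝ).range :=
          (Subgroup.IsArithmetic.isCusp_iff_isCusp_SL2Z _).1 hc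
        rw [OnePoint.isBoundedAt_iff_forall_SL2Z hc']
        intro g _
        rw [UpperHalfPlane.isBoundedAtImInfty_iff]
        have hdet := g.det_coe
        rw [Matrix.det_fin_two] at hdet
        have e : g = mkSL (g 0 0) (g 0 1) (g 1 0) (g 1 1) hdet := by
          ext i j; fin_cases i <;> fin_cases j <;> rfl
        obtain ⟨K, Y, hY, hK⟩ := bdd _ _ _ _ hdet
        refine ⟨K, Y + 1, fun z hz => ?_⟩
        rw [ModularForm.SL_slash_apply]
        simp only [neg_zero, zpow_zero, mul_one]
        rw [e, mkSL_smul]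
        exact hK z (lt_of_lt_of_le (by linarith) hz) }
  obtain ⟨c, hc⟩ := ModularForm.eq_const_of_weight_zero f
  exact ⟨c, fun τ ht => congrFun hc ⟨τ, ht⟩⟩

end C3A


namespace C3A
open Complex
open scoped UpperHalfPlane

lemma eta_eq (z : ℂ) : _root_.eta z = ModularForm.eta z := by
  unfold _root_.eta ModularForm.eta
  congr 1
  · rw [Function.Periodic.qParam]
    congr 1
    push_cast
    ring
  · congr 1
    funext n
    rw [ModularForm.eta_q_eq_cexp]

/-- `η^12` -/
noncomputable def E (z : ℂ) : ℂ := _root_.eta z ^ 12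

lemma E_ne {z : ℂ} (hz : 0 < z.im) : E z ≠ 0 := by
  unfold E
  rw [eta_eq]
  exact pow_ne_zero _ (ModularForm.eta_ne_zero hz)

lemma E_diff {z : ℂ} (hz : 0 < z.im) : DifferentiableAt ℂ E z := by
  have : E = fun z => ModularForm.eta z ^ 12 := by
    funext z; simp [E, eta_eq]
  rw [this]
  exact (ModularForm.differentiableAt_eta_of_mem_upperHalfPlaneSet hz).pow 12

lemma E_T (z : ℂ) : E (z + 1) = - E z := by
  unfold E _root_.eta
  have h1 : ∀ n : ℕ, cexp (2 * Real.pi * I * (n + 1) * (z + 1))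
      = cexp (2 * Real.pi * I * (n + 1) * z) := by
    intro n
    have : (2 * Real.pi * I * (n + 1) * (z + 1) : ℂ)
      = 2 * Real.pi * I * (n + 1) * z + ((n + 1 : ℕ) : ℂ) * (2 * Real.pi * I) := by
      push_cast; ring
    rw [this, Complex.exp_add, Complex.exp_nat_mul_two_pi_mul_I, mul_one]
  simp only [h1, mul_pow]
  rw [← neg_mul]
  congr 1
  rw [← Complex.exp_nat_mul, ← Complex.exp_nat_mul]
  have : (((12 : ℕ) : ℂ) * (Real.pi * I * (z + 1) / 12)) = ((12 : ℕ) : ℂ) * (Real.pi * I * z / 12)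
    + Real.pi * I := by push_cast; ring
  rw [this, Complex.exp_add, Complex.exp_pi_mul_I]
  ring

lemma csqrt_pow_12 {z : ℂ} (hz : z ≠ 0) : Complex.sqrt z ^ 12 = z ^ 6 := by
  rw [_root_.sqrt_eq_exp hz, ← Complex.exp_nat_mul]
  have : (((12 : ℕ) : ℂ) * (log z / 2)) = (6 : ℕ) * log z := by push_cast; ring
  rw [this, Complex.exp_nat_mul, Complex.exp_log hz]

lemma E_S {z : ℂ} (hz : 0 < z.im) : E (-1 / z) = - z ^ 6 * E z := by
  have hz0 : z ≠ 0 := by rintro rfl; simp at hz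
  have h := ModularForm.eta_comp_eq_csqrt_I_inv hz
  simp only [Function.comp, Pi.smul_apply, Pi.mul_apply, smul_eq_mul] at h
  unfold E
  rw [eta_eq, eta_eq, h, mul_pow, mul_pow, inv_pow, csqrt_pow_12 hz0, csqrt_pow_12 I_ne_zero]
  have : I ^ 6 = -1 := by
    rw [show 6 = 4 + 2 by rfl, pow_add, I_pow_four, I_sq]; ring
  rw [this]
  norm_num

/-- sign character mod 2 -/
def sg (a b c d : ZMod 2) : ℤ := if b + c + b * c * (1 + a + d) = 0 then 1 else -1

lemma sg_mul : ∀ a b c d a' b' c' d' : ZMod 2, a * d - b * c = 1 → a' * d' - b' * c' = 1 →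
    sg (a * a' + b * c') (a * b' + b * d') (c * a' + d * c') (c * b' + d * d')
      = sg a b c d * sg a' b' c' d' := by
  decide

lemma sg_sq (a b c d : ZMod 2) : sg a b c d * sg a b c d = 1 := by
  unfold sg; split_ifs <;> norm_num

/-- sign of an SL2 element -/
def sgn (g : Matrix.SpecialLinearGroup (Fin 2) ℤ) : ℤ := sg (g 0 0) (g 0 1) (g 1 0) (g 1 1)

lemma sgn_mul (g h : Matrix.SpecialLinearGroup (Fin 2) ℤ) : sgn (g * h) = sgn g * sgn h := by
  have hg := g.det_coe
  have hh := h.det_coe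
  rw [Matrix.det_fin_two] at hg hh
  unfold sgn
  rw [← sg_mul]
  · simp [Matrix.SpecialLinearGroup.coe_mul, Matrix.mul_apply, Fin.sum_univ_two]
  · have := congrArg (Int.cast : ℤ → ZMod 2) hg
    push_cast at this
    exact this
  · have := congrArg (Int.cast : ℤ → ZMod 2) hh
    push_cast at this
    exact this

lemma sgn_one : sgn 1 = 1 := by
  simp [sgn, sg]

/-- automorphy factor -/
noncomputable def jj (g : Matrix.SpecialLinearGroup (Fin 2) ℤ) (z : ℂ) : ℂ := (g 1 0 : ℂ) * z + g 1 1

lemma SL_coe (g : Matrix.SpecialLinearGroup (Fin 2) ℤ) (z : ℍ) :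
    ((g • z : ℍ) : ℂ) = ((g 0 0 : ℂ) * z + g 0 1) / jj g z := by
  rw [UpperHalfPlane.specialLinearGroup_apply]
  simp [jj]

lemma jj_ne (g : Matrix.SpecialLinearGroup (Fin 2) ℤ) (z : ℍ) : jj g z ≠ 0 := by
  have hg := g.det_coe
  rw [Matrix.det_fin_two] at hg
  exact den_ne hg z.2

lemma jj_mul (x y : Matrix.SpecialLinearGroup (Fin 2) ℤ) (z : ℍ) :
    jj (x * y) z = jj x (y • z : ℍ) * jj y z := by
  have h := jj_ne y z
  have h2 : jj x (y • z : ℍ) * jj y z =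
     (x 1 0 : ℂ) * ((y 0 0 : ℂ) * z + y 0 1) + x 1 1 * jj y z := by
    conv_lhs => rw [jj, SL_coe]
    field_simp
  rw [h2]
  simp [jj, Matrix.SpecialLinearGroup.coe_mul, Matrix.mul_apply, Fin.sum_univ_two]
  ring

lemma E_SL (g : Matrix.SpecialLinearGroup (Fin 2) ℤ) :
    ∀ z : ℍ, E ((g • z : ℍ) : ℂ) = sgn g * (jj g z) ^ 6 * E z := by
  have hg : g ∈ Subgroup.closure {ModularGroup.S, ModularGroup.T} := by
    rw [SpecialLinearGroup.SL2Z_generators]; trivial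
  induction hg using Subgroup.closure_induction with
  | mem x hx =>
    intro z
    rcases hx with rfl | rfl
    · have e2 : sgn ModularGroup.S = -1 := by decide
      have e3 : jj ModularGroup.S z = z := by simp [jj, ModularGroup.S]
      rw [SL_coe, e2, e3]
      have e4 : (((ModularGroup.S 0 0 : ℤ) : ℂ) * z + (ModularGroup.S 0 1 : ℤ)) = -1 := by
        simp [ModularGroup.S]
      rw [e4, E_S z.2]
      push_cast
      ring
    · have e2 : sgn ModularGroup.T = -1 := by decide
      have e3 : jj ModularGroup.T z = 1 := by simp [jj, ModularGroup.T]
      have e4 : (((ModularGroup.T 0 0 : ℤ) : ℂ) * z + (ModularGroup.T 0 1 : ℤ)) = z + 1 := by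
        simp [ModularGroup.T]
      rw [SL_coe, e2, e3, e4, div_one, E_T]
      push_cast; ring
  | one => intro z; simp [sgn_one, jj]
  | mul x y _ _ hx hy =>
    intro z
    rw [mul_smul, hx, hy, sgn_mul, jj_mul]
    push_cast
    ring
  | inv x _ hx =>
    intro z
    have h := hx (x⁻¹ • z)
    rw [smul_inv_smul] at h
    have hs : sgn x * sgn x⁻¹ = 1 := by rw [← sgn_mul]; simp [sgn_one]
    have hs' : (sgn x : ℂ) * sgn x⁻¹ = 1 := by exact_mod_cast hs
    have hd : jj x (x⁻¹ • z : ℍ) * jj x⁻¹ z = 1 := by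
      rw [← jj_mul]; simp [jj]
    rw [h]
    have e : ∀ a b c d e : ℂ, a * b = 1 → c * d = 1 → b * d ^ 6 * (a * c ^ 6 * e) = e := by
      intro a b c d e h1 h2
      have : b * d ^ 6 * (a * c ^ 6 * e) = (a * b) * (c * d) ^ 6 * e := by ring
      rw [this, h1, h2]; ring
    exact (e _ _ _ _ _ hs' hd).symm

lemma E_mob {A B C D : ℤ} (h : A * D - B * C = 1) {z : ℂ} (hz : 0 < z.im) :
    E (mob A B C D z) = sg A B C D * (C * z + D) ^ 6 * E z := by
  have := E_SL (mkSL A B C D h) ⟨z, hz⟩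
  rw [mkSL_smul] at this
  simpa [sgn, mkSL, jj] using this

end C3A


namespace C3A
open Complex
open scoped UpperHalfPlane

/-- `e(z)` -/
noncomputable def e (z : ℂ) : ℂ := cexp (2 * Real.pi * I * z)

lemma e_add (x y : ℂ) : e (x + y) = e x * e y := by
  unfold e; rw [← Complex.exp_add]; ring_nf

lemma e_neg (x : ℂ) : e (-x) = (e x)⁻¹ := by
  unfold e; rw [← Complex.exp_neg]; ring_nf

lemma e_ne (x : ℂ) : e x ≠ 0 := Complex.exp_ne_zero _

lemma e_nat_mul (n : ℕ) (x : ℂ) : e (n * x) = e x ^ n := by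
  unfold e; rw [← Complex.exp_nat_mul]; ring_nf

lemma e_int (n : ℤ) : e n = 1 := by
  unfold e
  rw [mul_comm]
  exact Complex.exp_int_mul_two_pi_mul_I n

lemma e_add_int (x : ℂ) (n : ℤ) : e (x + n) = e x := by
  rw [e_add, e_int, mul_one]

lemma norm_e (z : ℂ) : ‖e z‖ = Real.exp (-(2 * Real.pi * z.im)) := by
  unfold e
  rw [Complex.norm_exp]
  congr 1
  simp

lemma norm_e_lt {z : ℂ} (hz : 0 < z.im) : ‖e z‖ < 1 := by
  rw [norm_e, Real.exp_lt_one_iff]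
  have := Real.pi_pos
  have : 0 < 2 * Real.pi * z.im := by positivity
  linarith

lemma exists_e {q : ℂ} (h0 : q ≠ 0) (h1 : ‖q‖ < 1) : ∃ z : ℂ, 0 < z.im ∧ e z = q := by
  refine ⟨Function.Periodic.invQParam 1 q, ?_, ?_⟩
  · rw [Function.Periodic.im_invQParam]
    have : Real.log ‖q‖ < 0 := Real.log_neg (norm_pos_iff.mpr h0) h1
    have hp := Real.pi_pos
    have h2 : (-1 : ℝ) / (2 * Real.pi) < 0 := div_neg_of_neg_of_pos (by norm_num) (by positivity)
    exact mul_pos_of_neg_of_neg h2 this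
  · have := Function.Periodic.qParam_right_inv (h := 1) one_ne_zero h0
    rw [Function.Periodic.qParam] at this
    unfold e
    simpa using this

lemma e_diff (z : ℂ) : DifferentiableAt ℂ e z := by unfold e; fun_prop

/-- Euler product -/
noncomputable def P (q : ℂ) : ℂ := ∏' n : ℕ, (1 - q ^ (n + 1))

lemma P_zero : P 0 = 1 := by simp [P]

lemma P_diff : DifferentiableOn ℂ P (Metric.ball 0 1) :=
  ModularForm.differentiableOn_tprod_one_sub_pow

lemma E_eq (z : ℂ) : E z = cexp (Real.pi * I * z) * P (e z) ^ 12 := by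
  unfold E _root_.eta P
  rw [mul_pow, ← Complex.exp_nat_mul]
  congr 1
  · congr 1; push_cast; ring
  · congr 2
    funext n
    rw [e, ← Complex.exp_nat_mul]
    congr 2
    push_cast; ring

lemma P_ne {q : ℂ} (hq : ‖q‖ < 1) : P q ≠ 0 := by
  by_cases h0 : q = 0
  · rw [h0, P_zero]; exact one_ne_zero
  · obtain ⟨z, hz, rfl⟩ := exists_e h0 hq
    have := E_ne hz
    rw [E_eq] at this
    intro h
    rw [h] at this
    simp at this

/-- analytic nonvanishing with value 1 at 0 -/
structure Nice (φ : ℂ → ℂ) : Prop where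
  diff : DifferentiableOn ℂ φ (Metric.ball 0 1)
  ne : ∀ q, ‖q‖ < 1 → φ q ≠ 0
  one : φ 0 = 1

lemma pow_ball {q : ℂ} (hq : ‖q‖ < 1) (n : ℕ) (hn : n ≠ 0) : ‖q ^ n‖ < 1 := by
  rw [norm_pow]; exact pow_lt_one₀ (norm_nonneg _) hq hn

lemma nice_P (n : ℕ) (hn : n ≠ 0) : Nice (fun q => P (q ^ n)) := by
  refine ⟨?_, ?_, ?_⟩
  · refine P_diff.comp (by fun_prop) ?_
    intro q hq
    simp only [Metric.mem_ball, dist_zero_right] at hq ⊢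
    exact pow_ball hq n hn
  · intro q hq
    exact P_ne (pow_ball hq n hn)
  · simp [hn, P_zero]

lemma Nice.mul {f g : ℂ → ℂ} (hf : Nice f) (hg : Nice g) : Nice (fun q => f q * g q) :=
  ⟨hf.diff.mul hg.diff, fun q hq => mul_ne_zero (hf.ne q hq) (hg.ne q hq), by
    simp [hf.one, hg.one]⟩

lemma Nice.div {f g : ℂ → ℂ} (hf : Nice f) (hg : Nice g) : Nice (fun q => f q / g q) :=
  ⟨hf.diff.div hg.diff (fun q hq => hg.ne q (by simpa using hq)),
    fun q hq => div_ne_zero (hf.ne q hq) (hg.ne q hq), by simp [hf.one, hg.one]⟩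

lemma Nice.pow {f : ℂ → ℂ} (hf : Nice f) (n : ℕ) : Nice (fun q => f q ^ n) :=
  ⟨hf.diff.pow n, fun q hq => pow_ne_zero _ (hf.ne q hq), by simp [hf.one]⟩

lemma diff_bdd {f : ℂ → ℂ} (hf : DifferentiableOn ℂ f (Metric.ball 0 1)) :
    ∃ K : ℝ, ∀ q : ℂ, ‖q‖ ≤ 1 / 2 → ‖f q‖ ≤ K := by
  have hc : ContinuousOn f (Metric.closedBall 0 (1 / 2)) :=
    hf.continuousOn.mono (Metric.closedBall_subset_ball (by norm_num))
  obtain ⟨K, hK⟩ := (isCompact_closedBall (0 : ℂ) (1 / 2)).exists_bound_of_continuousOn hc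
  exact ⟨K, fun q hq => hK q (by simpa using hq)⟩

lemma norm_e_half {z : ℂ} (hz : 1 < z.im) : ‖e z‖ ≤ 1 / 2 := by
  rw [norm_e]
  have h1 : (1 : ℝ) ≤ 2 * Real.pi * z.im := by
    have := Real.pi_gt_three
    nlinarith
  have h2 : Real.exp (-(2 * Real.pi * z.im)) ≤ Real.exp (-1) := Real.exp_le_exp.mpr (by linarith)
  refine h2.trans ?_
  rw [Real.exp_neg, one_div]
  exact inv_anti₀ (by norm_num) (by linarith [Real.add_one_le_exp (1 : ℝ)])

lemma BI_of_diff {f : ℂ → ℂ} (hf : DifferentiableOn ℂ f (Metric.ball 0 1)) :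
    BI (fun z => f (e z)) := by
  obtain ⟨K, hK⟩ := diff_bdd hf
  exact ⟨K, 1, one_pos, fun z hz => hK _ (norm_e_half hz)⟩

lemma Nice.bi {φ : ℂ → ℂ} (h : Nice φ) : BI (fun z => e z * φ (e z)) :=
  BI_of_diff (f := fun q => q * φ q) (differentiableOn_id.mul h.diff)

lemma Nice.bi_inv {φ : ℂ → ℂ} (h : Nice φ) : BI (fun z => (e z * φ (e z))⁻¹ - e (-z)) := by
  have hb : Metric.ball (0 : ℂ) 1 ∈ nhds (0 : ℂ) := Metric.ball_mem_nhds _ one_pos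
  have h1 : DifferentiableOn ℂ (fun q => (φ q)⁻¹) (Metric.ball 0 1) :=
    h.diff.inv (fun q hq => h.ne q (by simpa using hq))
  have h2 := (Complex.differentiableOn_dslope hb).mpr h1
  refine (BI_of_diff h2).congr ?_
  intro z _
  rw [dslope_of_ne _ (e_ne z), slope_def_field, h.one, e_neg, mul_inv]
  simp
  field_simp [e_ne z]

/-- `η_g` -/
noncomputable def G (z : ℂ) : ℂ := E (3 * z) / E z
/-- `η_{-g}` -/
noncomputable def t (z : ℂ) : ℂ := E z * E (6 * z) / (E (2 * z) * E (3 * z))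
/-- `η(2z)^24/η(z)^24` -/
noncomputable def u (z : ℂ) : ℂ := E (2 * z) ^ 2 / E z ^ 2

lemma G_eq (z : ℂ) : etaG3A z = G z := rfl
lemma t_eq (z : ℂ) : etaMG3A z = t z := rfl

/-- unit part of the `q`-series -/
noncomputable def phT (q : ℂ) : ℂ :=
  (P (q ^ 1) * P (q ^ 6) / (P (q ^ 2) * P (q ^ 3))) ^ 12
/-- unit part of the `q`-series -/
noncomputable def phG (q : ℂ) : ℂ := (P (q ^ 3) / P (q ^ 1)) ^ 12
/-- unit part of the `q`-series -/
noncomputable def phU (q : ℂ) : ℂ := (P (q ^ 2) / P (q ^ 1)) ^ 24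

lemma nice_T : Nice phT :=
  (((nice_P 1 (by norm_num)).mul (nice_P 6 (by norm_num))).div
    ((nice_P 2 (by norm_num)).mul (nice_P 3 (by norm_num)))).pow 12
lemma nice_G : Nice phG := ((nice_P 3 (by norm_num)).div (nice_P 1 (by norm_num))).pow 12
lemma nice_U : Nice phU := ((nice_P 2 (by norm_num)).div (nice_P 1 (by norm_num))).pow 24

lemma E_eq' (n : ℕ) (z : ℂ) : E (n * z) = cexp (Real.pi * I * z) ^ n * P (e z ^ n) ^ 12 := by
  rw [E_eq, e_nat_mul, ← Complex.exp_nat_mul]; ring_nf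

lemma e_sq (z : ℂ) : e z = cexp (Real.pi * I * z) ^ 2 := by
  unfold e; rw [← Complex.exp_nat_mul]; push_cast; ring_nf

lemma G_q (z : ℂ) : G z = e z * phG (e z) := by
  have h1 := E_eq' 1 z
  have h3 := E_eq' 3 z
  push_cast at h1 h3
  rw [one_mul] at h1
  unfold G phG
  rw [h1, h3, div_pow]
  nth_rw 3 [e_sq]
  have := Complex.exp_ne_zero (Real.pi * I * z)
  field_simp

lemma u_q (z : ℂ) : u z = e z * phU (e z) := by
  have h1 := E_eq' 1 z
  have h3 := E_eq' 2 z
  push_cast at h1 h3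
  rw [one_mul] at h1
  unfold u phU
  rw [h1, h3, div_pow]
  nth_rw 3 [e_sq]
  have := Complex.exp_ne_zero (Real.pi * I * z)
  field_simp

lemma t_q (z : ℂ) : t z = e z * phT (e z) := by
  have h1 := E_eq' 1 z
  have h2 := E_eq' 2 z
  have h3 := E_eq' 3 z
  have h6 := E_eq' 6 z
  push_cast at h1 h2 h3 h6
  rw [one_mul] at h1
  unfold t phT
  rw [h1, h2, h3, h6, div_pow]
  nth_rw 5 [e_sq]
  have := Complex.exp_ne_zero (Real.pi * I * z)
  field_simp

lemma G_ne {z : ℂ} (hz : 0 < z.im) : G z ≠ 0 := by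
  rw [G_q]; exact mul_ne_zero (e_ne _) (nice_G.ne _ (norm_e_lt hz))
lemma u_ne {z : ℂ} (hz : 0 < z.im) : u z ≠ 0 := by
  rw [u_q]; exact mul_ne_zero (e_ne _) (nice_U.ne _ (norm_e_lt hz))
lemma t_ne {z : ℂ} (hz : 0 < z.im) : t z ≠ 0 := by
  rw [t_q]; exact mul_ne_zero (e_ne _) (nice_T.ne _ (norm_e_lt hz))

lemma Nice.diffAt {φ : ℂ → ℂ} (h : Nice φ) {z : ℂ} (hz : 0 < z.im) :
    DifferentiableAt ℂ (fun z => e z * φ (e z)) z := by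
  refine (e_diff z).mul ?_
  refine DifferentiableAt.comp z ?_ (e_diff z)
  exact h.diff.differentiableAt (Metric.isOpen_ball.mem_nhds (by simpa using norm_e_lt hz))

lemma G_diff {z : ℂ} (hz : 0 < z.im) : DifferentiableAt ℂ G z := by
  rw [show G = fun z => e z * phG (e z) from funext G_q]; exact nice_G.diffAt hz
lemma u_diff {z : ℂ} (hz : 0 < z.im) : DifferentiableAt ℂ u z := by
  rw [show u = fun z => e z * phU (e z) from funext u_q]; exact nice_U.diffAt hz
lemma t_diff {z : ℂ} (hz : 0 < z.im) : DifferentiableAt ℂ t z := by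
  rw [show t = fun z => e z * phT (e z) from funext t_q]; exact nice_T.diffAt hz

lemma G_per (z : ℂ) (n : ℤ) : G (z + n) = G z := by rw [G_q, G_q, e_add_int]
lemma u_per (z : ℂ) (n : ℤ) : u (z + n) = u z := by rw [u_q, u_q, e_add_int]
lemma t_per (z : ℂ) (n : ℤ) : t (z + n) = t z := by rw [t_q, t_q, e_add_int]

lemma BI_G : BI G := nice_G.bi.congr fun z _ => G_q z
lemma BI_u : BI u := nice_U.bi.congr fun z _ => u_q z
lemma BI_t : BI t := nice_T.bi.congr fun z _ => t_q z
lemma BI_Gi : BI (fun z => (G z)⁻¹ - e (-z)) := nice_G.bi_inv.congr fun z _ => by rw [G_q z]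
lemma BI_ui : BI (fun z => (u z)⁻¹ - e (-z)) := nice_U.bi_inv.congr fun z _ => by rw [u_q z]
lemma BI_ti : BI (fun z => (t z)⁻¹ - e (-z)) := nice_T.bi_inv.congr fun z _ => by rw [t_q z]

lemma t_G {z : ℂ} (hz : 0 < z.im) : t z = G (2 * z) / G z := by
  unfold t G
  have h1 := E_ne hz
  have h2 : E (2 * z) ≠ 0 := E_ne (by simpa using hz)
  have h3 : E (3 * z) ≠ 0 := E_ne (by simpa using hz)
  rw [show (3 : ℂ) * (2 * z) = 6 * z by ring]
  field_simp

end C3A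


namespace C3A
open Complex
open scoped UpperHalfPlane

lemma sg_ne (a b c d : ZMod 2) : ((sg a b c d : ℤ) : ℂ) ≠ 0 := by
  unfold sg; split_ifs <;> norm_num

lemma sg_sq' (a b c d : ZMod 2) : ((sg a b c d : ℤ) : ℂ) ^ 2 = 1 := by
  unfold sg; split_ifs <;> norm_num

lemma mob_shift (j A B C D : ℤ) (z : ℂ) : mob A B C D z = mob A (B - j * A) C (D - j * C) (z + j) := by
  unfold mob; push_cast; congr 1 <;> ring

lemma mob_up (k : ℤ) (A B c D : ℤ) (z : ℂ) : k * mob A B (k * c) D z = mob A (k * B) c D (k * z) := by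
  unfold mob; push_cast; rw [mul_div_assoc']; congr 1 <;> ring

lemma mob_dn (k : ℤ) (hk : k ≠ 0) (A B C d j : ℤ) (z : ℂ) :
    k * mob A B C (k * d + j * C) z = mob (k * A) (B - j * A) C d ((z + j) / k) := by
  have : (k : ℂ) ≠ 0 := by exact_mod_cast hk
  unfold mob; push_cast
  rw [mul_div_assoc', ← mul_div_mul_left _ _ this]
  field_simp
  congr 1 <;> ring

lemma im_up {z : ℂ} (hz : 0 < z.im) (k : ℤ) (hk : 0 < k) : 0 < ((k : ℂ) * z).im := by
  simp; have : (0 : ℝ) < k := by exact_mod_cast hk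
  positivity

lemma im_dn {z : ℂ} (hz : 0 < z.im) (k j : ℤ) (hk : 0 < k) : 0 < ((z + j) / (k : ℂ)).im := by
  have : (0 : ℝ) < k := by exact_mod_cast hk
  have h : ((z + j) / (k : ℂ)).im = z.im / k := by
    rw [show (k : ℂ) = ((k : ℝ) : ℂ) by push_cast; rfl, Complex.div_ofReal_im]; simp
  rw [h]; positivity

lemma E_even (z : ℂ) (j : ℤ) : E (z + (2 * j : ℤ)) = E z := by
  rw [E_eq, E_eq, e_add_int]
  congr 1
  rw [mul_add, Complex.exp_add]
  have : (Real.pi * I * ((2 * j : ℤ) : ℂ)) = j * (2 * Real.pi * I) := by push_cast; ring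
  rw [this, Complex.exp_int_mul_two_pi_mul_I, mul_one]

lemma G_up {A B c D : ℤ} (h : A * D - B * (3 * c) = 1) {z : ℂ} (hz : 0 < z.im) :
    G (mob A B (3 * c) D z) = G z := by
  unfold G
  have h1 := E_mob h hz
  have e1 := mob_up 3 A B c D z
  have h2 := E_mob (A := A) (B := 3 * B) (C := c) (D := D) (by rw [← h]; ring) (im_up hz 3 (by norm_num))
  rw [← e1] at h2
  push_cast at h1 h2
  have hd := den_ne h hz
  push_cast at hd
  have : sg (A : ZMod 2) (3 * B) c D = sg A B (3 * c) D := by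
    rw [show (3 : ZMod 2) = 1 by decide]; simp
  rw [h1, h2, this]
  have h4 := sg_ne A B (3 * c) D
  have h5 := E_ne hz
  rw [show (c : ℂ) * (3 * z) + D = 3 * c * z + D by ring]
  field_simp

lemma G_dn_aux {A B C d j : ℤ} (h : A * (3 * d + (2 * j) * C) - B * C = 1) {z : ℂ} (hz : 0 < z.im) :
    729 * G (mob A B C (3 * d + (2 * j) * C) z) = (G ((z + (2 * j : ℤ)) / 3))⁻¹ := by
  have h1 := E_mob h hz
  have e1 := mob_dn 3 (by norm_num) A B C d (2 * j) z
  have hw := im_dn hz 3 (2 * j) (by norm_num)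
  have h2 := E_mob (A := 3 * A) (B := B - 2 * j * A) (C := C) (D := d) (by rw [← h]; ring) hw
  rw [← e1] at h2
  have hd := den_ne h hz
  have h4 := sg_ne A B C (3 * d + 2 * j * C)
  have hs : sg (3 * A : ZMod 2) (B - 2 * j * A) C d = sg A B C (3 * d + 2 * j * C) := by
    rw [show (3 : ZMod 2) = 1 by decide, show (2 : ZMod 2) = 0 by decide]; simp
  have h5 := E_ne hz
  have h6 := E_ne hw
  unfold G
  have e3 : (3 : ℂ) * ((z + (2 * j : ℤ)) / 3) = z + (2 * j : ℤ) := by field_simp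
  rw [e3, E_even]
  push_cast at h1 h2 hd hs h6 ⊢
  rw [h1, h2, hs]
  rw [show (C : ℂ) * ((z + 2 * j) / 3) + d = (C * z + (3 * d + 2 * j * C)) / 3 by ring]
  generalize (C : ℂ) * z + (3 * d + 2 * j * C) = X at hd ⊢
  field_simp
  norm_num

lemma G_dn {A B C D : ℤ} (h : A * D - B * C = 1) {j : ℤ} (hj : (3 : ℤ) ∣ D - j * C) {z : ℂ}
    (hz : 0 < z.im) : 729 * G (mob A B C D z) = (G ((z + j) / 3))⁻¹ := by
  obtain ⟨d, hd⟩ := hj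
  rcases Int.even_or_odd' j with ⟨k, hk | hk⟩
  · have e1 : D = 3 * d + (2 * k) * C := by rw [← hk]; linarith
    rw [e1] at h
    have := G_dn_aux h hz
    rw [← e1, ← hk] at this
    exact this
  · have e1 : D = 3 * (d - C) + (2 * (k + 2)) * C := by
      have : D = 3 * d + j * C := by linarith
      rw [this, hk]; ring
    rw [e1] at h
    have := G_dn_aux h hz
    rw [← e1] at this
    rw [this]
    have e2 : (z + ((2 * (k + 2) : ℤ) : ℂ)) / 3 = (z + j) / 3 + (1 : ℤ) := by
      rw [hk]; push_cast; ring
    rw [e2, G_per]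

lemma u_up {A B c D : ℤ} (h : A * D - B * (2 * c) = 1) {z : ℂ} (hz : 0 < z.im) :
    u (mob A B (2 * c) D z) = u z := by
  unfold u
  have h1 := E_mob h hz
  have e1 := mob_up 2 A B c D z
  have h2 := E_mob (A := A) (B := 2 * B) (C := c) (D := D) (by rw [← h]; ring) (im_up hz 2 (by norm_num))
  rw [← e1] at h2
  have hd := den_ne h hz
  have h5 := E_ne hz
  push_cast at h1 h2 hd
  rw [h1, h2]
  simp only [mul_pow, sg_sq', one_mul]
  rw [show (c : ℂ) * (2 * z) + D = 2 * c * z + D by ring]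
  field_simp

lemma E_sq_per (z : ℂ) (j : ℤ) : E (z + j) ^ 2 = E z ^ 2 := by
  rcases Int.even_or_odd' j with ⟨k, hk | hk⟩
  · rw [hk, E_even]
  · have : z + j = (z + 1) + (2 * k : ℤ) := by rw [hk]; push_cast; ring
    rw [this, E_even, E_T]; ring

lemma u_dn {A B C D : ℤ} (h : A * D - B * C = 1) {j : ℤ} (hj : (2 : ℤ) ∣ D - j * C) {z : ℂ}
    (hz : 0 < z.im) : 4096 * u (mob A B C D z) = (u ((z + j) / 2))⁻¹ := by
  obtain ⟨d, hd⟩ := hj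
  have hD : D = 2 * d + j * C := by linarith
  subst hD
  have h1 := E_mob h hz
  have e1 := mob_dn 2 (by norm_num) A B C d j z
  have hw := im_dn hz 2 j (by norm_num)
  have h2 := E_mob (A := 2 * A) (B := B - j * A) (C := C) (D := d) (by rw [← h]; ring) hw
  rw [← e1] at h2
  have hd := den_ne h hz
  have h5 := E_ne hz
  have h6 := E_ne hw
  unfold u
  have e3 : (2 : ℂ) * ((z + j) / 2) = z + j := by field_simp
  rw [e3, E_sq_per]
  push_cast at h1 h2 hd h6 ⊢
  rw [h1, h2]
  simp only [mul_pow, sg_sq', one_mul]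
  rw [show (C : ℂ) * ((z + j) / 2) + d = (C * z + (2 * d + j * C)) / 2 by ring]
  generalize (C : ℂ) * z + (2 * d + j * C) = X at hd ⊢
  field_simp
  norm_num

/-- 6 | C -/
lemma t_66 {A B c D : ℤ} (h : A * D - B * (6 * c) = 1) {z : ℂ} (hz : 0 < z.im) :
    t (mob A B (6 * c) D z) = t z := by
  rw [t_G (mob_im_pos h hz), t_G hz]
  have e1 := mob_up 2 A B (3 * c) D z
  have e2 : (2 : ℤ) * (3 * c) = 6 * c := by ring
  rw [e2] at e1
  push_cast at e1
  rw [e1, G_up (by rw [← h]; ring) (by simpa using hz)]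
  rw [show (6 : ℤ) * c = 3 * (2 * c) by ring, G_up (by rw [← h]; ring) hz]

/-- 2 | C, 3 ∤ C -/
lemma t_2 {A B c D : ℤ} (h : A * D - B * (2 * c) = 1) {j : ℤ} (hj : (3 : ℤ) ∣ D - j * (2 * c)) {z : ℂ}
    (hz : 0 < z.im) : t (mob A B (2 * c) D z) = (t ((z + j) / 3))⁻¹ := by
  have hw := im_dn hz 3 j (by norm_num)
  push_cast at hw
  rw [t_G (mob_im_pos h hz), t_G hw]
  have e1 := mob_up 2 A B c D z
  push_cast at e1
  have h1 := G_dn h hj hz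
  have h2 := G_dn (A := A) (B := 2 * B) (C := c) (D := D) (by rw [← h]; ring) (j := 2 * j)
    (by rw [← mul_left_comm, ← mul_assoc] at hj; simpa [mul_comm, mul_assoc, mul_left_comm] using hj)
    (z := 2 * z) (by simpa using hz)
  rw [e1]
  rw [show (2 : ℂ) * ((z + j) / 3) = (2 * z + (2 * j : ℤ)) / 3 by push_cast; ring]
  have h3 : G (mob A B (2 * c) D z) = (G ((z + j) / 3))⁻¹ / 729 := by rw [← h1]; ring
  have h4 : G (mob A (2 * B) c D (2 * z)) = (G ((2 * z + (2 * j : ℤ)) / 3))⁻¹ / 729 := by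
    rw [← h2]; ring
  rw [h3, h4]
  have := G_ne hw
  field_simp

/-- 3 | C, C odd -/
lemma t_3 {A B c D : ℤ} (h : A * D - B * (3 * c) = 1) {i : ℤ} (hi : (2 : ℤ) ∣ D - i * (3 * c)) {z : ℂ}
    (hz : 0 < z.im) : t (mob A B (3 * c) D z) = (t ((z + i) / 2))⁻¹ := by
  have hw := im_dn hz 2 i (by norm_num)
  push_cast at hw
  rw [t_G (mob_im_pos h hz), t_G hw]
  obtain ⟨d, hd⟩ := hi
  have hD : D = 2 * d + i * (3 * c) := by linarith
  subst hD
  have e1 := mob_dn 2 (by norm_num) A B (3 * c) d i z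
  push_cast at e1
  rw [e1, G_up (by rw [← h]; ring) hw, G_up h hz]
  rw [show (2 : ℂ) * ((z + i) / 2) = z + i by field_simp, G_per, inv_div]

/-- C odd, 3 ∤ C -/
lemma t_1 {A B C D : ℤ} (h : A * D - B * C = 1) {i j : ℤ} (hi : (2 : ℤ) ∣ D - i * C)
    (hj : (3 : ℤ) ∣ (D - i * C) - 2 * j * C) {z : ℂ}
    (hz : 0 < z.im) : t (mob A B C D z) = t (((z + i) / 2 + j) / 3) := by
  have hw := im_dn hz 2 i (by norm_num)
  have hw' := im_dn hw 3 j (by norm_num)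
  obtain ⟨d, hd⟩ := hi
  have hD : D = 2 * d + i * C := by linarith
  subst hD
  have e1 := mob_dn 2 (by norm_num) A B C d i z
  push_cast at hw hw' e1
  rw [t_G (mob_im_pos h hz), t_G hw', e1]
  have hj2 : (3 : ℤ) ∣ d - j * C := by
    have : (3 : ℤ) ∣ 2 * (d - j * C) := by
      convert hj using 1; ring
    omega
  have h2 := G_dn (A := 2 * A) (B := B - i * A) (C := C) (D := d) (by rw [← h]; ring) hj2 hw
  have h1 := G_dn h (j := 2 * j + i) (by convert hj using 1; ring) hz
  have e2 : (2 : ℂ) * (((z + i) / 2 + j) / 3) = (z + (2 * j + i : ℤ)) / 3 := by push_cast; ring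
  rw [e2]
  have h3 : G (mob A B C (2 * d + i * C) z) = (G ((z + (2 * j + i : ℤ)) / 3))⁻¹ / 729 := by
    rw [← h1]; ring
  have h4 : G (mob (2 * A) (B - i * A) C d ((z + i) / 2)) = (G (((z + i) / 2 + j) / 3))⁻¹ / 729 := by
    rw [← h2]; ring
  rw [h3, h4]
  have := G_ne hw'
  field_simp

end C3A


namespace C3A
open Complex
open scoped UpperHalfPlane

/-- the replicate functions -/
noncomputable def cc (a : ℤ) (z : ℂ) : ℂ :=
  if 2 ∣ a then (if 3 ∣ a then 0 else 729 * G z) else (if 3 ∣ a then 4096 * u z else t z)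

/-- polar parts -/
noncomputable def pol (x y : ℤ) (z : ℂ) : ℂ :=
  if 2 ∣ y then (if 3 ∣ y then 0 else e (((x * y : ℤ) - z) / 3))
  else (if 3 ∣ y then e ((x - z) / 2) else 0)

lemma pol_0 {x y : ℤ} (h2 : 2 ∣ y) (h3 : 3 ∣ y) (z : ℂ) : pol x y z = 0 := by
  simp [pol, h2, h3]
lemma pol_1 {x y : ℤ} (h2 : ¬ 2 ∣ y) (h3 : ¬ 3 ∣ y) (z : ℂ) : pol x y z = 0 := by
  simp [pol, h2, h3]

lemma pol_3 {x y : ℤ} (h2 : 2 ∣ y) (h3 : ¬ 3 ∣ y) {k : ℤ} (hk : 3 ∣ x * y - k) (z : ℂ) :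
    pol x y z = e ((k - z) / 3) := by
  obtain ⟨m, hm⟩ := hk
  have : x * y = k + 3 * m := by linarith
  simp only [pol, h2, h3, if_true, if_false, this]
  rw [← e_add_int ((k - z) / 3) m]
  congr 1
  push_cast; ring

lemma pol_2 {x y : ℤ} (h2 : ¬ 2 ∣ y) (h3 : 3 ∣ y) {k : ℤ} (hk : 2 ∣ x - k) (z : ℂ) :
    pol x y z = e ((k - z) / 2) := by
  obtain ⟨m, hm⟩ := hk
  have : x = k + 2 * m := by linarith
  simp only [pol, h2, h3, if_true, if_false, this]
  rw [← e_add_int ((k - z) / 2) m]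
  congr 1
  push_cast; ring

lemma im_dn' (z : ℂ) (k j : ℤ) : ((z + j) / (k : ℂ)).im = (1 / k : ℝ) * z.im := by
  have h : ((z + j) / (k : ℂ)).im = z.im / k := by
    rw [show (k : ℂ) = ((k : ℝ) : ℂ) by push_cast; rfl, Complex.div_ofReal_im]; simp
  rw [h]; ring

lemma not3 {C : ℤ} (h : ¬ 3 ∣ C) : ∀ D : ℤ, 3 ∣ D - (D * C) * C := by
  intro D
  have h1 : (3 : ℤ) ∣ C * C - 1 := by
    rcases (by omega : C % 3 = 1 ∨ C % 3 = 2) with h | h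
    · have : C = 3 * (C / 3) + 1 := by omega
      rw [this]; exact ⟨3 * (C / 3) * (C / 3) + 2 * (C / 3), by ring⟩
    · have : C = 3 * (C / 3) + 2 := by omega
      rw [this]; exact ⟨3 * (C / 3) * (C / 3) + 4 * (C / 3) + 1, by ring⟩
  obtain ⟨m, hm⟩ := h1
  exact ⟨-D * m, by linear_combination (-D) * hm⟩

lemma not2 {C : ℤ} (h : ¬ 2 ∣ C) : ∀ D : ℤ, 2 ∣ D - D * C := by
  intro D
  obtain ⟨m, hm⟩ : (2 : ℤ) ∣ 1 - C := by omega
  exact ⟨D * m, by linear_combination D * hm⟩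

lemma dvd2_mul {a b : ℤ} : 2 ∣ a * b ↔ 2 ∣ a ∨ 2 ∣ b := Int.prime_two.dvd_mul
lemma dvd3_mul {a b : ℤ} : 3 ∣ a * b ↔ 3 ∣ a ∨ 3 ∣ b := Int.prime_three.dvd_mul

lemma BI_dn {f : ℂ → ℂ} (hf : BI f) (k j : ℤ) (hk : 0 < k) : BI (fun z => f ((z + j) / (k : ℂ))) := by
  have : (0 : ℝ) < k := by exact_mod_cast hk
  exact hf.comp (1 / k) (by positivity) _ (fun z => im_dn' z k j)

lemma cc_pol (a : ℤ) {A B C D : ℤ} (h : A * D - B * C = 1) :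
    BI (fun z => cc a (mob A B C D z) - pol (a * D) (-(a * C)) z) := by
  by_cases a2 : (2 : ℤ) ∣ a
  · have y2 : (2 : ℤ) ∣ -(a * C) := by rw [Int.dvd_neg, dvd2_mul]; exact Or.inl a2
    by_cases a3 : (3 : ℤ) ∣ a
    · have y3 : (3 : ℤ) ∣ -(a * C) := by rw [Int.dvd_neg, dvd3_mul]; exact Or.inl a3
      simp only [cc, a2, a3, if_true, pol_0 y2 y3, sub_zero]
      exact BI.const 0
    · simp only [cc, a2, a3, if_true, if_false]
      by_cases c3 : (3 : ℤ) ∣ C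
      · have y3 : (3 : ℤ) ∣ -(a * C) := by rw [Int.dvd_neg, dvd3_mul]; exact Or.inr c3
        obtain ⟨c, rfl⟩ := c3
        refine ((BI.const 729).mul BI_G).congr ?_
        intro z hz
        rw [G_up h hz, pol_0 y2 y3, sub_zero]
      · have y3 : ¬ (3 : ℤ) ∣ -(a * C) := by rw [Int.dvd_neg, dvd3_mul]; tauto
        have hj := not3 c3 D
        refine (BI_dn BI_Gi 3 (D * C) (by norm_num)).congr ?_
        intro z hz
        rw [G_dn h hj hz, pol_3 y2 y3 (k := -(D * C))]
        · push_cast; ring_nf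
        · have := not3 a3 (D * C)
          obtain ⟨m, hm⟩ := this
          exact ⟨m, by linear_combination hm⟩
  · by_cases a3 : (3 : ℤ) ∣ a
    · have y3 : (3 : ℤ) ∣ -(a * C) := by rw [Int.dvd_neg, dvd3_mul]; exact Or.inl a3
      simp only [cc, a2, a3, if_true, if_false]
      by_cases c2 : (2 : ℤ) ∣ C
      · have y2 : (2 : ℤ) ∣ -(a * C) := by rw [Int.dvd_neg, dvd2_mul]; exact Or.inr c2
        obtain ⟨c, rfl⟩ := c2
        refine ((BI.const 4096).mul BI_u).congr ?_
        intro z hz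
        rw [u_up h hz, pol_0 y2 y3, sub_zero]
      · have y2 : ¬ (2 : ℤ) ∣ -(a * C) := by rw [Int.dvd_neg, dvd2_mul]; tauto
        have hj := not2 c2 D
        refine (BI_dn BI_ui 2 D (by norm_num)).congr ?_
        intro z hz
        rw [u_dn h hj hz, pol_2 y2 y3 (k := -D)]
        · push_cast; ring_nf
        · have := not2 a2 D
          obtain ⟨m, hm⟩ := this
          exact ⟨D - m, by linear_combination -hm⟩
    · simp only [cc, a2, a3, if_false]
      by_cases c2 : (2 : ℤ) ∣ C
      · have y2 : (2 : ℤ) ∣ -(a * C) := by rw [Int.dvd_neg, dvd2_mul]; exact Or.inr c2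
        by_cases c3 : (3 : ℤ) ∣ C
        · have y3 : (3 : ℤ) ∣ -(a * C) := by rw [Int.dvd_neg, dvd3_mul]; exact Or.inr c3
          obtain ⟨c, rfl⟩ : (6 : ℤ) ∣ C := by omega
          refine BI_t.congr ?_
          intro z hz
          rw [t_66 h hz, pol_0 y2 y3, sub_zero]
        · have y3 : ¬ (3 : ℤ) ∣ -(a * C) := by rw [Int.dvd_neg, dvd3_mul]; tauto
          have hj := not3 c3 D
          obtain ⟨c, rfl⟩ := c2
          refine (BI_dn BI_ti 3 (D * (2 * c)) (by norm_num)).congr ?_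
          intro z hz
          rw [t_2 h hj hz, pol_3 y2 y3 (k := -(D * (2 * c)))]
          · push_cast; ring_nf
          · have := not3 a3 (D * (2 * c))
            obtain ⟨m, hm⟩ := this
            exact ⟨m, by linear_combination hm⟩
      · have y2 : ¬ (2 : ℤ) ∣ -(a * C) := by rw [Int.dvd_neg, dvd2_mul]; tauto
        have hi := not2 c2 D
        by_cases c3 : (3 : ℤ) ∣ C
        · have y3 : (3 : ℤ) ∣ -(a * C) := by rw [Int.dvd_neg, dvd3_mul]; exact Or.inr c3
          obtain ⟨c, rfl⟩ := c3
          refine (BI_dn BI_ti 2 D (by norm_num)).congr ?_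
          intro z hz
          rw [t_3 h hi hz, pol_2 y2 y3 (k := -D)]
          · push_cast; ring_nf
          · have := not2 a2 D
            obtain ⟨m, hm⟩ := this
            exact ⟨D - m, by linear_combination -hm⟩
        · have y3 : ¬ (3 : ℤ) ∣ -(a * C) := by rw [Int.dvd_neg, dvd3_mul]; tauto
          have hj : (3 : ℤ) ∣ (D - D * C) - 2 * (2 * (D - D * C) * C) * C := by
            obtain ⟨m, hm⟩ := not3 c3 (D - D * C)
            exact ⟨4 * m - (D - D * C), by linear_combination 4 * hm⟩
          refine (BI_dn (BI_dn BI_t 3 (2 * (D - D * C) * C) (by norm_num)) 2 D (by norm_num)).congr ?_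
          intro z hz
          rw [t_1 h hi hj hz, pol_1 y2 y3, sub_zero]
          push_cast
          rfl

lemma cc_inv (a : ℤ) {A B C D : ℤ} (h : A * D - B * C = 1) (hC : 6 ∣ C) {z : ℂ} (hz : 0 < z.im) :
    cc a (mob A B C D z) = cc a z := by
  obtain ⟨c, rfl⟩ := hC
  unfold cc
  split_ifs
  · rfl
  · rw [show 6 * c = 3 * (2 * c) by ring] at h ⊢
    rw [G_up h hz]
  · rw [show 6 * c = 2 * (3 * c) by ring] at h ⊢
    rw [u_up h hz]
  · rw [t_66 h hz]

lemma cc_diff (a : ℤ) {z : ℂ} (hz : 0 < z.im) : DifferentiableAt ℂ (cc a) z := by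
  unfold cc
  split_ifs
  · exact differentiableAt_const _
  · exact (G_diff hz).const_mul _
  · exact (u_diff hz).const_mul _
  · exact t_diff hz

end C3A


namespace C3A
open Complex
open scoped UpperHalfPlane

/-- upper triangular substitution -/
noncomputable def tri (a b d : ℤ) (z : ℂ) : ℂ := (a * z + b) / d

lemma tri_im (a b d : ℤ) (z : ℂ) : (tri a b d z).im = (a / d : ℝ) * z.im := by
  unfold tri
  rw [show (d : ℂ) = ((d : ℝ) : ℂ) by push_cast; rfl, Complex.div_ofReal_im]
  simp; ring

lemma tri_im_pos {a b d : ℤ} (ha : 0 < a) (hd : 0 < d) {z : ℂ} (hz : 0 < z.im) :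
    0 < (tri a b d z).im := by
  have : (0 : ℝ) < a := by exact_mod_cast ha
  have : (0 : ℝ) < d := by exact_mod_cast hd
  rw [tri_im]; positivity

/-- `f ∘ M` is invariant under `Γ(6n)` if `f` is under `Γ₀(6)` -/
lemma tri_inv {f : ℂ → ℂ} (hf : ∀ A B C D : ℤ, A * D - B * C = 1 → 6 ∣ C → ∀ z : ℂ, 0 < z.im →
      f (mob A B C D z) = f z) {a b d : ℤ} (ha : 0 < a) (hd : 0 < d)
    {A B C D : ℤ} (h : A * D - B * C = 1) (hA : 6 * (a * d) ∣ A - 1) (hB : 6 * (a * d) ∣ B)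
    (hC : 6 * (a * d) ∣ C) (hD : 6 * (a * d) ∣ D - 1) {z : ℂ} (hz : 0 < z.im) :
    f (tri a b d (mob A B C D z)) = f (tri a b d z) := by
  obtain ⟨A', hA⟩ := hA
  obtain ⟨B', rfl⟩ := hB
  obtain ⟨C', rfl⟩ := hC
  obtain ⟨D', hD⟩ := hD
  have hA2 : A = 1 + 6 * (a * d) * A' := by linarith
  have hD2 : D = 1 + 6 * (a * d) * D' := by linarith
  have hdet : (A + 6 * b * d * C') * (D - 6 * b * d * C') -
    (a * b * 6 * (D' - A') - 6 * b ^ 2 * C' + 6 * a ^ 2 * B') * (6 * (d ^ 2 * C')) = 1 := by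
    rw [← h, hA2, hD2]; ring
  rw [← hf _ _ _ _ hdet (Dvd.intro _ rfl) _ (tri_im_pos ha hd hz)]
  congr 1
  have hz1 := den_ne h hz
  have hz2 := den_ne hdet (tri_im_pos (b := b) ha hd hz)
  have hd0 : (d : ℂ) ≠ 0 := by exact_mod_cast hd.ne'
  have ha0 : (a : ℂ) ≠ 0 := by exact_mod_cast ha.ne'
  have e1 : ((6 * (d ^ 2 * C') : ℤ) : ℂ) * tri a b d z + ((D - 6 * b * d * C' : ℤ) : ℂ)
     = ((6 * (a * d) * C' : ℤ) : ℂ) * z + D := by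
    unfold tri; push_cast; field_simp; ring
  have e2 : ((A + 6 * b * d * C' : ℤ) : ℂ) * tri a b d z +
      ((a * b * 6 * (D' - A') - 6 * b ^ 2 * C' + 6 * a ^ 2 * B' : ℤ) : ℂ)
     = (a * (A * z + (6 * (a * d) * B' : ℤ)) + b * (((6 * (a * d) * C' : ℤ) : ℂ) * z + D)) / d := by
    rw [hA2, hD2]; unfold tri; push_cast; field_simp; ring
  unfold mob
  rw [e1, e2]
  generalize ((6 * (a * d) * C' : ℤ) : ℂ) * z + D = X at hz1
  unfold tri
  field_simp

/-- Hermite normal form -/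
lemma hnf {p r s w n : ℤ} (hn : 0 < n) (h : p * w - r * s = n) :
    ∃ a b d A B C D : ℤ, 0 < a ∧ 0 ≤ b ∧ b < d ∧ a * d = n ∧ A * D - B * C = 1 ∧
      p = A * a ∧ s = C * a ∧ r = A * b + B * d ∧ w = C * b + D * d := by
  have hg0 : 0 < Int.gcd p s := by
    rw [Nat.pos_iff_ne_zero]
    intro h0
    rw [Int.gcd_eq_zero_iff] at h0
    rw [h0.1, h0.2] at h; simp at h; omega
  obtain ⟨p', hp⟩ := Int.gcd_dvd_left p s
  obtain ⟨s', hs⟩ := Int.gcd_dvd_right p s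
  have hbez := Int.gcd_eq_gcd_ab p s
  set g : ℤ := (Int.gcd p s : ℤ) with hg
  set α := Int.gcdA p s
  set β := Int.gcdB p s
  have hg1 : 0 < g := by rw [hg]; exact_mod_cast hg0
  have hb : p' * α + s' * β = 1 := by
    have : g * (p' * α + s' * β) = g * 1 := by
      rw [mul_add, ← mul_assoc, ← mul_assoc, ← hp, ← hs, mul_one]; exact hbez.symm
    exact mul_left_cancel₀ hg1.ne' this
  set d := p' * w - s' * r with hd
  have hgd : g * d = n := by
    rw [← h, hd, mul_sub, ← mul_assoc, ← mul_assoc, ← hp, ← hs]; ring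
  have hd0 : 0 < d := by
    by_contra hcon
    push Not at hcon
    nlinarith
  set b0 := α * r + β * w with hb0
  refine ⟨g, b0 % d, d, p', -β + (b0 / d) * p', s', α + (b0 / d) * s', hg1,
    Int.emod_nonneg _ hd0.ne', Int.emod_lt_of_pos _ hd0, hgd, ?_, ?_, ?_, ?_, ?_⟩
  · linear_combination hb
  · linear_combination hp
  · linear_combination hs
  · have := Int.emod_add_mul_ediv b0 d
    have e1 : r = p' * b0 - β * d := by rw [hb0, hd]; linear_combination (-r) * hb
    linear_combination e1 - p' * this
  · have := Int.emod_add_mul_ediv b0 d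
    have e1 : w = s' * b0 + α * d := by rw [hb0, hd]; linear_combination (-w) * hb
    linear_combination e1 - s' * this

/-- index set -/
def S (n : ℕ) : Finset (Σ _ : ℕ × ℕ, ℕ) := n.divisorsAntidiagonal.sigma (fun p => Finset.range p.2)

lemma mem_S {n : ℕ} {M : Σ _ : ℕ × ℕ, ℕ} : M ∈ S n ↔ (M.1.1 * M.1.2 = n ∧ n ≠ 0) ∧ M.2 < M.1.2 := by
  simp [S]

lemma S_pos {n : ℕ} {M : Σ _ : ℕ × ℕ, ℕ} (h : M ∈ S n) : 0 < M.1.1 ∧ 0 < M.1.2 := by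
  rw [mem_S] at h
  obtain ⟨⟨h1, h2⟩, h3⟩ := h
  constructor
  · rw [Nat.pos_iff_ne_zero]; intro h0; rw [h0] at h1; simp at h1; exact h2 h1.symm
  · omega

/-- twisted Hecke operator -/
noncomputable def N (n : ℕ) (z : ℂ) : ℂ := ∑ M ∈ S n, cc M.1.1 (tri M.1.1 M.2 M.1.2 z)

lemma exists_map {n : ℕ} {A B C D : ℤ} (h : A * D - B * C = 1) (M : Σ _ : ℕ × ℕ, ℕ) (hM : M ∈ S n) :
    ∃ M' ∈ S n, ∃ A' B' C' D' : ℤ, A' * D' - B' * C' = 1 ∧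
      M.1.1 * A + M.2 * C = A' * M'.1.1 ∧ M.1.2 * C = C' * M'.1.1 ∧
      M.1.1 * B + M.2 * D = A' * M'.2 + B' * M'.1.2 ∧ M.1.2 * D = C' * M'.2 + D' * M'.1.2 := by
  obtain ⟨⟨a, d⟩, b⟩ := M
  have h0 := S_pos hM
  rw [mem_S] at hM
  obtain ⟨⟨h1, h2⟩, h3⟩ := hM
  simp only at h0 h1 h2 h3 ⊢
  have hdet : ((a : ℤ) * A + b * C) * (d * D) - (a * B + b * D) * (d * C) = n := by
    rw [← h1]; push_cast; linear_combination (a * d : ℤ) * h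
  obtain ⟨a', b', d', A', B', C', D', ha, hb, hbd, had, hdet', e1, e2, e3, e4⟩ :=
    hnf (by positivity) hdet
  lift a' to ℕ using ha.le
  lift b' to ℕ using hb
  lift d' to ℕ using by omega
  refine ⟨⟨⟨a', d'⟩, b'⟩, ?_, A', B', C', D', hdet', e1, e2, e3, e4⟩
  rw [mem_S]
  exact ⟨⟨by exact_mod_cast had, h2⟩, by exact_mod_cast hbd⟩

lemma hnf_unique {a b d a' b' d' : ℤ} {A B C D : ℤ} (hdet : A * D - B * C = 1)
    (ha : 0 < a) (ha' : 0 < a') (hd : 0 < d) (hd' : 0 < d')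
    (hb : 0 ≤ b) (hbd : b < d) (hb' : 0 ≤ b') (hbd' : b' < d')
    (e1 : a = A * a') (e2 : 0 = C * a') (e3 : b = A * b' + B * d') (e4 : d = C * b' + D * d') :
    a = a' ∧ b = b' ∧ d = d' := by
  have hC : C = 0 := by
    rcases mul_eq_zero.mp e2.symm with h | h
    · exact h
    · omega
  subst hC
  simp at hdet e4
  have hA : 0 < A := by
    by_contra hcon; push Not at hcon; nlinarith
  have hA1 : A = 1 := by
    rcases Int.eq_one_or_neg_one_of_mul_eq_one hdet with h | h <;> omega
  subst hA1
  have hD : D = 1 := by linarith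
  subst hD
  simp at e1 e4 e3
  refine ⟨e1, ?_, e4⟩
  subst e4
  have : B = 0 := by
    rcases lt_trichotomy B 0 with h | h | h
    · nlinarith
    · exact h
    · nlinarith
  subst this; linarith

lemma map_inj {n : ℕ} {A B C D : ℤ} (h : A * D - B * C = 1) {M1 M2 M' : Σ _ : ℕ × ℕ, ℕ}
    (hM1 : M1 ∈ S n) (hM2 : M2 ∈ S n)
    (h1 : ∃ A' B' C' D' : ℤ, A' * D' - B' * C' = 1 ∧
      M1.1.1 * A + M1.2 * C = A' * M'.1.1 ∧ M1.1.2 * C = C' * M'.1.1 ∧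
      M1.1.1 * B + M1.2 * D = A' * M'.2 + B' * M'.1.2 ∧ M1.1.2 * D = C' * M'.2 + D' * M'.1.2)
    (h2 : ∃ A' B' C' D' : ℤ, A' * D' - B' * C' = 1 ∧
      M2.1.1 * A + M2.2 * C = A' * M'.1.1 ∧ M2.1.2 * C = C' * M'.1.1 ∧
      M2.1.1 * B + M2.2 * D = A' * M'.2 + B' * M'.1.2 ∧ M2.1.2 * D = C' * M'.2 + D' * M'.1.2) :
    M1 = M2 := by
  obtain ⟨A1, B1, C1, D1, k1, l1, l2, l3, l4⟩ := h1
  obtain ⟨A2, B2, C2, D2, k2, m1, m2, m3, m4⟩ := h2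
  have p1 := S_pos hM1
  have p2 := S_pos hM2
  rw [mem_S] at hM1 hM2
  obtain ⟨⟨a1, d1⟩, b1⟩ := M1
  obtain ⟨⟨a2, d2⟩, b2⟩ := M2
  obtain ⟨⟨a', d'⟩, b'⟩ := M'
  simp only at *
  have u1 : (a1 : ℤ) = A1 * (a' * D - b' * C) + B1 * (-d' * C) := by
    linear_combination (-a1 : ℤ) * h + D * l1 - C * l3
  have u2 : (0 : ℤ) = C1 * (a' * D - b' * C) + D1 * (-d' * C) := by
    linear_combination D * l2 - C * l4
  have u3 : (b1 : ℤ) = A1 * (-a' * B + b' * A) + B1 * (d' * A) := by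
    linear_combination (-b1 : ℤ) * h - B * l1 + A * l3
  have u4 : (d1 : ℤ) = C1 * (-a' * B + b' * A) + D1 * (d' * A) := by
    linear_combination (-d1 : ℤ) * h - B * l2 + A * l4
  have v1 : (a2 : ℤ) = A2 * (a' * D - b' * C) + B2 * (-d' * C) := by
    linear_combination (-a2 : ℤ) * h + D * m1 - C * m3
  have v2 : (0 : ℤ) = C2 * (a' * D - b' * C) + D2 * (-d' * C) := by
    linear_combination D * m2 - C * m4
  have v3 : (b2 : ℤ) = A2 * (-a' * B + b' * A) + B2 * (d' * A) := by
    linear_combination (-b2 : ℤ) * h - B * m1 + A * m3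
  have v4 : (d2 : ℤ) = C2 * (-a' * B + b' * A) + D2 * (d' * A) := by
    linear_combination (-d2 : ℤ) * h - B * m2 + A * m4
  generalize (a' : ℤ) * D - b' * C = x at u1 u2 v1 v2
  generalize -(d' : ℤ) * C = y at u1 u2 v1 v2
  generalize -(a' : ℤ) * B + b' * A = x2 at u3 u4 v3 v4
  generalize (d' : ℤ) * A = y2 at u3 u4 v3 v4
  have w1 : x = D2 * a2 := by linear_combination (-x) * k2 - D2 * v1 + B2 * v2
  have w2 : y = -C2 * a2 := by linear_combination (-y) * k2 + C2 * v1 - A2 * v2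
  have w3 : x2 = D2 * b2 - B2 * d2 := by linear_combination (-x2) * k2 - D2 * v3 + B2 * v4
  have w4 : y2 = -C2 * b2 + A2 * d2 := by linear_combination (-y2) * k2 + C2 * v3 - A2 * v4
  have key := hnf_unique (a := a1) (b := b1) (d := d1) (a' := a2) (b' := b2) (d' := d2)
    (A := A1 * D2 - B1 * C2) (B := -A1 * B2 + B1 * A2) (C := C1 * D2 - D1 * C2)
    (D := -C1 * B2 + D1 * A2)
    (by linear_combination k1 + (A1 * D1 - B1 * C1) * (k2) )
    (by omega) (by omega) (by omega) (by omega) (by omega) (by omega) (by omega) (by omega)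
    ?_ ?_ ?_ ?_
  · obtain ⟨q1, q2, q3⟩ := key
    have q1' : a1 = a2 := by exact_mod_cast q1
    have q2' : b1 = b2 := by exact_mod_cast q2
    have q3' : d1 = d2 := by exact_mod_cast q3
    subst q1' q2' q3'; rfl
  · rw [u1, w1, w2]; ring
  · conv_lhs => rw [u2, w1, w2]
    ring
  · rw [u3, w3, w4]; ring
  · rw [u4, w3, w4]; ring

lemma N_diff (n : ℕ) : DifferentiableOn ℂ (N n) {z | 0 < z.im} := by
  intro z hz
  refine DifferentiableAt.differentiableWithinAt ?_
  have : N n = fun z => ∑ M ∈ S n, cc M.1.1 (tri M.1.1 M.2 M.1.2 z) := rfl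
  rw [this]
  refine DifferentiableAt.fun_sum ?_
  intro M hM
  have hp := S_pos hM
  refine DifferentiableAt.comp z (cc_diff _ ?_) ?_
  · exact tri_im_pos (by exact_mod_cast hp.1) (by exact_mod_cast hp.2) hz
  · unfold tri; fun_prop

lemma N_inv (n : ℕ) {A B C D : ℤ} (h : A * D - B * C = 1) (hA : ((6 * n : ℕ) : ℤ) ∣ A - 1)
    (hB : ((6 * n : ℕ) : ℤ) ∣ B) (hC : ((6 * n : ℕ) : ℤ) ∣ C) (hD : ((6 * n : ℕ) : ℤ) ∣ D - 1)
    {z : ℂ} (hz : 0 < z.im) : N n (mob A B C D z) = N n z := by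
  refine Finset.sum_congr rfl ?_
  intro M hM
  have hp := S_pos hM
  rw [mem_S] at hM
  have e1 : ((6 * n : ℕ) : ℤ) = 6 * ((M.1.1 : ℤ) * M.1.2) := by
    rw [← hM.1.1]; push_cast; ring
  rw [e1] at hA hB hC hD
  exact tri_inv (fun A B C D h h6 z hz => cc_inv _ h h6 hz) (by exact_mod_cast hp.1)
    (by exact_mod_cast hp.2) h hA hB hC hD hz

lemma N_cusp (n : ℕ) {A B C D : ℤ} (h : A * D - B * C = 1) :
    BI (fun z => N n (mob A B C D z) -
      ∑ M ∈ S n, pol (M.1.1 * D + M.2 * (-C)) (M.1.2 * (-C)) (tri M.1.1 M.2 M.1.2 z)) := by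
  choose! φ hφ hφ2 using exists_map (n := n) h
  have hinj : Set.InjOn φ (S n) := by
    intro M1 h1 M2 h2 he
    have k1 := hφ2 M1 h1
    have k2 := hφ2 M2 h2
    rw [he] at k1
    exact map_inj h h1 h2 k1 k2
  have hmaps : Set.MapsTo φ (S n) (S n) := hφ
  have hsurj : Set.SurjOn φ (S n) (S n) :=
    Finset.surjOn_of_injOn_of_card_le φ hmaps hinj le_rfl
  have hsum : ∀ z, ∑ M ∈ S n, pol (M.1.1 * D + M.2 * (-C)) (M.1.2 * (-C)) (tri M.1.1 M.2 M.1.2 z)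
    = ∑ M ∈ S n, pol ((φ M).1.1 * D + (φ M).2 * (-C)) ((φ M).1.2 * (-C))
        (tri (φ M).1.1 (φ M).2 (φ M).1.2 z) := by
    intro z
    refine (Finset.sum_nbij φ hφ hinj hsurj ?_).symm
    intro M _; rfl
  have : BI (fun z => ∑ M ∈ S n, (cc M.1.1 (tri M.1.1 M.2 M.1.2 (mob A B C D z)) -
      pol ((φ M).1.1 * D + (φ M).2 * (-C)) ((φ M).1.2 * (-C))
        (tri (φ M).1.1 (φ M).2 (φ M).1.2 z))) := by
    refine BI.sum _ ?_
    intro M hM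
    obtain ⟨A', B', C', D', hdet, l1, l2, l3, l4⟩ := hφ2 M hM
    have hp := S_pos hM
    have hp' := S_pos (hφ M hM)
    obtain ⟨⟨a, d⟩, b⟩ := M
    generalize φ ⟨⟨a, d⟩, b⟩ = M' at *
    obtain ⟨⟨a', d'⟩, b'⟩ := M'
    simp only at *
    have e1 : (a' : ℤ) * D + b' * -C = a * D' := by
      linear_combination (D' * a) * h - (a' * D - b' * C) * hdet - (D' * D) * l1 + (D' * C) * l3
        + B' * D * l2 - B' * C * l4
    have e2 : (d' : ℤ) * -C = -(a * C') := by
      linear_combination (-C' * a) * h + (d' * C) * hdet + (C' * D) * l1 - (C' * C) * l3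
        - A' * D * l2 + A' * C * l4
    have hBI := cc_pol (a : ℤ) hdet
    have q1 : (0 : ℝ) < a' := by exact_mod_cast hp'.1
    have q2 : (0 : ℝ) < d' := by exact_mod_cast hp'.2
    refine (hBI.comp (a' / d') (by positivity) (tri a' b' d')
      (fun z => by rw [tri_im]; push_cast; rfl)).congr ?_
    intro z hz
    rw [e1, e2]
    congr 2
    have hz' : 0 < (tri a' b' d' z).im :=
      tri_im_pos (by exact_mod_cast hp'.1) (by exact_mod_cast hp'.2) hz
    have n1 := den_ne h hz
    have n2 := den_ne hdet hz'
    have n3 : (d : ℂ) ≠ 0 := by exact_mod_cast hp.2.ne'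
    have n4 : (d' : ℂ) ≠ 0 := by exact_mod_cast hp'.2.ne'
    have c1 := congrArg (Int.cast : ℤ → ℂ) l1
    have c2 := congrArg (Int.cast : ℤ → ℂ) l2
    have c3 := congrArg (Int.cast : ℤ → ℂ) l3
    have c4 := congrArg (Int.cast : ℤ → ℂ) l4
    push_cast at c1 c2 c3 c4
    have f1 : (C' : ℂ) * tri a' b' d' z + D' = d * (C * z + D) / d' := by
      unfold tri; push_cast; field_simp; linear_combination (-z) * c2 - c4
    have f2 : (A' : ℂ) * tri a' b' d' z + B' = (a * (A * z + B) + b * (C * z + D)) / d' := by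
      unfold tri; push_cast; field_simp; linear_combination (-z) * c1 - c3
    unfold mob
    rw [f1, f2]
    generalize (C : ℂ) * z + D = X at *
    unfold tri
    push_cast
    field_simp
  refine this.congr ?_
  intro z hz
  rw [hsum, Finset.sum_sub_distrib]
  rfl

end C3A


namespace C3A
open Complex
open scoped UpperHalfPlane

lemma e_eq_one {x : ℂ} (h : e x = 1) : ∃ n : ℤ, x = n := by
  unfold e at h
  rw [Complex.exp_eq_one_iff] at h
  obtain ⟨n, hn⟩ := h
  refine ⟨n, ?_⟩
  have := Complex.two_pi_I_ne_zero
  rw [mul_comm] at hn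
  exact mul_right_cancel₀ this hn

lemma root_sum {d : ℕ} (hd : 1 < d) (k : ℤ) (hk : IsCoprime k (d : ℤ)) :
    ∑ b ∈ Finset.range d, e (b * (k / d)) = 0 := by
  have hd0 : (d : ℂ) ≠ 0 := by exact_mod_cast (by omega : d ≠ 0)
  have h1 : e (k / d) ≠ 1 := by
    intro h
    obtain ⟨m, hm⟩ := e_eq_one h
    rw [div_eq_iff hd0] at hm
    have hm' : k = m * d := by exact_mod_cast hm
    rw [hm'] at hk
    have : IsUnit (d : ℤ) := hk.isUnit_of_dvd' (Dvd.intro_left _ rfl) dvd_rfl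
    rw [Int.ofNat_isUnit, Nat.isUnit_iff] at this
    omega
  have h2 : e (k / d) ^ d = 1 := by
    rw [← e_nat_mul, mul_div_cancel₀ _ hd0, e_int]
  simp only [e_nat_mul]
  rw [geom_sum_eq h1, h2]
  simp

lemma pol_inner {d : ℕ} (hd : 1 < d) (a : ℕ) (x y : ℤ) (z : ℂ) :
    ∑ b ∈ Finset.range d, pol (a * x + b * y) (d * y) (tri a b d z) = 0 := by
  have hd0 : (d : ℂ) ≠ 0 := by exact_mod_cast (by omega : d ≠ 0)
  by_cases h2 : (2 : ℤ) ∣ d * y <;> by_cases h3 : (3 : ℤ) ∣ d * y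
  · exact Finset.sum_eq_zero fun b _ => pol_0 h2 h3 _
  · obtain ⟨m, hm⟩ := not3 h3 1
    -- 1 - (dy)^2 = 3 m
    have hc : IsCoprime (-m) (d : ℤ) := ⟨-3, (d : ℤ) * y ^ 2, by linear_combination -hm⟩
    have := root_sum hd _ hc
    have e1 : ∀ b : ℕ, pol (a * x + b * y) (d * y) (tri a b d z)
      = e (((a * x * (d * y) : ℤ) - a * z / d) / 3) * e (b * (((-m : ℤ) : ℂ) / d)) := by
      intro b
      have hm' := congrArg (Int.cast : ℤ → ℂ) hm
      push_cast at hm'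
      simp only [pol, h2, h3, if_true, if_false]
      rw [← e_add]
      congr 1
      unfold tri
      push_cast
      field_simp
      linear_combination (-b : ℂ) * hm'
    simp only [e1]
    rw [← Finset.mul_sum, this, mul_zero]
  · obtain ⟨m, hm⟩ : (2 : ℤ) ∣ d * y - 1 := by omega
    have hc : IsCoprime m (d : ℤ) := ⟨-2, y, by linear_combination hm⟩
    have := root_sum hd _ hc
    have e1 : ∀ b : ℕ, pol (a * x + b * y) (d * y) (tri a b d z)
      = e (((a * x : ℤ) - a * z / d) / 2) * e (b * (((m : ℤ) : ℂ) / d)) := by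
      intro b
      have hm' := congrArg (Int.cast : ℤ → ℂ) hm
      push_cast at hm'
      simp only [pol, h2, h3, if_true, if_false]
      rw [← e_add]
      congr 1
      unfold tri
      push_cast
      field_simp
      linear_combination (b : ℂ) * hm'
    simp only [e1]
    rw [← Finset.mul_sum, this, mul_zero]
  · exact Finset.sum_eq_zero fun b _ => pol_1 h2 h3 _

lemma pol_pow (n : ℕ) (hn : n ≠ 0) (x y : ℤ) (z : ℂ) : pol (n * x) y (n * z) = pol x y z ^ n := by
  unfold pol
  split_ifs
  · rw [zero_pow hn]
  · rw [← e_nat_mul]; congr 1; push_cast; ring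
  · rw [← e_nat_mul]; congr 1; push_cast; ring
  · rw [zero_pow hn]

lemma pol_sum (n : ℕ) (hn : n ≠ 0) (x y : ℤ) (z : ℂ) :
    ∑ M ∈ S n, pol (M.1.1 * x + M.2 * y) (M.1.2 * y) (tri M.1.1 M.2 M.1.2 z) = pol x y z ^ n := by
  unfold S
  rw [Finset.sum_sigma]
  rw [Finset.sum_eq_single (n, 1)]
  · simp only [Finset.range_one, Finset.sum_singleton]
    rw [← pol_pow n hn]
    simp [tri]
  · rintro ⟨a, d⟩ hp hne
    rw [Nat.mem_divisorsAntidiagonal] at hp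
    simp only at hp ⊢
    have hd : 1 < d := by
      rcases Nat.lt_or_ge 1 d with h | h
      · exact h
      · exfalso
        interval_cases d
        · simp at hp; omega
        · simp at hp; exact hne (by rw [hp.1])
    have := pol_inner hd a x y z
    exact_mod_cast this
  · intro h
    simp [hn] at h

lemma N_cusp' (n : ℕ) (hn : n ≠ 0) {A B C D : ℤ} (h : A * D - B * C = 1) :
    BI (fun z => N n (mob A B C D z) - pol D (-C) z ^ n) := by
  refine (N_cusp n h).congr ?_
  intro z _
  rw [pol_sum n hn]

lemma t_cusp {A B C D : ℤ} (h : A * D - B * C = 1) :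
    BI (fun z => t (mob A B C D z) - pol D (-C) z) := by
  have := cc_pol 1 h
  simp only [cc, one_mul] at this
  norm_num at this
  exact this

/-- `η_{-g}` inverse -/
noncomputable def hh (z : ℂ) : ℂ := (t z)⁻¹

end C3A


namespace C3A
open Complex Filter Topology
open scoped UpperHalfPlane

/-- Faber-type polynomials -/
noncomputable def R (c : ℕ → ℂ) (w : ℂ) : ℕ → ℂ
  | 0 => 0
  | n + 1 => w * ((n + 1) * c (n + 1) + ∑ j : Fin n, c (j + 1) * R c w (n - j))
decreasing_by omega

lemma R_zero (c : ℕ → ℂ) (w : ℂ) : R c w 0 = 0 := by rw [R]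

lemma R_succ (c : ℕ → ℂ) (w : ℂ) (n : ℕ) : R c w (n + 1) =
    w * ((n + 1) * c (n + 1) + ∑ j ∈ Finset.range n, c (j + 1) * R c w (n - j)) := by
  rw [R, Finset.sum_range]

lemma R_at_zero (c : ℕ → ℂ) (n : ℕ) : R c 0 n = 0 := by
  cases n with
  | zero => exact R_zero _ _
  | succ n => rw [R_succ, zero_mul]

lemma R_diff (c : ℕ → ℂ) (n : ℕ) : Differentiable ℂ (fun w => R c w n) := by
  induction n using Nat.strong_induction_on with
  | _ n ih =>
    cases n with
    | zero => simp only [R_zero]; exact differentiable_const _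
    | succ n =>
      simp only [R_succ]
      refine differentiable_id.mul ((differentiable_const _).add ?_)
      refine Differentiable.fun_sum ?_
      intro j hj
      exact (ih (n - j) (by omega)).const_mul _

/-- abstract Faber identity -/
lemma faber_K (c V : ℕ → ℂ) (q : ℂ) (hq : q ≠ 0) (hV0 : V 0 ≠ 0)
    (hV : ∀ i, V i = c (i + 1) + q * V (i + 1)) (n : ℕ) :
    ∑ j ∈ Finset.range n, V j * (R c (q * V 0)⁻¹ (n - j) - (q⁻¹) ^ (n - j)) + n * V n = 0 := by
  set w := (q * V 0)⁻¹ with hw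
  have hK : ∀ n : ℕ, ∑ j ∈ Finset.range n, V j * R c w (n - j) + n * V n =
      ∑ j ∈ Finset.range n, V j * (q⁻¹) ^ (n - j) := by
    intro n
    induction n with
    | zero => simp
    | succ n ih =>
      have h1 : q * V 0 * R c w (n + 1) =
          (n + 1) * c (n + 1) + ∑ j ∈ Finset.range n, c (j + 1) * R c w (n - j) := by
        rw [R_succ, hw, mul_inv_cancel_left₀ (mul_ne_zero hq hV0)]
      have h2 : ∑ j ∈ Finset.range n, c (j + 1) * R c w (n - j) =
         ∑ j ∈ Finset.range n, V j * R c w (n - j)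
          - q * ∑ j ∈ Finset.range n, V (j + 1) * R c w (n - j) := by
        rw [Finset.mul_sum, ← Finset.sum_sub_distrib]
        refine Finset.sum_congr rfl fun j _ => ?_
        rw [hV j]; ring
      have h3 : ∑ j ∈ Finset.range (n + 1), V j * R c w (n + 1 - j) =
          ∑ j ∈ Finset.range n, V (j + 1) * R c w (n - j) + V 0 * R c w (n + 1) := by
        rw [Finset.sum_range_succ']
        simp
      have h4 : ∑ j ∈ Finset.range (n + 1), V j * (q⁻¹) ^ (n + 1 - j) =
          q⁻¹ * (∑ j ∈ Finset.range n, V j * (q⁻¹) ^ (n - j) + V n) := by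
        rw [Finset.sum_range_succ, mul_add, Finset.mul_sum]
        congr 1
        · refine Finset.sum_congr rfl fun j hj => ?_
          rw [Finset.mem_range] at hj
          rw [show n + 1 - j = (n - j) + 1 by omega, pow_succ]; ring
        · simp; ring
      rw [h3, h4, ← ih]
      have h5 := hV n
      apply mul_left_cancel₀ hq
      rw [mul_inv_cancel_left₀ hq]
      push_cast
      linear_combination h1 + h2 - (n + 1) * h5
  have := hK n
  have e1 : ∑ j ∈ Finset.range n, V j * (R c w (n - j) - (q⁻¹) ^ (n - j)) =
    ∑ j ∈ Finset.range n, V j * R c w (n - j) - ∑ j ∈ Finset.range n, V j * (q⁻¹) ^ (n - j) := by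
    rw [← Finset.sum_sub_distrib]
    exact Finset.sum_congr rfl fun j _ => by ring
  rw [e1, ← this]; ring

lemma faber_bdd (c : ℕ → ℂ) (Vb : ℕ → ℝ) (hVb : ∀ i, 0 ≤ Vb i) (n : ℕ) :
    ∃ K : ℝ, ∀ (V : ℕ → ℂ) (q : ℂ), q ≠ 0 → 1 / 2 ≤ ‖V 0‖ → (∀ i, ‖V i‖ ≤ Vb i) →
      (∀ i, V i = c (i + 1) + q * V (i + 1)) → ‖R c (q * V 0)⁻¹ n - (q⁻¹) ^ n‖ ≤ K := by
  induction n using Nat.strong_induction_on with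
  | _ n ih =>
    cases n with
    | zero => exact ⟨1, fun V q _ _ _ _ => by simp [R_zero]⟩
    | succ n =>
      choose! K hK using ih
      refine ⟨2 * (∑ j ∈ Finset.range n, Vb (j + 1) * |K (n - j)| + (n + 1) * Vb (n + 1)), ?_⟩
      intro V q hq h0 hb hV
      have hV0 : V 0 ≠ 0 := by intro h; rw [h] at h0; norm_num at h0
      have key := faber_K c V q hq hV0 hV (n + 1)
      rw [Finset.sum_range_succ'] at key
      simp only [Nat.sub_zero, Nat.add_sub_add_right] at key
      set X := R c (q * V 0)⁻¹ (n + 1) - (q⁻¹) ^ (n + 1)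
      have e1 : V 0 * X = -(∑ j ∈ Finset.range n, V (j + 1) *
          (R c (q * V 0)⁻¹ (n - j) - (q⁻¹) ^ (n - j)) + (n + 1 : ℕ) * V (n + 1)) := by
        linear_combination key
      have e2 : ‖V 0‖ * ‖X‖ ≤ ∑ j ∈ Finset.range n, Vb (j + 1) * |K (n - j)| + (n + 1) * Vb (n + 1) := by
        rw [← norm_mul, e1, norm_neg]
        refine (norm_add_le _ _).trans (add_le_add ((norm_sum_le _ _).trans ?_) ?_)
        · refine Finset.sum_le_sum fun j hj => ?_
          rw [norm_mul]
          exact mul_le_mul (hb _) ((hK (n - j) (by omega) V q hq h0 hb hV).trans (le_abs_self _))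
            (norm_nonneg _) (hVb _)
        · rw [norm_mul]
          have : ‖((n + 1 : ℕ) : ℂ)‖ = n + 1 := by
            rw [Complex.norm_natCast]; push_cast; ring
          rw [this]
          exact mul_le_mul_of_nonneg_left (hb _) (by positivity)
      nlinarith [norm_nonneg X]

end C3A


namespace C3A
open Complex Filter Topology
open scoped UpperHalfPlane

lemma t_form {A B C D : ℤ} (h : A * D - B * C = 1) :
    (BI (fun z => t (mob A B C D z)) ∧ ∀ z, pol D (-C) z = 0) ∨
    ∃ k j : ℤ, 0 < k ∧ ∀ z : ℂ, 0 < z.im → t (mob A B C D z) = (t ((z + j) / (k : ℂ)))⁻¹ ∧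
      pol D (-C) z = e (-((z + j) / (k : ℂ))) := by
  by_cases c2 : (2 : ℤ) ∣ C
  · have y2 : (2 : ℤ) ∣ -C := by rwa [Int.dvd_neg]
    by_cases c3 : (3 : ℤ) ∣ C
    · have y3 : (3 : ℤ) ∣ -C := by rwa [Int.dvd_neg]
      left
      refine ⟨?_, fun z => pol_0 y2 y3 z⟩
      refine (t_cusp h).congr fun z _ => ?_
      rw [pol_0 y2 y3, sub_zero]
    · have y3 : ¬ (3 : ℤ) ∣ -C := by rwa [Int.dvd_neg]
      right
      have hj := not3 c3 D
      obtain ⟨c, rfl⟩ := c2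
      refine ⟨3, D * (2 * c), by norm_num, fun z hz => ⟨?_, ?_⟩⟩
      · rw [t_2 h hj hz]; norm_num
      · rw [pol_3 y2 y3 (k := -(D * (2 * c)))]
        · push_cast; ring_nf
        · exact ⟨0, by ring⟩
  · have y2 : ¬ (2 : ℤ) ∣ -C := by rwa [Int.dvd_neg]
    by_cases c3 : (3 : ℤ) ∣ C
    · have y3 : (3 : ℤ) ∣ -C := by rwa [Int.dvd_neg]
      right
      have hi := not2 c2 D
      obtain ⟨c, rfl⟩ := c3
      refine ⟨2, D, by norm_num, fun z hz => ⟨?_, ?_⟩⟩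
      · rw [t_3 h hi hz]; norm_num
      · rw [pol_2 y2 y3 (k := -D)]
        · push_cast; ring_nf
        · exact ⟨D, by ring⟩
    · have y3 : ¬ (3 : ℤ) ∣ -C := by rwa [Int.dvd_neg]
      left
      refine ⟨?_, fun z => pol_1 y2 y3 z⟩
      refine (t_cusp h).congr fun z _ => ?_
      rw [pol_1 y2 y3, sub_zero]

lemma BI.diff_comp {f g : ℂ → ℂ} (hf : Differentiable ℂ f) (hg : BI g) : BI (fun z => f (g z)) := by
  obtain ⟨K, Y, hY, h⟩ := hg
  obtain ⟨K', hK'⟩ := (isCompact_closedBall (0 : ℂ) K).exists_bound_of_continuousOn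
    hf.continuous.continuousOn
  exact ⟨K', Y, hY, fun τ ht => hK' _ (by simpa using h τ ht)⟩

lemma hs_bound (c : ℕ → ℂ) (hc : ∀ q : ℂ, ‖q‖ < 1 → HasSum (fun n => c (n + 1) * q ^ n) (phT q)) :
    ∀ i, Summable (fun m => ‖c (m + i + 1)‖ * (1 / 2 : ℝ) ^ m) := by
  intro i
  have h1 := (hc (1 / 2) (by norm_num)).summable.norm
  have h2 := (summable_nat_add_iff i).mpr h1
  have h3 := h2.mul_left (2 ^ i)
  refine h3.congr fun m => ?_
  rw [norm_mul, norm_pow, pow_add]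
  norm_num
  have : (2 : ℝ) ^ i * (1 / 2) ^ i = 1 := by rw [← mul_pow]; norm_num
  linear_combination ‖c (m + i + 1)‖ * ((1 / 2 : ℝ) ^ m) * this

lemma Nice.dAt {φ : ℂ → ℂ} (h : Nice φ) {q : ℂ} (hq : ‖q‖ < 1) : DifferentiableAt ℂ φ q :=
  h.diff.differentiableAt (Metric.isOpen_ball.mem_nhds (by simpa using hq))

lemma R_cusp (c : ℕ → ℂ) (hc : ∀ q : ℂ, ‖q‖ < 1 → HasSum (fun n => c (n + 1) * q ^ n) (phT q))
    (n : ℕ) : BI (fun z => R c (t z)⁻¹ n - e (-z) ^ n) := by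
  have hb := hs_bound c hc
  obtain ⟨K, hK⟩ := faber_bdd c (fun i => ∑' m, ‖c (m + i + 1)‖ * (1 / 2 : ℝ) ^ m)
    (fun i => tsum_nonneg fun m => by positivity) n
  -- phT near 0
  have hct : ContinuousAt phT 0 := (nice_T.dAt (by simp)).continuousAt
  have : ∀ᶠ q in 𝓝 (0 : ℂ), 1 / 2 < ‖phT q‖ := by
    have h := hct.norm
    refine h.eventually (lt_mem_nhds ?_)
    simp only [nice_T.one]; norm_num
  obtain ⟨δ, hδ, hδ'⟩ := Metric.eventually_nhds_iff_ball.mp this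
  obtain ⟨Y, hY, hYδ⟩ : ∃ Y : ℝ, 0 < Y ∧ ∀ z : ℂ, Y < z.im → ‖e z‖ < min δ (1 / 2) := by
    refine ⟨max 1 (-Real.log (min δ (1 / 2)) / (2 * Real.pi)), by positivity, fun z hz => ?_⟩
    rw [norm_e, ← Real.lt_log_iff_exp_lt (by positivity)]
    have := (le_max_right _ _).trans_lt hz
    rw [div_lt_iff₀ (by positivity)] at this
    linarith
  refine ⟨K, Y, hY, fun z hz => ?_⟩
  have h1 := hYδ z hz
  set q := e z with hq
  have hq2 : ‖q‖ < 1 / 2 := h1.trans_le (min_le_right _ _)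
  have hs : ∀ i, Summable (fun m => c (m + i + 1) * q ^ m) := by
    intro i
    refine Summable.of_norm_bounded (hb i) fun m => ?_
    rw [norm_mul, norm_pow]
    gcongr
  have hV0 : ∑' m, c (m + 0 + 1) * q ^ m = phT q := (hc q (by linarith)).tsum_eq
  have := hK (fun i => ∑' m, c (m + i + 1) * q ^ m) q (e_ne _) ?_ ?_ ?_
  · simp only [hV0] at this
    simp only [t_q, e_neg]; exact this
  · simp only [hV0]
    exact (hδ' q (by simpa using h1.trans_le (min_le_left _ _))).le
  · intro i
    refine tsum_of_norm_bounded (hb i).hasSum fun m => ?_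
    rw [norm_mul, norm_pow]
    gcongr
  · intro i
    rw [(hs i).tsum_eq_zero_add, ← tsum_mul_left]
    simp only [pow_zero, mul_one, zero_add]
    congr 1
    refine tsum_congr fun m => ?_
    rw [show m + 1 + i + 1 = m + (i + 1) + 1 by ring]; ring

/-- filter at i∞ -/
def iinf : Filter ℂ := Filter.comap Complex.im atTop

instance : iinf.NeBot := by
  unfold iinf
  refine Filter.comap_neBot fun s hs => ?_
  obtain ⟨a, ha⟩ := Filter.mem_atTop_sets.mp hs
  exact ⟨a * I, ha _ (by simp)⟩

lemma iinf_pos : ∀ᶠ z in iinf, 0 < z.im := by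
  unfold iinf
  exact Filter.tendsto_comap.eventually (eventually_gt_atTop 0)

lemma e_lim : Tendsto e iinf (𝓝 0) := by
  rw [tendsto_zero_iff_norm_tendsto_zero]
  simp only [norm_e]
  refine Real.tendsto_exp_atBot.comp ?_
  refine tendsto_neg_atTop_atBot.comp ?_
  exact Tendsto.const_mul_atTop (by positivity) Filter.tendsto_comap

lemma nice_lim {φ : ℂ → ℂ} (h : Nice φ) : Tendsto (fun z => φ (e z)) iinf (𝓝 1) := by
  have := (h.dAt (q := 0) (by simp)).continuousAt
  have h2 := this.tendsto.comp e_lim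
  rwa [h.one] at h2

lemma lim_of {f φ : ℂ → ℂ} (h : Nice φ) (hf : ∀ z, f z = e z * φ (e z)) : Tendsto f iinf (𝓝 0) := by
  have : f = fun z => e z * φ (e z) := funext hf
  rw [this]
  simpa using e_lim.mul (nice_lim h)

lemma t_lim : Tendsto t iinf (𝓝 0) := lim_of nice_T t_q
lemma G_lim : Tendsto G iinf (𝓝 0) := lim_of nice_G G_q
lemma u_lim : Tendsto u iinf (𝓝 0) := lim_of nice_U u_q

lemma cc_lim (a : ℤ) : Tendsto (cc a) iinf (𝓝 0) := by
  unfold cc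
  split_ifs
  · exact tendsto_const_nhds
  · simpa using G_lim.const_mul 729
  · simpa using u_lim.const_mul 4096
  · exact t_lim

lemma tri_lim (a b d : ℤ) (ha : 0 < a) (hd : 0 < d) : Tendsto (tri a b d) iinf iinf := by
  unfold iinf
  rw [Filter.tendsto_comap_iff]
  have : (Complex.im ∘ tri a b d) = fun z => ((a : ℝ) / d) * z.im := by
    funext z
    simp only [Function.comp, tri]
    rw [show (d : ℂ) = ((d : ℝ) : ℂ) by push_cast; rfl, Complex.div_ofReal_im]; simp; ring
  rw [this]
  have h1 : (0 : ℝ) < a := by exact_mod_cast ha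
  have h2 : (0 : ℝ) < d := by exact_mod_cast hd
  exact Tendsto.const_mul_atTop (by positivity) Filter.tendsto_comap

lemma N_lim (n : ℕ) : Tendsto (N n) iinf (𝓝 0) := by
  have : Tendsto (N n) iinf (𝓝 (∑ M ∈ S n, 0)) := by
    unfold N
    refine tendsto_finsetSum _ fun M hM => ?_
    have := S_pos hM
    exact (cc_lim _).comp (tri_lim _ _ _ (by exact_mod_cast this.1) (by exact_mod_cast this.2))
  simpa using this

lemma const_lim {F : ℂ → ℂ} {c l : ℂ} (h : ∀ z : ℂ, 0 < z.im → F z = c) (hl : Tendsto F iinf (𝓝 l)) :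
    c = l := by
  refine tendsto_nhds_unique (f := F) (l := iinf) ?_ hl
  refine Tendsto.congr' ?_ tendsto_const_nhds
  filter_upwards [iinf_pos] with z hz
  exact (h z hz).symm

theorem N_eq_R (c : ℕ → ℂ) (hc : ∀ q : ℂ, ‖q‖ < 1 → HasSum (fun n => c (n + 1) * q ^ n) (phT q))
    (n : ℕ) (hn : n ≠ 0) {z : ℂ} (hz : 0 < z.im) : N n z = R c (t z) n := by
  have key : ∃ k, ∀ z : ℂ, 0 < z.im → N n z - R c (t z) n = k := by
    refine const_of_bdd (fun z => N n z - R c (t z) n) (6 * n) (by omega) ?_ ?_ ?_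
    · refine (N_diff n).sub fun z hz => ?_
      exact ((R_diff c n).differentiableAt.comp z (t_diff hz)).differentiableWithinAt
    · intro A B C D h hA hB hC hD z hz
      rw [N_inv n h hA hB hC hD hz]
      obtain ⟨m, hm⟩ := hC
      have hC' : C = 6 * (n * m) := by rw [hm]; push_cast; ring
      subst hC'
      rw [t_66 h hz]
    · intro A B C D h
      rcases t_form h with ⟨h1, h2⟩ | ⟨k, j, hk, h1⟩
      · refine ((N_cusp' n hn h).sub (h1.diff_comp (R_diff c n))).congr ?_
        intro z _
        simp [h2, hn]
      · refine ((N_cusp' n hn h).sub (BI_dn (R_cusp c hc n) k j hk)).congr ?_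
        intro z hz
        obtain ⟨h3, h4⟩ := h1 z hz
        simp only [h3, h4]; ring
  obtain ⟨k, hk⟩ := key
  have hk0 : k = 0 := by
    refine const_lim (hk) ?_
    have : Tendsto (fun z => R c (t z) n) iinf (𝓝 (R c 0 n)) :=
      ((R_diff c n).continuous.tendsto 0).comp t_lim
    rw [R_at_zero] at this
    simpa using (N_lim n).sub this
  have := hk z hz
  rw [hk0] at this
  exact sub_eq_zero.mp this

end C3A


namespace C3A
open Complex Filter Topology
open scoped UpperHalfPlane

lemma mob_comp {A B C D : ℤ} (h : A * D - B * C = 1) (A' B' C' D' : ℤ) {z : ℂ} (hz : 0 < z.im) :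
    mob A' B' C' D' (mob A B C D z) =
      mob (A' * A + B' * C) (A' * B + B' * D) (C' * A + D' * C) (C' * B + D' * D) z := by
  have h1 := den_ne h hz
  unfold mob
  push_cast
  rw [mul_div_assoc', mul_div_assoc', div_add' _ _ _ h1, div_add' _ _ _ h1,
    div_div_div_cancel_right₀ h1]
  congr 1 <;> ring

lemma e_half (z : ℂ) : e (z + 1 / 2) = - e z := by
  rw [e_add]
  have : e (1 / 2) = -1 := by
    unfold e
    rw [show (2 : ℂ) * Real.pi * I * (1 / 2) = Real.pi * I by ring, Complex.exp_pi_mul_I]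
  rw [this]; ring

lemma pol_2s {x y x' y' : ℤ} (h2 : ¬ 2 ∣ y) (h3 : 3 ∣ y) (h2' : ¬ 2 ∣ y') (h3' : 3 ∣ y')
    (hx : 2 ∣ x' - x - 1) (z : ℂ) : pol x y z + pol x' y' z = 0 := by
  rw [pol_2 h2 h3 (k := x) ⟨0, by ring⟩, pol_2 h2' h3' (k := x + 1) (by omega)]
  have := e_half ((x - z) / 2)
  rw [show ((x + 1 : ℤ) - z) / 2 = (x - z) / 2 + 1 / 2 by push_cast; ring, this]; ring

lemma det_par {A B C D : ℤ} (h : A * D - B * C = 1) :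
    (C % 2 = 0 ∧ A % 2 = 1 ∧ D % 2 = 1) ∨ (C % 2 = 1 ∧ A % 2 = 0 ∧ B % 2 = 1) ∨
      (C % 2 = 1 ∧ A % 2 = 1 ∧ (B + D) % 2 = 1) := by
  have h1 : (A * D - B * C) % 2 = 1 := by rw [h]; norm_num
  rcases Int.emod_two_eq_zero_or_one A with a | a <;> rcases Int.emod_two_eq_zero_or_one B with b | b <;>
  rcases Int.emod_two_eq_zero_or_one C with c | c <;> rcases Int.emod_two_eq_zero_or_one D with d | d <;>
  simp [Int.sub_emod, Int.mul_emod, a, b, c, d] at h1 <;> omega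

lemma pol_id1 {A B C D : ℤ} (h : A * D - B * C = 1) (z : ℂ) :
    pol (3 * B - 2 * D) (-(3 * A - 2 * C)) z + pol (3 * B + D) (-(3 * A + C)) z
     - pol (2 * D) (-(2 * C)) z + pol D (-C) z = 0 := by
  by_cases c3 : (3 : ℤ) ∣ C
  · rw [pol_0 (x := 2 * D) (by omega) (by omega), sub_zero]
    rcases det_par h with ⟨h1, h2, h3⟩ | ⟨h1, h2, h3⟩ | ⟨h1, h2, h3⟩
    · rw [pol_0 (x := D) (by omega) (by omega), add_zero]
      exact pol_2s (by omega) (by omega) (by omega) (by omega) (by omega) z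
    · rw [pol_0 (x := 3 * B - 2 * D) (by omega) (by omega), zero_add]
      exact pol_2s (by omega) (by omega) (by omega) (by omega) (by omega) z
    · rw [pol_0 (x := 3 * B + D) (by omega) (by omega), add_zero]
      exact pol_2s (by omega) (by omega) (by omega) (by omega) (by omega) z
  · rw [pol_3 (x := 2 * D) (k := -(D * C)) (by omega) (by omega) ⟨-(D * C), by ring⟩]
    rcases det_par h with ⟨h1, h2, h3⟩ | ⟨h1, h2, h3⟩ | ⟨h1, h2, h3⟩
    · rw [pol_1 (x := 3 * B - 2 * D) (by omega) (by omega), pol_1 (x := 3 * B + D) (by omega) (by omega),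
        pol_3 (x := D) (k := -(D * C)) (by omega) (by omega) ⟨0, by ring⟩]; ring
    · rw [pol_1 (x := D) (by omega) (by omega), pol_1 (x := 3 * B + D) (by omega) (by omega),
        pol_3 (x := 3 * B - 2 * D) (k := -(D * C)) (by omega) (by omega)
          ⟨- 3 * A * B + 2 * B * C + 2 * A * D - D * C, by ring⟩]; ring
    · rw [pol_1 (x := D) (by omega) (by omega), pol_1 (x := 3 * B - 2 * D) (by omega) (by omega),
        pol_3 (x := 3 * B + D) (k := -(D * C)) (by omega) (by omega)
          ⟨- 3 * A * B - B * C - A * D, by ring⟩]; ring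

lemma pol_id2 {A B C D : ℤ} (h : A * D - B * C = 1) (z : ℂ) :
    pol (3 * D) (-(3 * C)) z + pol (3 * B) (-(3 * A)) z + pol (3 * (B + D)) (-(3 * (A + C))) z = 0 := by
  rcases det_par h with ⟨h1, h2, h3⟩ | ⟨h1, h2, h3⟩ | ⟨h1, h2, h3⟩
  · rw [pol_0 (x := 3 * D) (by omega) (by omega), zero_add]
    exact pol_2s (by omega) (by omega) (by omega) (by omega) (by omega) z
  · rw [pol_0 (x := 3 * B) (by omega) (by omega), add_zero]
    exact pol_2s (by omega) (by omega) (by omega) (by omega) (by omega) z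
  · rw [pol_0 (x := 3 * (B + D)) (by omega) (by omega), add_zero]
    exact pol_2s (by omega) (by omega) (by omega) (by omega) (by omega) z

lemma h0_eq {z : ℂ} (hz : 0 < z.im) : (t (z / 2))⁻¹ = t (mob 1 (-1) 3 (-2) z) := by
  have := t_3 (A := 1) (B := -1) (c := 1) (D := -2) (by norm_num) (i := 0) (by norm_num) hz
  norm_num at this
  exact this.symm
lemma h1_eq {z : ℂ} (hz : 0 < z.im) : (t ((z + 1) / 2))⁻¹ = t (mob 1 0 3 1 z) := by
  have := t_3 (A := 1) (B := 0) (c := 1) (D := 1) (by norm_num) (i := 1) (by norm_num) hz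
  norm_num at this
  exact this.symm
lemma u0_eq {z : ℂ} (hz : 0 < z.im) : (u (z / 2))⁻¹ = cc 3 (mob 0 (-1) 1 0 z) := by
  have := u_dn (A := 0) (B := -1) (C := 1) (D := 0) (by norm_num) (j := 0) (by norm_num) hz
  norm_num at this
  simpa [cc] using this.symm
lemma u1_eq {z : ℂ} (hz : 0 < z.im) : (u ((z + 1) / 2))⁻¹ = cc 3 (mob 0 (-1) 1 1 z) := by
  have := u_dn (A := 0) (B := -1) (C := 1) (D := 1) (by norm_num) (j := 1) (by norm_num) hz
  norm_num at this
  simpa [cc] using this.symm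

/-- first identity function -/
noncomputable def F1 (z : ℂ) : ℂ := (t (z / 2))⁻¹ + (t ((z + 1) / 2))⁻¹ - 729 * G z + t z
/-- second identity function -/
noncomputable def F2 (z : ℂ) : ℂ := 4096 * u z + (u (z / 2))⁻¹ + (u ((z + 1) / 2))⁻¹

lemma im_half {z : ℂ} (hz : 0 < z.im) : 0 < (z / 2).im := by
  simp; exact hz
lemma im_half1 {z : ℂ} (hz : 0 < z.im) : 0 < ((z + 1) / 2).im := by
  simp; exact hz

lemma inv_tri (f : ℂ → ℂ) (hf : ∀ A B C D : ℤ, A * D - B * C = 1 → 6 ∣ C → ∀ z : ℂ, 0 < z.im →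
      f (mob A B C D z) = f z) {A B C D : ℤ} (h : A * D - B * C = 1) (hA : ((12 : ℕ) : ℤ) ∣ A - 1)
    (hB : ((12 : ℕ) : ℤ) ∣ B) (hC : ((12 : ℕ) : ℤ) ∣ C) (hD : ((12 : ℕ) : ℤ) ∣ D - 1) {z : ℂ} (hz : 0 < z.im) :
    f ((mob A B C D z) / 2) = f (z / 2) ∧ f ((mob A B C D z + 1) / 2) = f ((z + 1) / 2) := by
  have h0 := tri_inv hf (a := 1) (b := 0) (d := 2) (by norm_num) (by norm_num) h hA hB hC hD hz
  have h1 := tri_inv hf (a := 1) (b := 1) (d := 2) (by norm_num) (by norm_num) h hA hB hC hD hz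
  simp [tri] at h0 h1
  exact ⟨h0, h1⟩

lemma F1_const : ∃ c, ∀ z : ℂ, 0 < z.im → F1 z = c := by
  refine const_of_bdd F1 12 (by norm_num) ?_ ?_ ?_
  · intro z hz
    have hz : 0 < z.im := hz
    refine DifferentiableAt.differentiableWithinAt ?_
    unfold F1
    have d1 : DifferentiableAt ℂ (fun z => t (z / 2)) z :=
      DifferentiableAt.comp z (t_diff (im_half hz)) (f := fun z => z / 2) (by fun_prop)
    have d2 : DifferentiableAt ℂ (fun z => t ((z + 1) / 2)) z :=
      DifferentiableAt.comp z (t_diff (im_half1 hz)) (f := fun z => (z + 1) / 2) (by fun_prop)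
    exact (((d1.inv (t_ne (im_half hz))).add (d2.inv (t_ne (im_half1 hz)))).sub
      ((G_diff hz).const_mul _)).add (t_diff hz)
  · intro A B C D h hA hB hC hD z hz
    have h6 : (6 : ℤ) ∣ C := Dvd.dvd.trans (by norm_num) hC
    have h1 := inv_tri t (fun A B C D h hC z hz => by have := cc_inv 1 h hC hz; simpa [cc] using this)
      h hA hB hC hD hz
    have h2 := cc_inv 1 h h6 hz
    have h3 := cc_inv 2 h h6 hz
    simp [cc] at h2 h3
    unfold F1
    rw [h1.1, h1.2, h2, h3]
  · intro A B C D h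
    have b1 := t_cusp (A := A - C) (B := B - D) (C := 3 * A - 2 * C) (D := 3 * B - 2 * D)
      (by linear_combination h)
    have b2 := t_cusp (A := A) (B := B) (C := 3 * A + C) (D := 3 * B + D)
      (by linear_combination h)
    have b3 := cc_pol 2 h
    have b4 := t_cusp h
    refine (((b1.add b2).sub b3).add b4).congr ?_
    intro z hz
    have hw := mob_im_pos h hz
    have := pol_id1 h z
    unfold F1
    have e1 : mob 1 (-1) 3 (-2) (mob A B C D z) =
        mob (A - C) (B - D) (3 * A - 2 * C) (3 * B - 2 * D) z := by
      rw [mob_comp h _ _ _ _ hz]; congr 1 <;> ring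
    have e2 : mob 1 0 3 1 (mob A B C D z) = mob A B (3 * A + C) (3 * B + D) z := by
      rw [mob_comp h _ _ _ _ hz]; congr 1 <;> ring
    have e3 : cc 2 (mob A B C D z) = 729 * G (mob A B C D z) := by simp [cc]
    rw [h0_eq hw, h1_eq hw, e1, e2, e3]
    linear_combination this
  
lemma F2_const : ∃ c, ∀ z : ℂ, 0 < z.im → F2 z = c := by
  refine const_of_bdd F2 12 (by norm_num) ?_ ?_ ?_
  · intro z hz
    have hz : 0 < z.im := hz
    refine DifferentiableAt.differentiableWithinAt ?_
    unfold F2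
    have d1 : DifferentiableAt ℂ (fun z => u (z / 2)) z :=
      DifferentiableAt.comp z (u_diff (im_half hz)) (f := fun z => z / 2) (by fun_prop)
    have d2 : DifferentiableAt ℂ (fun z => u ((z + 1) / 2)) z :=
      DifferentiableAt.comp z (u_diff (im_half1 hz)) (f := fun z => (z + 1) / 2) (by fun_prop)
    exact (((u_diff hz).const_mul _).add (d1.inv (u_ne (im_half hz)))).add (d2.inv (u_ne (im_half1 hz)))
  · intro A B C D h hA hB hC hD z hz
    have h6 : (6 : ℤ) ∣ C := Dvd.dvd.trans (by norm_num) hC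
    have h1 := inv_tri u (fun A B C D h hC z hz => by have := cc_inv 3 h hC hz; simpa [cc] using this)
      h hA hB hC hD hz
    have h2 := cc_inv 3 h h6 hz
    simp [cc] at h2
    unfold F2
    rw [h1.1, h1.2, h2]
  · intro A B C D h
    have b1 := cc_pol 3 (A := -C) (B := -D) (C := A) (D := B)
      (by linear_combination h)
    have b2 := cc_pol 3 (A := -C) (B := -D) (C := A + C) (D := B + D)
      (by linear_combination h)
    have b3 := cc_pol 3 h
    refine ((b3.add b1).add b2).congr ?_
    intro z hz
    have hw := mob_im_pos h hz
    have := pol_id2 h z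
    unfold F2
    rw [u0_eq hw, u1_eq hw, mob_comp h _ _ _ _ hz, mob_comp h _ _ _ _ hz]
    simp only [cc]
    norm_num
    linear_combination this

end C3A


namespace C3A
open Complex Filter Topology
open scoped UpperHalfPlane

lemma summ_pow {q : ℂ} (hq : ‖q‖ < 1) (k : ℕ) : Summable (fun n : ℕ => ‖-q ^ (n + k)‖) := by
  simp only [norm_neg, norm_pow]
  exact (summable_nat_add_iff k).mpr (summable_geometric_of_lt_one (norm_nonneg _) hq)

lemma multip {q : ℂ} (hq : ‖q‖ < 1) (k : ℕ) : Multipliable (fun n : ℕ => 1 - q ^ (n + k)) := by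
  simpa [sub_eq_add_neg] using multipliable_one_add_of_summable (summ_pow hq k)

lemma P_split {q : ℂ} (hq : ‖q‖ < 1) : P q = (1 - q) * ∏' n : ℕ, (1 - q ^ (n + 2)) := by
  unfold P
  rw [tprod_eq_zero_mul' (f := fun n : ℕ => 1 - q ^ (n + 1))]
  · simp
  · exact multip hq 2

lemma Q_bound {q : ℂ} (hq : ‖q‖ ≤ 1 / 2) : ‖∏' n : ℕ, (1 - q ^ (n + 2)) - 1‖ ≤ 4 * ‖q‖ ^ 2 := by
  have hq1 : ‖q‖ < 1 := by linarith
  have h1 := (multip hq1 2).hasProd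
  have h2 : Tendsto (fun s : Finset ℕ => ‖∏ n ∈ s, (1 - q ^ (n + 2)) - 1‖) atTop
      (𝓝 ‖∏' n : ℕ, (1 - q ^ (n + 2)) - 1‖) := by
    exact (Filter.Tendsto.sub_const h1 1).norm
  refine le_of_tendsto h2 (Eventually.of_forall fun s => ?_)
  have h3 := Finset.norm_prod_one_add_sub_one_le s (fun n => -q ^ (n + 2))
  simp only [← sub_eq_add_neg] at h3
  refine h3.trans ?_
  have h4 : ∑ n ∈ s, ‖-q ^ (n + 2)‖ ≤ 2 * ‖q‖ ^ 2 := by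
    refine ((summ_pow hq1 2).sum_le_tsum s (fun _ _ => norm_nonneg _)).trans ?_
    simp only [norm_neg, norm_pow]
    simp only [pow_add]
    rw [tsum_mul_right, tsum_geometric_of_lt_one (norm_nonneg _) hq1]
    gcongr
    rw [inv_le_comm₀ (by linarith) (by norm_num)]
    linarith
  have h5 : 0 ≤ ∑ n ∈ s, ‖-q ^ (n + 2)‖ := Finset.sum_nonneg fun _ _ => norm_nonneg _
  set x := ∑ n ∈ s, ‖-q ^ (n + 2)‖
  have h6 := norm_nonneg q
  have h7 : ‖q‖ ^ 2 ≤ 1 / 4 := by nlinarith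
  have := Real.abs_exp_sub_one_le (x := x) (by rw [abs_of_nonneg h5]; linarith)
  rw [abs_of_nonneg h5] at this
  have := le_abs_self (Real.exp x - 1)
  linarith

lemma P_deriv : HasDerivAt P (-1) 0 := by
  have hQ : HasDerivAt (fun q : ℂ => ∏' n : ℕ, (1 - q ^ (n + 2)) - 1) 0 0 := by
    have : HasFDerivAt (fun q : ℂ => ∏' n : ℕ, (1 - q ^ (n + 2)) - 1) (0 : ℂ →L[ℂ] ℂ) 0 := by
      refine Asymptotics.IsBigO.hasFDerivAt (n := 2) ?_ (by norm_num)
      refine Asymptotics.IsBigO.of_bound 4 ?_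
      filter_upwards [Metric.ball_mem_nhds (0 : ℂ) (by norm_num : (0 : ℝ) < 1 / 2)] with q hq
      have := Q_bound (q := q) (by have := mem_ball_zero_iff.mp hq; linarith)
      simpa using this
    simpa using this.hasDerivAt
  have h1 : HasDerivAt (fun q : ℂ => (1 - q) * ((∏' n : ℕ, (1 - q ^ (n + 2)) - 1) + 1)) (-1) 0 := by
    have := ((hasDerivAt_id (0 : ℂ)).const_sub 1).mul (hQ.add_const 1)
    refine this.congr_deriv ?_
    simp
  refine h1.congr_of_eventuallyEq ?_
  filter_upwards [Metric.ball_mem_nhds (0 : ℂ) (by norm_num : (0 : ℝ) < 1)] with q hq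
  rw [P_split (by simpa using hq)]; ring

lemma P_deriv_pow (k : ℕ) (hk : 2 ≤ k) : HasDerivAt (fun q => P (q ^ k)) 0 0 := by
  have h1 : HasDerivAt (fun q : ℂ => q ^ k) 0 0 := by
    have := hasDerivAt_pow k (0 : ℂ)
    refine this.congr_deriv ?_
    rw [zero_pow (by omega)]; simp
  have h2 : HasDerivAt P (-1) ((0 : ℂ) ^ k) := by rw [zero_pow (by omega)]; exact P_deriv
  have := h2.comp (0 : ℂ) h1
  rw [mul_zero] at this
  exact this

lemma phT_deriv : HasDerivAt phT (-12) 0 := by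
  have h1 : HasDerivAt (fun q => P (q ^ 1)) (-1) 0 := by simpa using P_deriv
  have := ((h1.mul (P_deriv_pow 6 (by norm_num))).div ((P_deriv_pow 2 (by norm_num)).mul
    (P_deriv_pow 3 (by norm_num))) (by simp [P_zero])).pow 12
  refine this.congr_deriv ?_
  simp [P_zero]

lemma phU_deriv : HasDerivAt phU 24 0 := by
  have h1 : HasDerivAt (fun q => P (q ^ 1)) (-1) 0 := by simpa using P_deriv
  have := ((P_deriv_pow 2 (by norm_num)).div h1 (by simp [P_zero])).pow 24
  refine this.congr_deriv ?_
  simp [P_zero]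

lemma inv_lim {f φ : ℂ → ℂ} {κ : ℂ} (h : Nice φ) (hd : HasDerivAt φ κ 0) (hf : ∀ z, f z = e z * φ (e z)) :
    Tendsto (fun z => (f z)⁻¹ - e (-z)) iinf (𝓝 (-κ)) := by
  have h1 := hasDerivAt_iff_tendsto_slope_zero.mp hd
  have h2 : Tendsto e iinf (𝓝[≠] 0) :=
    tendsto_nhdsWithin_iff.mpr ⟨e_lim, Eventually.of_forall fun z => e_ne z⟩
  have h3 := (h1.comp h2).neg.div (nice_lim h) one_ne_zero
  rw [div_one] at h3
  refine h3.congr' ?_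
  filter_upwards [iinf_pos] with z hz
  have := h.ne _ (norm_e_lt hz)
  have he := e_ne z
  simp only [Function.comp, Pi.div_apply, zero_add, h.one, hf, smul_eq_mul, e_neg]
  field_simp
  ring

lemma half_lim {f : ℂ → ℂ} {κ : ℂ} (h : Tendsto (fun z => (f z)⁻¹ - e (-z)) iinf (𝓝 κ)) :
    Tendsto (fun z => (f (z / 2))⁻¹ + (f ((z + 1) / 2))⁻¹) iinf (𝓝 (2 * κ)) := by
  have t0 := h.comp (tri_lim 1 0 2 (by norm_num) (by norm_num))
  have t1 := h.comp (tri_lim 1 1 2 (by norm_num) (by norm_num))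
  have := t0.add t1
  rw [← two_mul] at this
  refine this.congr fun z => ?_
  have := e_half (-((z + 1) / 2))
  simp only [Function.comp, tri]
  push_cast
  rw [one_mul, add_zero, show -(z / 2) = -((z + 1) / 2) + 1 / 2 by ring, this]
  ring

lemma F1_eq {z : ℂ} (hz : 0 < z.im) : F1 z = 24 := by
  obtain ⟨c, hc⟩ := F1_const
  rw [hc z hz]
  refine const_lim hc ?_
  have := ((half_lim (inv_lim nice_T phT_deriv t_q)).sub (G_lim.const_mul 729)).add t_lim
  norm_num at this
  exact this

lemma F2_eq {z : ℂ} (hz : 0 < z.im) : F2 z = -48 := by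
  obtain ⟨c, hc⟩ := F2_const
  rw [hc z hz]
  refine const_lim hc ?_
  have := (u_lim.const_mul 4096).add (half_lim (inv_lim nice_U phU_deriv u_q))
  norm_num at this
  refine this.congr fun z => ?_
  unfold F2; ring

lemma t_rel0 {z : ℂ} (hz : 0 < z.im) : (t (z / 2))⁻¹ = etaG3A (z / 2) / etaG3A z := by
  rw [G_eq, G_eq, t_G (im_half hz)]
  rw [show 2 * (z / 2) = z by ring, inv_div]

/-- odd product -/
noncomputable def O (q : ℂ) : ℂ := ∏' n : ℕ, (1 - q ^ (2 * n + 1))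

lemma multip_odd {q : ℂ} (hq : ‖q‖ < 1) : Multipliable (fun n : ℕ => 1 - q ^ (2 * n + 1)) := by
  have : Summable (fun n : ℕ => ‖-q ^ (2 * n + 1)‖) :=
    (summ_pow hq 1).comp_injective (i := fun n : ℕ => 2 * n) (fun a b h => by simpa using h)
  simpa [sub_eq_add_neg] using multipliable_one_add_of_summable this

lemma sq_lt {q : ℂ} (hq : ‖q‖ < 1) : ‖q ^ 2‖ < 1 := pow_ball hq 2 (by norm_num)

lemma P_O {q : ℂ} (hq : ‖q‖ < 1) : P q = O q * P (q ^ 2) := by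
  unfold P O
  have := tprod_even_mul_odd (f := fun n : ℕ => 1 - q ^ (n + 1)) (multip_odd hq) (by
    have := multip (sq_lt hq) 1
    refine this.congr fun n => ?_
    rw [← pow_mul]; ring_nf)
  rw [← this]
  congr 1
  refine tprod_congr fun n => ?_
  rw [← pow_mul]; ring_nf

lemma O_mul {q : ℂ} (hq : ‖q‖ < 1) : O q * O (-q) = O (q ^ 2) := by
  unfold O
  rw [← (multip_odd hq).tprod_mul (multip_odd (by simpa using hq))]
  refine tprod_congr fun n => ?_
  rw [(show Odd (2 * n + 1) from ⟨n, rfl⟩).neg_pow, ← pow_mul]; ring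

lemma P_mul {q : ℂ} (hq : ‖q‖ < 1) : P q * P (-q) * P (q ^ 4) = P (q ^ 2) ^ 3 := by
  have h1 := P_O hq
  have h2 := P_O (q := -q) (by simpa using hq)
  have h3 := P_O (sq_lt hq)
  have h4 := O_mul hq
  rw [← pow_mul] at h3
  norm_num at h2 h3
  rw [h1, h2]
  rw [show O q * P (q ^ 2) * (O (-q) * P (q ^ 2)) * P (q ^ 4) =
    (O q * O (-q)) * P (q ^ 4) * P (q ^ 2) ^ 2 by ring, h4, ← h3]; ring

lemma phT_mul {q : ℂ} (hq : ‖q‖ < 1) : phT q * phT (-q) = phT (q ^ 2) := by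
  have h1 := P_mul hq
  have h3 := P_mul (pow_ball hq 3 (by norm_num))
  have n1 := P_ne hq
  have n2 := P_ne (pow_ball hq 2 (by norm_num))
  have n3 := P_ne (pow_ball hq 3 (by norm_num))
  have n4 := P_ne (pow_ball hq 4 (by norm_num))
  have n6 := P_ne (pow_ball hq 6 (by norm_num))
  have n12 := P_ne (pow_ball hq 12 (by norm_num))
  simp only [← pow_mul] at h3
  norm_num at h3
  have m3 : P (-q ^ 3) ≠ 0 := P_ne (by rw [norm_neg]; exact pow_ball hq 3 (by norm_num))
  unfold phT
  rw [← mul_pow]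
  congr 1
  simp only [← pow_mul]
  rw [(show Odd 3 by decide).neg_pow, (show Even 6 by decide).neg_pow, (show Even 2 by decide).neg_pow]
  norm_num
  field_simp
  have e1 : P (-q) = P (q ^ 2) ^ 3 / (P q * P (q ^ 4)) := by field_simp; linear_combination h1
  have e3 : P (-q ^ 3) = P (q ^ 6) ^ 3 / (P (q ^ 3) * P (q ^ 12)) := by field_simp; linear_combination h3
  rw [e1, e3]
  field_simp

lemma phU_mul {q : ℂ} (hq : ‖q‖ < 1) : phU q * phU (-q) = phU (q ^ 2) := by
  have h1 := P_mul hq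
  have n1 := P_ne hq
  have n2 := P_ne (pow_ball hq 2 (by norm_num))
  have n4 := P_ne (pow_ball hq 4 (by norm_num))
  have m1 : P (-q) ≠ 0 := P_ne (by rwa [norm_neg])
  unfold phU
  rw [← mul_pow]
  congr 1
  simp only [← pow_mul]
  rw [(show Even 2 by decide).neg_pow]
  norm_num
  field_simp
  linear_combination -h1

lemma mul_half {f φ : ℂ → ℂ} (hf : ∀ z, f z = e z * φ (e z))
    (h : ∀ q : ℂ, ‖q‖ < 1 → φ q * φ (-q) = φ (q ^ 2)) {z : ℂ} (hz : 0 < z.im) :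
    f (z / 2) * f ((z + 1) / 2) = - f z := by
  have h1 : e ((z + 1) / 2) = - e (z / 2) := by rw [← e_half]; ring_nf
  have h2 : e z = e (z / 2) ^ 2 := by
    rw [← e_nat_mul]; congr 1; push_cast; ring
  have := h _ (norm_e_lt (im_half hz))
  rw [hf, hf, hf, h1, h2, ← this]; ring

lemma t_rel1 {z : ℂ} (hz : 0 < z.im) : (t ((z + 1) / 2))⁻¹ = - (etaMG3A (z / 2) / etaMG3A z) := by
  have := mul_half t_q (fun q => phT_mul) hz
  have h1 := t_ne hz
  have h2 := t_ne (im_half hz)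
  have h3 := t_ne (im_half1 hz)
  rw [t_eq, t_eq]
  field_simp
  linear_combination this

lemma phi1_eq {z : ℂ} (hz : 0 < z.im) : phi1 z = t z - 12 := by
  have h := F1_eq hz
  unfold F1 at h
  rw [t_rel0 hz, t_rel1 hz, ← G_eq] at h
  unfold phi1
  rw [← t_eq] at h ⊢
  linear_combination -h / 2

lemma phi0_eq {z : ℂ} (hz : 0 < z.im) : phi0 z = 729 * G z + 12 := by
  have h := F1_eq hz
  unfold F1 at h
  rw [t_rel0 hz, t_rel1 hz, ← G_eq] at h
  unfold phi0
  rw [← t_eq, ← G_eq] at *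
  linear_combination h / 2

lemma NS_eq {z : ℂ} (hz : 0 < z.im) : (fNS z - ftNS z) / 2 = 2048 * u z := by
  have h := F2_eq hz
  unfold F2 at h
  have a1 : (u ((z + 1) / 2))⁻¹ = - (u (z / 2) / u z) := by
    have := mul_half u_q (fun q => phU_mul) hz
    have h1 := u_ne hz
    have h2 := u_ne (im_half hz)
    have h3 := u_ne (im_half1 hz)
    field_simp
    linear_combination this
  have a2 : (u (z / 2))⁻¹ = ftNS z - 24 := by
    unfold u ftNS E
    rw [show 2 * (z / 2) = z by ring, inv_div]
    ring
  have a3 : u (z / 2) / u z = fNS z + 24 := by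
    have n1 := E_ne hz
    have n2 := E_ne (im_half hz)
    have n3 : E (2 * z) ≠ 0 := E_ne (by simpa using hz)
    have : fNS z + 24 = E z ^ 4 / (E (z / 2) ^ 2 * E (2 * z) ^ 2) := by
      unfold fNS E; ring
    rw [this]
    unfold u
    rw [show 2 * (z / 2) = z by ring]
    field_simp
  rw [a1, a2, a3] at h
  linear_combination -h / 2

lemma fR_eq (z : ℂ) : -(fR z + 24) / 2 = -2048 * u z - 24 := by
  unfold fR u E
  ring

end C3A

namespace C3A
open Complex Filter Topology
open scoped UpperHalfPlane

lemma P_tend {q : ℂ} (hq : ‖q‖ < 1) :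
    Tendsto (fun s : Finset ℕ => ∏ n ∈ s, ‖1 - q ^ (n + 1)‖) atTop (𝓝 ‖P q‖) := by
  have := (multip hq 1).hasProd
  have h2 := this.norm
  exact h2

lemma fac_le {q : ℂ} {x : ℝ} (hq : ‖q‖ ≤ x) (hx : x < 1) (n : ℕ) :
    ‖1 - (x : ℂ) ^ (n + 1)‖ ≤ ‖1 - q ^ (n + 1)‖ ∧ ‖1 - q ^ (n + 1)‖ * ‖1 - (x : ℂ) ^ (n + 1)‖ ≤ 1 := by
  have hx0 : 0 ≤ x := (norm_nonneg q).trans hq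
  have h1 : ‖1 - (x : ℂ) ^ (n + 1)‖ = 1 - x ^ (n + 1) := by
    rw [show (1 - (x : ℂ) ^ (n + 1)) = ((1 - x ^ (n + 1) : ℝ) : ℂ) by push_cast; rfl, Complex.norm_real,
      Real.norm_of_nonneg]
    linarith [pow_le_one₀ (n := n + 1) hx0 hx.le]
  have h2 : ‖q ^ (n + 1)‖ ≤ x ^ (n + 1) := by
    rw [norm_pow]; gcongr
  have h3 : 1 - ‖q ^ (n + 1)‖ ≤ ‖1 - q ^ (n + 1)‖ := by
    have := norm_sub_norm_le (1 : ℂ) (q ^ (n + 1)); simpa using this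
  have h4 : ‖1 - q ^ (n + 1)‖ ≤ 1 + ‖q ^ (n + 1)‖ := by
    have := norm_sub_le (1 : ℂ) (q ^ (n + 1)); simpa using this
  rw [h1]
  refine ⟨by linarith, ?_⟩
  have h5 : 0 ≤ 1 - x ^ (n + 1) := by linarith [pow_le_one₀ (n := n + 1) hx0 hx.le]
  calc _ ≤ (1 + x ^ (n + 1)) * (1 - x ^ (n + 1)) := by gcongr; linarith
    _ ≤ 1 := by nlinarith [sq_nonneg (x ^ (n + 1))]

lemma P_bds {q : ℂ} {x : ℝ} (hq : ‖q‖ ≤ x) (hx : x < 1) :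
    ‖P x‖ ≤ ‖P q‖ ∧ ‖P q‖ * ‖P x‖ ≤ 1 := by
  have hx0 : 0 ≤ x := (norm_nonneg q).trans hq
  have hx' : ‖(x : ℂ)‖ < 1 := by rw [Complex.norm_real, Real.norm_of_nonneg hx0]; exact hx
  have t1 := P_tend (hq.trans_lt hx)
  have t2 := P_tend hx'
  constructor
  · exact le_of_tendsto_of_tendsto' t2 t1 fun s =>
      Finset.prod_le_prod (fun _ _ => norm_nonneg _) fun n _ => (fac_le hq hx n).1
  · refine le_of_tendsto' (t1.mul t2) fun s => ?_
    rw [← Finset.prod_mul_distrib]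
    exact Finset.prod_le_one (fun _ _ => by positivity) fun n _ => (fac_le hq hx n).2

lemma P_bds_pow {q : ℂ} {x : ℝ} (hq : ‖q‖ ≤ x) (hx : x < 1) (k : ℕ) (hk : k ≠ 0) :
    ‖P x‖ ≤ ‖P (q ^ k)‖ ∧ ‖P (q ^ k)‖ ≤ ‖P x‖⁻¹ := by
  have h : ‖q ^ k‖ ≤ x := by
    rw [norm_pow]
    exact (pow_le_of_le_one (norm_nonneg _) (hq.trans hx.le) hk).trans hq
  have hx0 : 0 ≤ x := (norm_nonneg q).trans hq
  have hx' : ‖(x : ℂ)‖ < 1 := by rw [Complex.norm_real, Real.norm_of_nonneg hx0]; exact hx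
  have hp : 0 < ‖P x‖ := norm_pos_iff.2 (P_ne hx')
  obtain ⟨h1, h2⟩ := P_bds h hx
  refine ⟨h1, ?_⟩
  rw [← one_div, le_div_iff₀ hp]; exact h2

def Gr (φ : ℂ → ℂ) : Prop := ∀ (q : ℂ) (x : ℝ), ‖q‖ ≤ x → x < 1 → ‖φ q‖ ≤ (‖P x‖⁻¹) ^ 48

lemma quo {a b y : ℝ} (hy : 0 < y) (ha : a ≤ y⁻¹) (ha0 : 0 ≤ a) (hb : y ≤ b) : a / b ≤ y⁻¹ ^ 2 := by
  have hb0 : 0 ≤ b := hy.le.trans hb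
  rw [sq, div_eq_mul_inv]
  gcongr

lemma Px_inv {q : ℂ} {x : ℝ} (hq : ‖q‖ ≤ x) (hx : x < 1) : 0 < ‖P x‖ ∧ 1 ≤ ‖P x‖⁻¹ := by
  have hx0 : 0 ≤ x := (norm_nonneg q).trans hq
  have hx' : ‖(x : ℂ)‖ < 1 := by rw [Complex.norm_real, Real.norm_of_nonneg hx0]; exact hx
  have hp : 0 < ‖P x‖ := norm_pos_iff.2 (P_ne hx')
  refine ⟨hp, (one_le_inv₀ hp).2 ?_⟩
  have := (P_bds (q := 0) (x := x) (by simpa using hx0) hx).1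
  simpa [P_zero] using this

lemma gr_U : Gr phU := by
  intro q x hq hx
  obtain ⟨hp, h1⟩ := Px_inv hq hx
  have a := P_bds_pow hq hx 2 (by norm_num)
  have b := P_bds_pow hq hx 1 (by norm_num)
  rw [phU, norm_pow, norm_div, show (48 : ℕ) = 2 * 24 by norm_num, pow_mul]
  gcongr
  exact quo hp a.2 (norm_nonneg _) b.1

lemma gr_G : Gr phG := by
  intro q x hq hx
  obtain ⟨hp, h1⟩ := Px_inv hq hx
  have a := P_bds_pow hq hx 3 (by norm_num)
  have b := P_bds_pow hq hx 1 (by norm_num)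
  rw [phG, norm_pow, norm_div]
  calc _ ≤ (‖P x‖⁻¹ ^ 2) ^ 12 := by
        gcongr
        exact quo hp a.2 (norm_nonneg _) b.1
    _ = ‖P x‖⁻¹ ^ 24 := by rw [← pow_mul]
    _ ≤ _ := pow_le_pow_right₀ h1 (by norm_num)

lemma gr_T : Gr phT := by
  intro q x hq hx
  obtain ⟨hp, h1⟩ := Px_inv hq hx
  have a := P_bds_pow hq hx 2 (by norm_num)
  have b := P_bds_pow hq hx 1 (by norm_num)
  have c := P_bds_pow hq hx 3 (by norm_num)
  have d := P_bds_pow hq hx 6 (by norm_num)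
  rw [phT, norm_pow, norm_div, norm_mul, norm_mul, show (48 : ℕ) = 4 * 12 by norm_num, pow_mul]
  gcongr
  rw [mul_div_mul_comm, show (4 : ℕ) = 2 + 2 by norm_num, pow_add]
  gcongr
  · exact quo hp b.2 (norm_nonneg _) a.1
  · exact quo hp d.2 (norm_nonneg _) c.1

lemma P_low : ∃ K > (0 : ℝ), ∀ y : ℝ, 0 < y → y ≤ 1 →
    (‖P (Real.exp (-(2 * Real.pi * y)) : ℝ)‖⁻¹) ^ 12 ≤ K * Real.exp (Real.pi / y) := by
  set x0 := Real.exp (-(2 * Real.pi)) with hx0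
  have hx1 : x0 < 1 := by rw [hx0, Real.exp_lt_one_iff]; have := Real.pi_pos; linarith
  have hP0 : 0 < ‖P x0‖ := (Px_inv (q := 0) (by simpa using (Real.exp_pos _).le) hx1).1
  refine ⟨(‖P x0‖⁻¹) ^ 12, by positivity, fun y hy hy1 => ?_⟩
  have hz : 0 < ((y : ℂ) * I).im := by simpa using hy
  have h := E_S hz
  have hyc : (y : ℂ) ≠ 0 := by exact_mod_cast hy.ne'
  have e1 : (-1 / ((y : ℂ) * I)) = ((y⁻¹ : ℝ) : ℂ) * I := by
    push_cast; field_simp; rw [I_sq]; 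
  have ee : ∀ s : ℝ, e ((s : ℂ) * I) = (Real.exp (-(2 * Real.pi * s)) : ℝ) := by
    intro s; rw [e]; push_cast; congr 1; linear_combination (2 * Real.pi * s : ℂ) * I_sq
  have en : ∀ s : ℝ, cexp (Real.pi * I * ((s : ℂ) * I)) = (Real.exp (-(Real.pi * s)) : ℝ) := by
    intro s; push_cast; congr 1; linear_combination (Real.pi * s : ℂ) * I_sq
  rw [e1, E_eq, E_eq, ee, ee, en, en] at h
  have h' := congrArg norm h
  simp only [norm_mul, norm_neg, norm_pow, Complex.norm_real, Complex.norm_I, Real.norm_eq_abs, abs_of_pos hy,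
    Real.abs_exp] at h'
  set X := ‖P (Real.exp (-(2 * Real.pi * y)) : ℝ)‖ with hX
  set Z := ‖P (Real.exp (-(2 * Real.pi * y⁻¹)) : ℝ)‖ with hZ
  have hXp : 0 < X := (Px_inv (q := 0) (by simpa using (Real.exp_pos _).le)
    (by rw [Real.exp_lt_one_iff]; have := Real.pi_pos; have := mul_pos this hy; linarith)).1
  have hyi : 1 ≤ y⁻¹ := (one_le_inv₀ hy).2 hy1
  have hZl : ‖P x0‖ ≤ Z := by
    refine (P_bds ?_ hx1).1
    rw [Complex.norm_real, Real.norm_eq_abs, Real.abs_exp]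
    apply Real.exp_le_exp.2
    have := Real.pi_pos
    nlinarith
  have k1 : Real.exp (-(Real.pi * y⁻¹)) * ‖P x0‖ ^ 12 ≤ X ^ 12 := by
    calc _ ≤ Real.exp (-(Real.pi * y⁻¹)) * Z ^ 12 := by gcongr
      _ = y ^ 6 * (Real.exp (-(Real.pi * y)) * X ^ 12) := by rw [h']; ring
      _ ≤ 1 * (1 * X ^ 12) := by
        gcongr
        · exact pow_le_one₀ hy.le hy1
        · rw [Real.exp_le_one_iff]; have := Real.pi_pos; have := mul_pos this hy; linarith
      _ = X ^ 12 := by ring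
  rw [inv_pow, inv_pow, show Real.exp (Real.pi / y) = (Real.exp (-(Real.pi * y⁻¹)))⁻¹ by
    rw [← Real.exp_neg]; congr 1; field_simp, ← mul_inv]
  rw [mul_comm] at k1
  exact inv_anti₀ (by positivity) k1

noncomputable def tc (φ : ℂ → ℂ) (n : ℕ) : ℂ := iteratedDeriv n φ 0 / (n.factorial : ℂ)

noncomputable def co (φ : ℂ → ℂ) : ℕ → ℂ
  | 0 => 0
  | n + 1 => tc φ n

lemma Gr.bound {φ : ℂ → ℂ} (h : Gr φ) (hn : Nice φ) : ∃ K > (0 : ℝ), ∀ n, ‖co φ n‖ ≤ K * Real.exp (6 * Real.pi * √n) := by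
  obtain ⟨K, hK, hb⟩ := P_low
  refine ⟨K ^ 4, by positivity, fun n => ?_⟩
  rcases n with _ | n
  · simp [co]; positivity
  set s := √((n + 1 : ℕ) : ℝ) with hs
  have hs1 : 1 ≤ s := by rw [hs, Real.one_le_sqrt]; push_cast; linarith [n.cast_nonneg (α := ℝ)]
  have hss : s * s = n + 1 := by rw [hs, Real.mul_self_sqrt (by positivity)]; push_cast; rfl
  have hs0 : 0 < s := by linarith
  have hpi := Real.pi_pos
  set x := Real.exp (-(2 * Real.pi * s⁻¹)) with hx
  have hx0 : 0 < x := Real.exp_pos _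
  have hx1 : x < 1 := by rw [hx, Real.exp_lt_one_iff]; have : 0 < 2 * Real.pi * s⁻¹ := by positivity
                         linarith
  have hB := hb s⁻¹ (by positivity) (inv_le_one_of_one_le₀ hs1)
  rw [← hx] at hB
  have hM : ∀ z ∈ Metric.sphere (0 : ℂ) x, ‖φ z‖ ≤ (K * Real.exp (Real.pi * s)) ^ 4 := by
    intro z hz
    have hz' : ‖z‖ ≤ x := by simpa using (mem_sphere_zero_iff_norm.1 hz).le
    refine (h z x hz' hx1).trans ?_
    rw [show (48 : ℕ) = 12 * 4 by norm_num, pow_mul]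
    rw [div_inv_eq_mul] at hB
    gcongr
  have hd : DiffContOnCl ℂ φ (Metric.ball 0 x) := by
    apply DifferentiableOn.diffContOnCl
    rw [closure_ball _ hx0.ne']
    exact hn.diff.mono (Metric.closedBall_subset_ball hx1)
  have := Complex.norm_iteratedDeriv_le_of_forall_mem_sphere_norm_le n hx0 hd hM
  have hf : (0 : ℝ) < n.factorial := by exact_mod_cast n.factorial_pos
  simp only [co, tc, norm_div, Complex.norm_natCast]
  rw [div_le_iff₀ hf]
  refine this.trans ?_
  have hxn : (x ^ n)⁻¹ ≤ Real.exp (2 * Real.pi * s) := by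
    rw [hx, ← Real.exp_nat_mul, ← Real.exp_neg]
    apply Real.exp_le_exp.2
    have : (n : ℝ) * s⁻¹ ≤ s := by
      rw [← div_eq_mul_inv, div_le_iff₀ hs0]; linarith
    nlinarith
  rw [div_eq_mul_inv]
  calc _ ≤ (n.factorial : ℝ) * (K * Real.exp (Real.pi * s)) ^ 4 * Real.exp (2 * Real.pi * s) := by gcongr
    _ = K ^ 4 * (Real.exp (Real.pi * s) ^ 4 * Real.exp (2 * Real.pi * s)) * n.factorial := by ring
    _ = _ := by
      rw [← Real.exp_nat_mul, ← Real.exp_add]; congr 3; push_cast; ring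

lemma Gr.bound2 {φ : ℂ → ℂ} (h : Gr φ) (hn : Nice φ) : ∃ K > (0 : ℝ), ∀ r d : ℕ,
    ‖co φ (r * d)‖ ≤ K * (Real.exp (3 * Real.pi) ^ r * Real.exp (3 * Real.pi) ^ d) := by
  obtain ⟨K, hK, hb⟩ := h.bound hn
  refine ⟨K, hK, fun r d => (hb _).trans ?_⟩
  rw [← Real.exp_nat_mul, ← Real.exp_nat_mul, ← Real.exp_add]
  gcongr
  have hpi := Real.pi_pos
  have : √((r * d : ℕ) : ℝ) ≤ (r + d) / 2 := by
    rw [Real.sqrt_le_left (by positivity)]; push_cast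
    nlinarith [sq_nonneg ((r : ℝ) - d)]
  nlinarith

end C3A

namespace C3A
open Complex Filter Topology
open scoped UpperHalfPlane

lemma hs_congr {ι : Type*} {f g : ι → ℂ} {a b : ℂ} (h : HasSum f a) (h1 : ∀ n, g n = f n) (h2 : b = a) : HasSum g b := by
  rw [h2, show g = f from funext h1]; exact h

lemma ps {a : ℕ → ℂ} {g : ℂ → ℂ} {ρ : ℝ} (hρ : 0 < ρ)
    (h : ∀ q : ℂ, ‖q‖ < ρ → HasSum (fun n => a n * q ^ n) (g q)) :
    HasFPowerSeriesOnBall g (FormalMultilinearSeries.ofScalars ℂ a) 0 (ENNReal.ofReal ρ) := by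
  refine ⟨?_, by simpa using hρ, ?_⟩
  · refine ENNReal.le_of_forall_nnreal_lt fun r hr => ?_
    apply FormalMultilinearSeries.le_radius_of_summable_norm
    have hr' : (r : ℝ) < ρ := by
      rw [← ENNReal.ofReal_coe_nnreal] at hr
      exact (ENNReal.ofReal_lt_ofReal_iff hρ).1 hr
    have := (h (r : ℝ) (by simpa using hr')).summable.norm
    refine this.congr fun n => ?_
    simp
  · intro y hy
    have hy' : ‖y‖ < ρ := by
      simpa using hy
    simpa [FormalMultilinearSeries.ofScalars_apply_eq, mul_comm] using h y hy'

lemma ps_diff {a : ℕ → ℂ} {g : ℂ → ℂ} {ρ : ℝ} (hρ : 0 < ρ)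
    (h : ∀ q : ℂ, ‖q‖ < ρ → HasSum (fun n => a n * q ^ n) (g q)) :
    DifferentiableOn ℂ g (Metric.ball 0 ρ) := by
  have := (ps hρ h).differentiableOn
  rwa [Metric.eball_ofReal] at this

lemma ps_tc {a : ℕ → ℂ} {g : ℂ → ℂ} {ρ : ℝ} (hρ : 0 < ρ)
    (h : ∀ q : ℂ, ‖q‖ < ρ → HasSum (fun n => a n * q ^ n) (g q)) (n : ℕ) : tc g n = a n := by
  have := (ps hρ h).factorial_smul 1 n
  rw [tc, iteratedDeriv_eq_iteratedFDeriv, ← this]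
  have hf : (n.factorial : ℂ) ≠ 0 := by exact_mod_cast n.factorial_ne_zero
  simp
  field_simp

lemma tc_sum {g : ℂ → ℂ} {ρ : ℝ} (h : DifferentiableOn ℂ g (Metric.ball 0 ρ)) {q : ℂ} (hq : ‖q‖ < ρ) :
    HasSum (fun n => tc g n * q ^ n) (g q) := by
  have := Complex.hasSum_taylorSeries_on_ball h (z := q) (by simpa using hq)
  refine this.congr_fun ?_ 
  intro n
  simp [tc, div_eq_mul_inv]; ring

lemma co_sum {φ : ℂ → ℂ} (h : Nice φ) {q : ℂ} (hq : ‖q‖ < 1) :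
    HasSum (fun n => co φ n * q ^ n) (q * φ q) := by
  rw [← hasSum_nat_add_iff' 1]
  simp only [Finset.sum_range_one, co, zero_mul, sub_zero]
  refine ((tc_sum h.diff hq).mul_left q).congr_fun ?_
  intro n; ring

lemma tc_deriv (g : ℂ → ℂ) (n : ℕ) : tc (deriv g) n = (n + 1) * tc g (n + 1) := by
  rw [tc, tc, iteratedDeriv_succ', Nat.factorial_succ]
  have hf : (n.factorial : ℂ) ≠ 0 := by exact_mod_cast n.factorial_ne_zero
  have : ((n : ℂ) + 1) ≠ 0 := by exact_mod_cast n.succ_ne_zero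
  push_cast
  field_simp

lemma ps_uniq {d : ℕ → ℂ} (h : ∀ q : ℂ, q ≠ 0 → ‖q‖ < 1 → HasSum (fun n => d n * q ^ n) 0) (n : ℕ) : d n = 0 := by
  set g : ℂ → ℂ := fun q => if q = 0 then d 0 else 0 with hg
  have hs : ∀ q : ℂ, ‖q‖ < 1 → HasSum (fun n => d n * q ^ n) (g q) := by
    intro q hq
    by_cases h0 : q = 0
    · subst h0
      simp only [hg, if_true]
      convert hasSum_single (f := fun n => d n * (0 : ℂ) ^ n) 0 ?_ using 1
      · simp
      · intro b hb; simp [hb]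
    · simp only [hg, if_neg h0]; exact h q h0 hq
  have hc : ContinuousAt g 0 := (ps_diff one_pos hs).continuousOn.continuousAt (Metric.ball_mem_nhds _ one_pos)
  have h1 : Tendsto g (𝓝[≠] 0) (𝓝 (g 0)) := hc.tendsto.mono_left nhdsWithin_le_nhds
  have h2 : Tendsto g (𝓝[≠] 0) (𝓝 0) := by
    refine tendsto_const_nhds.congr' ?_
    filter_upwards [self_mem_nhdsWithin] with q hq
    have : q ≠ 0 := hq
    simp [hg, this]
  have h3 : g 0 = 0 := tendsto_nhds_unique h1 h2
  have h4 : d 0 = 0 := by simpa [hg] using h3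
  have h5 : g = fun _ => 0 := by funext q; simp [hg, h4]
  rw [← ps_tc one_pos hs n, h5, tc]
  simp

lemma ps_uniq' {a b : ℕ → ℂ} {F : ℂ → ℂ} (ha : ∀ z : ℂ, 0 < z.im → HasSum (fun n => a n * e z ^ n) (F z))
    (hb : ∀ z : ℂ, 0 < z.im → HasSum (fun n => b n * e z ^ n) (F z)) (n : ℕ) : a n = b n := by
  have := ps_uniq (d := fun n => a n - b n) (fun q h0 h1 => by
    obtain ⟨z, hz, rfl⟩ := exists_e h0 h1
    have := (ha z hz).sub (hb z hz)
    rw [sub_self] at this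
    refine this.congr_fun fun n => by ring) n
  exact sub_eq_zero.1 this

lemma delta_sum (k q : ℂ) : HasSum (fun n : ℕ => (if n = 0 then k else 0) * q ^ n) k := by
  convert hasSum_single (f := fun n : ℕ => (if n = 0 then k else 0) * q ^ n) 0 ?_ using 1
  · simp
  · intro b hb; simp [hb]

lemma coT {z : ℂ} (hz : 0 < z.im) : HasSum (fun n => co phT n * e z ^ n) (t z) := by
  rw [t_q]; exact co_sum nice_T (norm_e_lt hz)
lemma coG {z : ℂ} (hz : 0 < z.im) : HasSum (fun n => co phG n * e z ^ n) (G z) := by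
  rw [G_q]; exact co_sum nice_G (norm_e_lt hz)
lemma coU {z : ℂ} (hz : 0 < z.im) : HasSum (fun n => co phU n * e z ^ n) (u z) := by
  rw [u_q]; exact co_sum nice_U (norm_e_lt hz)

lemma cT (n : ℕ) (A0 A1 : ℕ → ℂ)
    (hA0 : ∀ z : ℂ, 0 < z.im → HasSum (fun n : ℕ => A0 n * e z ^ n) ((phi0 z + phi1 z) / 2))
    (hA1 : ∀ z : ℂ, 0 < z.im → HasSum (fun n : ℕ => A1 n * e z ^ n) ((phi0 z - phi1 z) / 2)) :
    A0 n - A1 n = co phT n - (if n = 0 then 12 else 0) := by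
  refine ps_uniq' (a := fun n => A0 n - A1 n) (b := fun n => co phT n - (if n = 0 then 12 else 0))
    (F := phi1) (fun z hz => ?_) (fun z hz => ?_) n
  · exact hs_congr ((hA0 z hz).sub (hA1 z hz)) (fun n => by ring) (by ring)
  · rw [phi1_eq hz]
    exact hs_congr ((coT hz).sub (delta_sum 12 (e z))) (fun n => by ring) (by ring)

lemma cG (n : ℕ) (A0 A1 : ℕ → ℂ)
    (hA0 : ∀ z : ℂ, 0 < z.im → HasSum (fun n : ℕ => A0 n * e z ^ n) ((phi0 z + phi1 z) / 2))
    (hA1 : ∀ z : ℂ, 0 < z.im → HasSum (fun n : ℕ => A1 n * e z ^ n) ((phi0 z - phi1 z) / 2)) :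
    A0 n + A1 n = 729 * co phG n + (if n = 0 then 12 else 0) := by
  refine ps_uniq' (a := fun n => A0 n + A1 n) (b := fun n => 729 * co phG n + (if n = 0 then 12 else 0))
    (F := phi0) (fun z hz => ?_) (fun z hz => ?_) n
  · exact hs_congr ((hA0 z hz).add (hA1 z hz)) (fun n => by ring) (by ring)
  · rw [phi0_eq hz]
    exact hs_congr (((coG hz).mul_left 729).add (delta_sum 12 (e z))) (fun n => by ring) (by ring)

lemma cU0 (n : ℕ) (C : ℕ → ℂ)
    (h : ∀ z : ℂ, 0 < z.im → HasSum (fun n : ℕ => C n * e z ^ n) ((fNS z - ftNS z) / 2)) :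
    C n = 2048 * co phU n := by
  refine ps_uniq' (b := fun n => 2048 * co phU n) h (fun z hz => ?_) n
  rw [NS_eq hz]
  exact hs_congr ((coU hz).mul_left 2048) (fun n => by ring) (by ring)

lemma cU1 (n : ℕ) (C : ℕ → ℂ)
    (h : ∀ z : ℂ, 0 < z.im → HasSum (fun n : ℕ => C n * e z ^ n) (-(fR z + 24) / 2)) :
    C n = -2048 * co phU n - (if n = 0 then 24 else 0) := by
  refine ps_uniq' (b := fun n => -2048 * co phU n - (if n = 0 then 24 else 0)) h (fun z hz => ?_) n
  rw [fR_eq z]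
  exact hs_congr (((coU hz).mul_left (-2048)).sub (delta_sum 24 (e z))) (fun n => by ring) (by ring)

lemma ode (w : ℂ) {ρ : ℝ} (hρ : 0 < ρ) (hρ1 : ρ ≤ 1)
    (hg : ∀ p : ℂ, ‖p‖ < ρ → Summable (fun n : ℕ => R (co phT) w n / n * p ^ n))
    {p L : ℂ} (hp : ‖p‖ < ρ) (hL : HasSum (fun n : ℕ => R (co phT) w n / n * p ^ n) L) :
    cexp (-L) = 1 - w * (p * phT p) := by
  set a : ℕ → ℂ := fun n => R (co phT) w n / n with ha
  set g : ℂ → ℂ := fun q => ∑' n, a n * q ^ n with hgd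
  have hs : ∀ q : ℂ, ‖q‖ < ρ → HasSum (fun n => a n * q ^ n) (g q) := fun q hq => (hg q hq).hasSum
  set f0 : ℂ → ℂ := fun q => q * phT q with hf0
  have hs0 : ∀ q : ℂ, ‖q‖ < 1 → HasSum (fun n => co phT n * q ^ n) (f0 q) := fun q hq => co_sum nice_T hq
  have dg := ps_diff hρ hs
  have df : DifferentiableOn ℂ f0 (Metric.ball 0 ρ) := (ps_diff one_pos hs0).mono (Metric.ball_subset_ball hρ1)
  have eqn : ∀ q : ℂ, ‖q‖ < ρ → deriv g q = w * (deriv f0 q + f0 q * deriv g q) := by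
    intro q hq
    have s1 : HasSum (fun n => R (co phT) w (n + 1) * q ^ n) (deriv g q) := by
      refine (tc_sum (dg.deriv Metric.isOpen_ball) hq).congr_fun fun n => ?_
      rw [tc_deriv, ps_tc hρ hs, ha]
      have : ((n : ℂ) + 1) ≠ 0 := by exact_mod_cast n.succ_ne_zero
      push_cast; field_simp
    have s2 : HasSum (fun n : ℕ => ((n : ℂ) + 1) * co phT (n + 1) * q ^ n) (deriv f0 q) := by
      refine (tc_sum (df.deriv Metric.isOpen_ball) hq).congr_fun fun n => ?_
      rw [tc_deriv, ps_tc one_pos hs0]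
    have s3 := hs0 q (hq.trans_le hρ1)
    have n3 := s3.summable.norm
    have n1 := s1.summable.norm
    have s4 : HasSum (fun n => (∑ j ∈ Finset.range n, co phT (j + 1) * R (co phT) w (n - j)) * q ^ n)
        (f0 q * deriv g q) := by
      have hsum := (summable_norm_sum_mul_antidiagonal_of_summable_norm n3 n1).of_norm
      have := tsum_mul_tsum_eq_tsum_sum_antidiagonal_of_summable_norm n3 n1
      rw [s3.tsum_eq, s1.tsum_eq] at this
      rw [this]
      refine hsum.hasSum.congr_fun fun n => ?_
      rw [Finset.Nat.sum_antidiagonal_eq_sum_range_succ (fun i j => co phT i * q ^ i * (R (co phT) w (j + 1) * q ^ j)),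
        Finset.sum_range_succ', Finset.sum_mul]
      simp only [co, zero_mul, add_zero]
      refine Finset.sum_congr rfl fun j hj => ?_
      have hj' : j < n := Finset.mem_range.1 hj
      rw [show n - (j + 1) + 1 = n - j by omega]
      rw [show q ^ n = q ^ (j + 1) * q ^ (n - (j + 1)) by rw [← pow_add]; congr 1; omega]
      ring
    have s5 := (s2.add s4).mul_left w
    refine s1.unique (s5.congr_fun fun n => ?_)
    rw [R_succ]; ring
  set H : ℂ → ℂ := fun q => (1 - w * f0 q) * cexp (g q) with hH
  have hder : ∀ q ∈ Metric.ball (0 : ℂ) ρ, HasDerivAt H 0 q := by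
    intro q hq
    have hq' : ‖q‖ < ρ := by simpa using hq
    have d1 := (dg.differentiableAt (Metric.isOpen_ball.mem_nhds hq)).hasDerivAt
    have d2 := (df.differentiableAt (Metric.isOpen_ball.mem_nhds hq)).hasDerivAt
    have := ((d2.const_mul w).const_sub 1).mul d1.cexp
    refine this.congr_deriv ?_
    have := eqn q hq'
    linear_combination cexp (g q) * this
  have hcon : H p = H 0 := by
    refine (convex_ball (0 : ℂ) ρ).is_const_of_fderivWithin_eq_zero (𝕜 := ℂ)
      (fun q hq => (hder q hq).differentiableAt.differentiableWithinAt) (fun q hq => ?_)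
      (by simpa using hp) (by simpa using hρ)
    rw [fderivWithin_of_isOpen Metric.isOpen_ball hq, (hder q hq).hasFDerivAt.fderiv]
    ext; simp
  have g0 : g 0 = 0 := by
    have h1 := hs 0 (by simpa using hρ)
    have h2 : HasSum (fun n => a n * (0 : ℂ) ^ n) (a 0) := by
      convert hasSum_single (f := fun n => a n * (0 : ℂ) ^ n) 0 ?_ using 1
      · simp
      · intro b hb; simp [hb]
    rw [h1.unique h2]; simp [ha]
  have hgL : g p = L := hL.tsum_eq
  simp only [hH, g0, hgL, hf0, zero_mul, mul_zero, sub_zero, Complex.exp_zero, mul_one] at hcon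
  rw [Complex.exp_neg]
  exact (eq_inv_of_mul_eq_one_left hcon).symm

end C3A

namespace C3A
open Complex Filter Topology
open scoped UpperHalfPlane

noncomputable def am (a : ℤ) (n : ℕ) : ℂ :=
  if 2 ∣ a then (if 3 ∣ a then 0 else 729 * co phG n) else (if 3 ∣ a then 4096 * co phU n else co phT n)

lemma am_zero (a : ℤ) : am a 0 = 0 := by simp [am, co]

lemma am_sum (a : ℤ) {z : ℂ} (hz : 0 < z.im) : HasSum (fun n => am a n * e z ^ n) (cc a z) := by
  unfold am cc
  split_ifs
  · simp [hasSum_zero]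
  · exact hs_congr ((coG hz).mul_left 729) (fun n => by ring) rfl
  · exact hs_congr ((coU hz).mul_left 4096) (fun n => by ring) rfl
  · exact coT hz

lemma roots {d : ℕ} (hd : d ≠ 0) (k : ℕ) :
    ∑ b ∈ Finset.range d, e ((b : ℂ) / d) ^ k = if d ∣ k then (d : ℂ) else 0 := by
  have hd0 : (d : ℂ) ≠ 0 := by exact_mod_cast hd
  have h1 : ∀ b : ℕ, e ((b : ℂ) / d) ^ k = e ((k : ℂ) / d) ^ b := by
    intro b
    rw [← e_nat_mul, ← e_nat_mul]; congr 1; ring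
  simp only [h1]
  split_ifs with h
  · obtain ⟨j, rfl⟩ := h
    have : e (((d * j : ℕ) : ℂ) / d) = 1 := by
      have := e_int j
      rw [← this]; congr 1; push_cast; field_simp
    rw [this]; simp
  · have hne : e ((k : ℂ) / d) ≠ 1 := by
      intro h'
      obtain ⟨m, hm⟩ := e_eq_one h'
      apply h
      have : (k : ℂ) = ((m * d : ℤ) : ℂ) := by push_cast; field_simp at hm; rw [hm]; ring
      have h2 : (k : ℤ) = m * d := by exact_mod_cast this
      exact Int.natCast_dvd_natCast.1 ⟨m, by rw [h2]; ring⟩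
    rw [geom_sum_eq hne, ← e_nat_mul, show ((d : ℂ) * ((k : ℂ) / d)) = ((k : ℤ) : ℂ) by push_cast; field_simp, e_int]
    simp

lemma inner (a d : ℕ) (ha : a ≠ 0) (hd : d ≠ 0) {z : ℂ} (hz : 0 < z.im) :
    HasSum (fun r : ℕ => (d : ℂ) * (am a (r * d) * e z ^ (r * a)))
      (∑ b ∈ Finset.range d, cc a (tri a b d z)) := by
  have hd0 : (d : ℂ) ≠ 0 := by exact_mod_cast hd
  set y := e ((a : ℂ) * z / d) with hy
  have h1 : HasSum (fun k : ℕ => am a k * y ^ k * (if d ∣ k then (d : ℂ) else 0))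
      (∑ b ∈ Finset.range d, cc a (tri a b d z)) := by
    have : ∀ b ∈ Finset.range d, HasSum (fun k : ℕ => am a k * e (tri a b d z) ^ k) (cc a (tri a b d z)) := by
      intro b _
      exact am_sum a (tri_im_pos (by positivity) (by positivity) hz)
    refine hs_congr (hasSum_sum this) (fun k => ?_) rfl
    rw [← roots hd, Finset.mul_sum]
    refine Finset.sum_congr rfl fun b _ => ?_
    rw [mul_assoc, ← mul_pow, hy, ← e_add]
    congr 3; unfold tri; push_cast; ring
  have hinj : Function.Injective (fun r : ℕ => r * d) := fun x y h => Nat.eq_of_mul_eq_mul_right (Nat.pos_of_ne_zero hd) h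
  rw [← hinj.hasSum_iff] at h1
  · refine hs_congr h1 (fun r => ?_) rfl
    simp only [Function.comp, dvd_mul_left, if_true]
    have : y ^ (r * d) = e z ^ (r * a) := by
      rw [hy, ← e_nat_mul, ← e_nat_mul]; congr 1; push_cast; field_simp
    rw [this]; ring
  · intro k hk
    rw [if_neg, mul_zero]
    rintro ⟨j, rfl⟩
    exact hk ⟨j, mul_comm _ _⟩

/-- the triple series -/
noncomputable def F (p q : ℂ) (x : (ℕ × ℕ) × ℕ) : ℂ :=
  am x.1.1 (x.2 * x.1.2) / x.1.1 * (p ^ (x.1.1 * x.1.2) * q ^ (x.2 * x.1.1))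

lemma F_sum {p z L : ℂ} (hz : 0 < z.im) (h : HasSum (F p (e z)) L) :
    HasSum (fun n : ℕ => N n z / n * p ^ n) L := by
  set H : ℕ × ℕ → ℂ := fun x => (∑ b ∈ Finset.range x.2, cc x.1 (tri x.1 b x.2 z)) / (x.1 * x.2) * p ^ (x.1 * x.2) with hH
  have h1 : HasSum H L := by
    refine h.prod_fiberwise fun x => ?_
    obtain ⟨a, d⟩ := x
    by_cases ha : a = 0
    · subst ha; simp [F, hH, hasSum_zero]
    by_cases hd : d = 0
    · subst hd; simp [F, hH, am_zero, hasSum_zero]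
    have hd0 : (d : ℂ) ≠ 0 := by exact_mod_cast hd
    have ha0 : (a : ℂ) ≠ 0 := by exact_mod_cast ha
    refine hs_congr ((inner a d ha hd hz).mul_right (1 / (a * d) * p ^ (a * d))) (fun r => ?_) ?_
    · simp only [F]; field_simp
    · simp only [hH]; ring
  have h2 := h1.tsum_fiberwise (fun x : ℕ × ℕ => x.1 * x.2)
  refine hs_congr h2 (fun n => ?_) rfl
  by_cases hn : n = 0
  · subst hn
    have : ∀ b : ((fun x : ℕ × ℕ => x.1 * x.2) ⁻¹' {0}), H b = 0 := by
      rintro ⟨⟨a, d⟩, hb⟩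
      have hb' : a * d = 0 := hb
      rcases mul_eq_zero.1 hb' with h0 | h0
      · simp [hH, h0]
      · simp [hH, h0]
    rw [tsum_congr this]; simp
  · have hset : ((fun x : ℕ × ℕ => x.1 * x.2) ⁻¹' {n}) = ↑(n.divisorsAntidiagonal) := by
      ext x; simp [hn]
    rw [hset, Finset.tsum_subtype', N, S, Finset.sum_sigma, Finset.sum_div, Finset.sum_mul]
    refine Finset.sum_congr rfl fun x hx => ?_
    have hx' := (Nat.mem_divisorsAntidiagonal.1 hx).1
    simp only [hH, hx']
    congr 2
    rw [← hx']; push_cast; rfl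

lemma geo3 : Summable (fun x : (ℕ × ℕ) × ℕ => ((1 / 2 : ℝ) ^ x.1.1 * (1 / 2) ^ x.1.2) * (1 / 2) ^ x.2) := by
  have g : Summable (fun n : ℕ => (1 / 2 : ℝ) ^ n) := summable_geometric_two
  have h0 : (0 : ℕ → ℝ) ≤ fun n : ℕ => (1 / 2 : ℝ) ^ n := fun n => by positivity
  exact (g.mul_of_nonneg g h0 h0).mul_of_nonneg g (fun n => by positivity) h0

noncomputable def B : ℝ := Real.exp (3 * Real.pi)
lemma B_one : 1 ≤ B := by unfold B; rw [Real.one_le_exp_iff]; have := Real.pi_pos; positivity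

lemma bnd {x y : ℝ} (hx0 : 0 ≤ x) (hy0 : 0 ≤ y) (hx : B * x ≤ 1 / 2) (hy : B * y ≤ 1 / 2)
    {m d r : ℕ} (hm : m ≠ 0) (hd : d ≠ 0) (hr : r ≠ 0) :
    (B ^ r * B ^ d) * (x ^ (m * d) * y ^ (r * m)) ≤ 2 * (((1 / 2) ^ m * (1 / 2) ^ d) * (1 / 2) ^ r) := by
  have hB := B_one
  have h1 : B ^ r * y ^ (r * m) ≤ (1 / 2) ^ (r * m) := by
    calc _ ≤ B ^ (r * m) * y ^ (r * m) := by
          gcongr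
          exact Nat.le_mul_of_pos_right _ (Nat.pos_of_ne_zero hm)
      _ = (B * y) ^ (r * m) := by rw [mul_pow]
      _ ≤ _ := by gcongr
  have h2 : B ^ d * x ^ (m * d) ≤ (1 / 2) ^ (m * d) := by
    calc _ ≤ B ^ (m * d) * x ^ (m * d) := by
          gcongr
          exact Nat.le_mul_of_pos_left _ (Nat.pos_of_ne_zero hm)
      _ = (B * x) ^ (m * d) := by rw [mul_pow]
      _ ≤ _ := by gcongr
  calc _ = (B ^ d * x ^ (m * d)) * (B ^ r * y ^ (r * m)) := by ring
    _ ≤ (1 / 2) ^ (m * d) * (1 / 2) ^ (r * m) := by gcongr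
    _ = (1 / 2) ^ (m * d + r * m) := by rw [pow_add]
    _ ≤ (1 / 2) ^ (m + d + r - 1) := by
      apply pow_le_pow_of_le_one (by norm_num) (by norm_num)
      obtain ⟨m, rfl⟩ := Nat.exists_eq_succ_of_ne_zero hm
      obtain ⟨d, rfl⟩ := Nat.exists_eq_succ_of_ne_zero hd
      simp only [Nat.succ_eq_add_one]
      have : m * 1 ≤ m * r := Nat.mul_le_mul_left _ (Nat.pos_of_ne_zero hr)
      have e1 : (m + 1) * (d + 1) + r * (m + 1) = m * d + m + d + 1 + m * r + r := by ring
      have : 0 ≤ m * d := Nat.zero_le _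
      omega
    _ = _ := by
      have : m + d + r = (m + d + r - 1) + 1 := by omega
      rw [← pow_add, ← pow_add, this, pow_succ]; simp; ring

lemma am_bound : ∃ K > (0 : ℝ), ∀ (a : ℤ) (r d : ℕ), ‖am a (r * d)‖ ≤ K * (B ^ r * B ^ d) := by
  obtain ⟨K1, h1, b1⟩ := gr_T.bound2 nice_T
  obtain ⟨K2, h2, b2⟩ := gr_G.bound2 nice_G
  obtain ⟨K3, h3, b3⟩ := gr_U.bound2 nice_U
  refine ⟨K1 + 729 * K2 + 4096 * K3, by positivity, fun a r d => ?_⟩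
  have hB : 0 ≤ B ^ r * B ^ d := by have := B_one; positivity
  have c1 := b1 r d
  have c2 := b2 r d
  have c3 := b3 r d
  change _ ≤ _ * (B ^ r * B ^ d) at c1 c2 c3
  have m1 := mul_nonneg h1.le hB
  have m2 := mul_nonneg h2.le hB
  have m3 := mul_nonneg h3.le hB
  unfold am
  split_ifs
  · simp; nlinarith
  · rw [norm_mul]; norm_num; nlinarith
  · rw [norm_mul]; norm_num; nlinarith
  · nlinarith

lemma F_summable {p q : ℂ} (hp : B * ‖p‖ ≤ 1 / 2) (hq : B * ‖q‖ ≤ 1 / 2) : Summable (F p q) := by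
  obtain ⟨K, hK, hb⟩ := am_bound
  refine Summable.of_norm_bounded (geo3.mul_left (K * 2)) fun x => ?_
  obtain ⟨⟨m, d⟩, r⟩ := x
  by_cases hm : m = 0
  · subst hm; simp [F]; positivity
  by_cases hd : d = 0
  · subst hd; simp [F, am_zero]; positivity
  by_cases hr : r = 0
  · subst hr; simp [F, am_zero]; positivity
  have hm1 : (1 : ℝ) ≤ m := by exact_mod_cast Nat.pos_of_ne_zero hm
  simp only [F, norm_mul, norm_div, norm_pow, Complex.norm_natCast]
  calc _ ≤ (K * (B ^ r * B ^ d)) / 1 * (‖p‖ ^ (m * d) * ‖q‖ ^ (r * m)) := by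
        gcongr
        · have := B_one; positivity
        · exact hb _ _ _
    _ = K * ((B ^ r * B ^ d) * (‖p‖ ^ (m * d) * ‖q‖ ^ (r * m))) := by ring
    _ ≤ K * (2 * (((1 / 2) ^ m * (1 / 2) ^ d) * (1 / 2) ^ r)) := by
        exact mul_le_mul_of_nonneg_left (bnd (norm_nonneg _) (norm_nonneg _) hp hq hm hd hr) hK.le
    _ = _ := by ring

lemma hcT (q : ℂ) (hq : ‖q‖ < 1) : HasSum (fun n => co phT (n + 1) * q ^ n) (phT q) := tc_sum nice_T.diff hq

lemma F_exp {p z L : ℂ} (hz : 0 < z.im) (hp : B * ‖p‖ < 1 / 2) (hq : B * ‖e z‖ ≤ 1 / 2)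
    (h : HasSum (F p (e z)) L) : cexp (-L) = 1 - t z * (p * phT p) := by
  have hB := B_one
  have key : ∀ {p L : ℂ}, HasSum (F p (e z)) L → HasSum (fun n : ℕ => R (co phT) (t z) n / n * p ^ n) L := by
    intro p L h
    refine hs_congr (F_sum hz h) (fun n => ?_) rfl
    by_cases hn : n = 0
    · subst hn; simp
    · rw [N_eq_R _ hcT n hn hz]
  have hpos : 0 < 1 / (2 * B) := by positivity
  refine ode (t z) (ρ := 1 / (2 * B)) hpos ?_ (fun p hp => ?_) ?_ (key h)
  · rw [div_le_one (by positivity)]; linarith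
  · refine (key (F_summable ?_ hq).hasSum).summable
    rw [lt_div_iff₀ (by positivity)] at hp; linarith
  · rw [lt_div_iff₀ (by positivity)]; linarith

end C3A

namespace C3A
open Complex Filter Topology
open scoped UpperHalfPlane

noncomputable def W (k : Fin 3) : ℂ := cexp (2 * Real.pi * I * ((k : ℕ) : ℂ) / 3)

lemma W_e (k : Fin 3) : W k = e (((k : ℕ) : ℂ) / (3 : ℕ)) := by
  unfold W e; congr 1; push_cast; ring

lemma W_norm (k : Fin 3) : ‖W k‖ = 1 := by
  rw [W_e, norm_e]
  have : ((((k : ℕ) : ℂ) / (3 : ℕ)).im) = 0 := by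
    rw [show (((k : ℕ) : ℂ) / (3 : ℕ)) = ((((k : ℕ) : ℝ) / (3 : ℕ) : ℝ) : ℂ) by push_cast; rfl, ofReal_im]
  rw [this]; simp

lemma W_zero : W 0 = 1 := by simp [W]

lemma W_sum (m : ℕ) : W 0 ^ m + W 1 ^ m + W 2 ^ m = if 3 ∣ m then 3 else 0 := by
  have := roots (d := 3) (by norm_num) m
  rw [Finset.sum_range (n := 3), Fin.sum_univ_three] at this
  simp only [W_e]
  exact_mod_cast this

lemma chat_sum (C A : ℕ → ℂ) (n m : ℕ) :
    ∑ k : Fin 3, W k ^ m * Chat C A n k = if 3 ∣ m then C n else A n := by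
  have h := W_sum m
  rw [Fin.sum_univ_three]
  simp only [Chat, W_zero, one_pow] at h ⊢
  have e1 : (1 : Fin 3) ≠ 0 := by decide
  have e2 : (2 : Fin 3) ≠ 0 := by decide
  rw [if_neg e1, if_neg e2, if_pos trivial]
  split_ifs at h ⊢
  · linear_combination (1 / 3) * (C n - A n) * h
  · linear_combination (1 / 3) * (C n - A n) * h

/-- hypotheses on coefficients -/
structure Hyp (C0 C1 A0 A1 : ℕ → ℂ) : Prop where
  T : ∀ n, A0 n - A1 n = co phT n - (if n = 0 then 12 else 0)
  G : ∀ n, A0 n + A1 n = 729 * co phG n + (if n = 0 then 12 else 0)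
  U0 : ∀ n, C0 n = 2048 * co phU n
  U1 : ∀ n, C1 n = -2048 * co phU n - (if n = 0 then 24 else 0)

variable {C0 C1 A0 A1 : ℕ → ℂ}

lemma Hyp.sgn (h : Hyp C0 C1 A0 A1) {n : ℕ} (hn : n ≠ 0) (m : ℕ) :
    (if 3 ∣ m then C0 n else A0 n) + (-1) ^ m * (if 3 ∣ m then C1 n else A1 n) = am m n := by
  have hT := h.T n
  have hG := h.G n
  have h0 := h.U0 n
  have h1 := h.U1 n
  rw [if_neg hn] at hT hG h1
  have d2 : ((2 : ℤ) ∣ (m : ℤ)) ↔ 2 ∣ m := by exact_mod_cast Int.natCast_dvd_natCast (m := 2) (n := m)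
  have d3 : ((3 : ℤ) ∣ (m : ℤ)) ↔ 3 ∣ m := by exact_mod_cast Int.natCast_dvd_natCast (m := 3) (n := m)
  simp only [am, d2, d3]
  by_cases h2 : 2 ∣ m
  · rw [(even_iff_two_dvd.2 h2).neg_one_pow, if_pos h2]
    split_ifs
    · linear_combination h0 + h1
    · linear_combination hG
  · rw [(Nat.not_even_iff_odd.1 (fun h' => h2 (even_iff_two_dvd.1 h'))).neg_one_pow, if_neg h2]
    split_ifs
    · linear_combination h0 - h1
    · linear_combination hT

lemma chat_norm (C A : ℕ → ℂ) (n : ℕ) (k : Fin 3) : ‖Chat C A n k‖ ≤ ‖C n‖ + ‖A n‖ := by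
  unfold Chat
  have n3 : ‖(3 : ℂ)‖ = 3 := by simp
  have hk : ‖(3 * (if k = 0 then 1 else 0) - 1 : ℂ)‖ ≤ 2 := by
    split_ifs <;> norm_num
  have h1 : ‖C n + (3 * (if k = 0 then 1 else 0) - 1) * A n‖ ≤ ‖C n‖ + 2 * ‖A n‖ := by
    refine (norm_add_le _ _).trans ?_
    rw [norm_mul]; gcongr
  rw [norm_mul, norm_div, n3, norm_one]
  have := norm_nonneg (C n)
  have := norm_nonneg (A n)
  linarith

lemma Hyp.bound (h : Hyp C0 C1 A0 A1) : ∃ K > (0 : ℝ), ∀ (k : Fin 3) (r d : ℕ), r * d ≠ 0 →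
    ‖Chat C0 A0 (r * d) k‖ + ‖Chat C1 A1 (r * d) k‖ ≤ K * (B ^ r * B ^ d) := by
  obtain ⟨K, hK, hb⟩ := am_bound
  refine ⟨4 * K, by positivity, fun k r d hn => ?_⟩
  set n := r * d with hnd
  have a1 := hb 1 r d
  have a2 := hb 2 r d
  have a3 := hb 3 r d
  rw [← hnd] at a1 a2 a3
  have hT := h.T n
  have hG := h.G n
  have h0 := h.U0 n
  have h1 := h.U1 n
  rw [if_neg hn] at hT hG h1
  have e1 : am 1 n = co phT n := by norm_num [am]
  have e2 : am 2 n = 729 * co phG n := by norm_num [am]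
  have e3 : am 3 n = 4096 * co phU n := by norm_num [am]
  have f0 : C0 n = (1 / 2) * am 3 n := by rw [e3, h0]; ring
  have f1 : C1 n = -(1 / 2) * am 3 n := by rw [e3, h1]; ring
  have g0 : A0 n = (1 / 2) * am 2 n + (1 / 2) * am 1 n := by rw [e2, e1]; linear_combination (hT + hG) / 2
  have g1 : A1 n = (1 / 2) * am 2 n - (1 / 2) * am 1 n := by rw [e2, e1]; linear_combination (hG - hT) / 2
  have i0 : ‖C0 n‖ ≤ K * (B ^ r * B ^ d) := by
    rw [f0, norm_mul]; norm_num; linarith [norm_nonneg (am 3 n)]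
  have i1 : ‖C1 n‖ ≤ K * (B ^ r * B ^ d) := by
    rw [f1, norm_mul]; norm_num; linarith [norm_nonneg (am 3 n)]
  have j0 : ‖A0 n‖ ≤ K * (B ^ r * B ^ d) := by
    rw [g0]; refine (norm_add_le _ _).trans ?_
    rw [norm_mul, norm_mul]; norm_num; linarith
  have j1 : ‖A1 n‖ ≤ K * (B ^ r * B ^ d) := by
    rw [g1]; refine (norm_sub_le _ _).trans ?_
    rw [norm_mul, norm_mul]; norm_num; linarith
  have := chat_norm C0 A0 n k
  have := chat_norm C1 A1 n k
  linarith

/-- argument -/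
noncomputable def X (p q : ℂ) (z : ℕ × Fin 3 × ℕ) : ℂ := W z.2.1 * p ^ (z.1 + 1) * q ^ z.2.2

lemma X_norm (p q : ℂ) (z : ℕ × Fin 3 × ℕ) : ‖X p q z‖ = ‖p‖ ^ (z.1 + 1) * ‖q‖ ^ z.2.2 := by
  simp [X, W_norm]

/-- log of a factor -/
noncomputable def el (C0 C1 A0 A1 : ℕ → ℂ) (p q : ℂ) (z : ℕ × Fin 3 × ℕ) : ℂ :=
  Chat C0 A0 (z.2.2 * (z.1 + 1)) z.2.1 * log (1 - X p q z) + Chat C1 A1 (z.2.2 * (z.1 + 1)) z.2.1 * log (1 + X p q z)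

noncomputable def TT (C0 C1 A0 A1 : ℕ → ℂ) (p q : ℂ) (x : ((ℕ × ℕ) × ℕ) × Fin 3) : ℂ :=
  if x.1.2 = 0 then 0 else
  -(Chat C0 A0 (x.1.2 * (x.1.1.2 + 1)) x.2 * (X p q (x.1.1.2, x.2, x.1.2) ^ x.1.1.1 / x.1.1.1)
   + Chat C1 A1 (x.1.2 * (x.1.1.2 + 1)) x.2 * ((-X p q (x.1.1.2, x.2, x.1.2)) ^ x.1.1.1 / x.1.1.1))

lemma Hyp.TT_summable (h : Hyp C0 C1 A0 A1) {p q : ℂ} (hp : B * ‖p‖ ≤ 1 / 2) (hq : B * ‖q‖ ≤ 1 / 2) :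
    Summable (TT C0 C1 A0 A1 p q) := by
  obtain ⟨K, hK, hb⟩ := h.bound
  have hs : Summable (fun _ : Fin 3 => (1 : ℝ)) := (hasSum_fintype _).summable
  have g4 := geo3.mul_of_nonneg hs (fun _ => by positivity) (fun _ => by simp)
  refine Summable.of_norm_bounded (g4.mul_left (K * 2)) fun x => ?_
  obtain ⟨⟨⟨m, d⟩, r⟩, k⟩ := x
  by_cases hr : r = 0
  · subst hr; simp [TT]; positivity
  by_cases hm : m = 0
  · subst hm; simp [TT]; positivity
  have hm1 : (1 : ℝ) ≤ m := by exact_mod_cast Nat.pos_of_ne_zero hm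
  have hn : r * (d + 1) ≠ 0 := by simp [hr]
  have hb' := hb k r (d + 1) hn
  have hXm : ‖X p q (d, k, r)‖ ^ m / m ≤ ‖p‖ ^ (m * (d + 1)) * ‖q‖ ^ (r * m) := by
    rw [X_norm, mul_pow, ← pow_mul, ← pow_mul, mul_comm m]
    exact div_le_self (by positivity) hm1
  have hX0 : 0 ≤ ‖X p q (d, k, r)‖ ^ m / m := by positivity
  simp only [TT, if_neg hr, norm_neg]
  refine (norm_add_le _ _).trans ?_
  simp only [norm_mul, norm_div, norm_pow, norm_neg, Complex.norm_natCast]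
  rw [← add_mul]
  calc _ ≤ (K * (B ^ r * B ^ (d + 1))) * (‖p‖ ^ (m * (d + 1)) * ‖q‖ ^ (r * m)) := by
        have := B_one
        exact mul_le_mul hb' hXm hX0 (by positivity)
    _ = K * ((B ^ r * B ^ (d + 1)) * (‖p‖ ^ (m * (d + 1)) * ‖q‖ ^ (r * m))) := by ring
    _ ≤ K * (2 * (((1 / 2) ^ m * (1 / 2) ^ (d + 1)) * (1 / 2) ^ r)) :=
        mul_le_mul_of_nonneg_left (bnd (norm_nonneg _) (norm_nonneg _) hp hq hm (by simp) hr) hK.le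
    _ ≤ K * (2 * (((1 / 2) ^ m * (1 / 2) ^ d) * (1 / 2) ^ r)) := by
        have : (1 / 2 : ℝ) ^ (d + 1) ≤ (1 / 2) ^ d := pow_le_pow_of_le_one (by norm_num) (by norm_num) (by omega)
        gcongr
    _ = _ := by ring

def reidx : (ℕ × Fin 3 × ℕ) × ℕ ≃ ((ℕ × ℕ) × ℕ) × Fin 3 where
  toFun x := (((x.2, x.1.1), x.1.2.2), x.1.2.1)
  invFun y := ((y.1.1.2, y.2, y.1.2), y.1.1.1)
  left_inv _ := rfl
  right_inv _ := rfl

lemma half_of {x : ℝ} (h0 : 0 ≤ x) (h : B * x ≤ 1 / 2) : x ≤ 1 / 2 := by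
  have := B_one; nlinarith

lemma X_lt {p q : ℂ} (hp : B * ‖p‖ ≤ 1 / 2) (hq : B * ‖q‖ ≤ 1 / 2) (z : ℕ × Fin 3 × ℕ) : ‖X p q z‖ ≤ 1 / 2 := by
  have hp' := half_of (norm_nonneg _) hp
  have hq' := half_of (norm_nonneg _) hq
  rw [X_norm]
  calc _ ≤ ‖p‖ ^ 1 * 1 := by
        refine mul_le_mul ?_ ?_ (by positivity) (by positivity)
        · exact pow_le_pow_of_le_one (norm_nonneg _) (by linarith) (by omega)
        · exact pow_le_one₀ (norm_nonneg _) (by linarith)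
    _ ≤ 1 / 2 := by simpa using hp'

lemma Hyp.part1 (h : Hyp C0 C1 A0 A1) {p z : ℂ} (hz : 0 < z.im) (hp : B * ‖p‖ < 1 / 2) (hq : B * ‖e z‖ ≤ 1 / 2) :
    ∃ S1, HasSum (fun x : ℕ × Fin 3 × ℕ => if x.2.2 = 0 then 0 else el C0 C1 A0 A1 p (e z) x) S1 ∧
      cexp S1 = 1 - t z * (p * phT p) := by
  obtain ⟨S1, hS⟩ := h.TT_summable hp.le hq
  refine ⟨S1, ?_, ?_⟩
  · have h1 := (reidx.hasSum_iff).2 hS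
    refine h1.prod_fiberwise fun x => ?_
    obtain ⟨d, k, r⟩ := x
    by_cases hr : r = 0
    · subst hr; simp [TT, reidx, hasSum_zero]
    have hX := X_lt hp.le hq (d, k, r)
    have l1 := Complex.hasSum_taylorSeries_neg_log (z := X p (e z) (d, k, r)) (by linarith)
    have l2 := Complex.hasSum_taylorSeries_neg_log (z := -X p (e z) (d, k, r)) (by rw [norm_neg]; linarith)
    refine hs_congr ((l1.mul_left (Chat C0 A0 (r * (d + 1)) k)).add (l2.mul_left (Chat C1 A1 (r * (d + 1)) k))).neg
      (fun m => ?_) ?_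
    · simp [TT, reidx, hr]
    · simp only [if_neg hr, el, sub_neg_eq_add]; ring
  · have h1 : HasSum (fun x : (ℕ × ℕ) × ℕ => -F p (e z) ((x.1.1, x.1.2 + 1), x.2)) S1 := by
      refine hS.prod_fiberwise fun x => ?_
      obtain ⟨⟨m, d⟩, r⟩ := x
      refine hs_congr (hasSum_fintype _) (fun m => rfl) ?_
      by_cases hr : r = 0
      · subst hr; simp [TT, F, am_zero]
      have hn : r * (d + 1) ≠ 0 := by simp [hr]
      simp only [TT, if_neg hr, F]
      rw [← h.sgn hn m, ← chat_sum C0 A0, ← chat_sum C1 A1]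
      rw [Fin.sum_univ_three, Fin.sum_univ_three, Fin.sum_univ_three]
      have hX : ∀ k, X p (e z) (d, k, r) ^ m = W k ^ m * (p ^ (m * (d + 1)) * e z ^ (r * m)) := by
        intro k; simp only [X]; rw [mul_pow, mul_pow, ← pow_mul, ← pow_mul, mul_comm m, mul_assoc]
      have hX' : ∀ k, (-X p (e z) (d, k, r)) ^ m = (-1) ^ m * (W k ^ m * (p ^ (m * (d + 1)) * e z ^ (r * m))) := by
        intro k; rw [neg_pow, hX]
      simp only [hX, hX']
      ring
    have h2 : HasSum (F p (e z)) (-S1) := by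
      have hinj : Function.Injective (fun x : (ℕ × ℕ) × ℕ => ((x.1.1, x.1.2 + 1), x.2)) := by
        rintro ⟨⟨a, b⟩, c⟩ ⟨⟨a', b'⟩, c'⟩ h; simpa using h
      rw [← hinj.hasSum_iff]
      · exact hs_congr h1.neg (fun x => by simp) rfl
      · rintro ⟨⟨m, d⟩, r⟩ hx
        have : d = 0 := by
          by_contra hd
          exact hx ⟨((m, d - 1), r), by simp; omega⟩
        subst this; simp [F, am_zero]
    have := F_exp hz hp hq h2
    rwa [neg_neg] at this

lemma Hyp.zero (h : Hyp C0 C1 A0 A1) (k : Fin 3) : Chat C0 A0 0 k = 0 ∧ Chat C1 A1 0 k = if k = 0 then 0 else -12 := by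
  have hT := h.T 0
  have hG := h.G 0
  have h0 := h.U0 0
  have h1 := h.U1 0
  simp only [if_true, co] at hT hG h0 h1
  have a0 : A0 0 = 0 := by linear_combination (hT + hG) / 2
  have a1 : A1 0 = 12 := by linear_combination (hG - hT) / 2
  constructor
  · rw [Chat, a0, h0]; ring
  · rw [Chat, a1, h1]; split_ifs <;> ring

lemma hp_P {p : ℂ} (hp : ‖p‖ < 1) (j : ℕ) (hj : j ≠ 0) : HasProd (fun n : ℕ => 1 - (p ^ (n + 1)) ^ j) (P (p ^ j)) := by
  have := (multip (pow_ball hp j hj) 1).hasProd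
  have e1 : (fun n : ℕ => 1 - (p ^ j) ^ (n + 1)) = fun n : ℕ => 1 - (p ^ (n + 1)) ^ j := by
    funext n; rw [← pow_mul, ← pow_mul, mul_comm]
  rw [← e1]; exact this

lemma Hyp.part0 (h : Hyp C0 C1 A0 A1) {p q : ℂ} (hp : B * ‖p‖ < 1 / 2) :
    ∃ S0, HasSum (fun x : ℕ × Fin 3 => el C0 C1 A0 A1 p q (x.1, x.2, 0)) S0 ∧
      cexp S0 = (phT p)⁻¹ := by
  have hp' := half_of (norm_nonneg _) hp.le
  have hp1 : ‖p‖ < 1 := by linarith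
  have hel : ∀ x : ℕ × Fin 3, el C0 C1 A0 A1 p q (x.1, x.2, 0) =
      (if x.2 = 0 then 0 else -12) * log (1 + W x.2 * p ^ (x.1 + 1)) := by
    intro x
    simp [el, X, (h.zero x.2).1, (h.zero x.2).2]
  have hpn : ∀ d : ℕ, ‖p‖ ^ (d + 1) ≤ 1 / 2 := fun d =>
    (pow_le_of_le_one (norm_nonneg _) hp1.le (by omega)).trans hp'
  have hs : Summable (fun x : ℕ × Fin 3 => el C0 C1 A0 A1 p q (x.1, x.2, 0)) := by
    have hs3 : Summable (fun _ : Fin 3 => (1 : ℝ)) := (hasSum_fintype _).summable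
    have g := (summable_geometric_of_lt_one (norm_nonneg p) hp1).mul_of_nonneg hs3
      (fun _ => by positivity) (fun _ => by simp)
    refine Summable.of_norm_bounded (g.mul_left 18) fun x => ?_
    obtain ⟨d, k⟩ := x
    rw [hel]
    simp only [norm_mul, mul_one]
    have hw : ‖W k * p ^ (d + 1)‖ = ‖p‖ ^ (d + 1) := by simp [W_norm]
    have l := Complex.norm_log_one_add_half_le_self (z := W k * p ^ (d + 1)) (by rw [hw]; exact hpn d)
    rw [hw] at l
    have c : ‖(if k = 0 then 0 else -12 : ℂ)‖ ≤ 12 := by split_ifs <;> norm_num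
    have : ‖p‖ ^ (d + 1) ≤ ‖p‖ ^ d := pow_le_pow_of_le_one (norm_nonneg _) hp1.le (by omega)
    calc _ ≤ 12 * (3 / 2 * ‖p‖ ^ (d + 1)) := by gcongr
      _ ≤ _ := by linarith
  obtain ⟨S0, hS0⟩ := hs
  refine ⟨S0, hS0, ?_⟩
  have h1 : HasSum (fun d : ℕ => -12 * log (1 + W 1 * p ^ (d + 1)) + -12 * log (1 + W 2 * p ^ (d + 1))) S0 := by
    refine hS0.prod_fiberwise fun d => ?_
    refine hs_congr (hasSum_fintype _) (fun m => rfl) ?_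
    rw [Fin.sum_univ_three]
    have e1 : (1 : Fin 3) ≠ 0 := by decide
    have e2 : (2 : Fin 3) ≠ 0 := by decide
    rw [hel (d, 0), hel (d, 1), hel (d, 2)]
    dsimp only
    rw [if_neg e1, if_neg e2]; simp
  have h2 := h1.cexp
  have w1 : W 1 + W 2 = -1 := by
    have := W_sum 1; norm_num [W_zero] at this; linear_combination this
  have w2 : W 1 * W 2 = 1 := by
    have := W_sum 2; norm_num [W_zero] at this
    linear_combination ((W 1 + W 2 - 1) * w1 - this) / 2
  have nz : ∀ (k : Fin 3) (d : ℕ), 1 + W k * p ^ (d + 1) ≠ 0 := by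
    intro k d h0
    have : ‖W k * p ^ (d + 1)‖ = 1 := by
      rw [show W k * p ^ (d + 1) = -1 by linear_combination h0]; simp
    have hw : ‖W k * p ^ (d + 1)‖ = ‖p‖ ^ (d + 1) := by simp [W_norm]
    have := hpn d
    linarith
  have a1 := hp_P hp1 1 (by norm_num)
  have a2 := hp_P hp1 2 (by norm_num)
  have a3 := hp_P hp1 3 (by norm_num)
  have a6 := hp_P hp1 6 (by norm_num)
  have c1 : Continuous (powMonoidHom 12 : ℂ →* ℂ) := by
    change Continuous (fun x : ℂ => x ^ 12); fun_prop
  have L := h2.mul ((a1.mul a6).map (powMonoidHom 12) c1)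
  have R' := (a2.mul a3).map (powMonoidHom 12) c1
  have key : cexp S0 * (P (p ^ 1) * P (p ^ 6)) ^ 12 = (P (p ^ 2) * P (p ^ 3)) ^ 12 := by
    refine L.unique ?_
    change HasProd _ (powMonoidHom 12 (P (p ^ 2) * P (p ^ 3)))
    convert R' using 1
    funext d
    simp only [Function.comp, powMonoidHom_apply]
    set x := p ^ (d + 1) with hx
    have n1 := nz 1 d
    have n2 := nz 2 d
    rw [← hx] at n1 n2
    have ex : ∀ y : ℂ, y ≠ 0 → cexp (-12 * log y) = (y ^ 12)⁻¹ := by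
      intro y hy
      rw [show -12 * log y = -((12 : ℕ) * log y) by push_cast; ring, Complex.exp_neg, Complex.exp_nat_mul, Complex.exp_log hy]
    rw [Complex.exp_add, ex _ n1, ex _ n2, ← mul_inv, ← mul_pow, inv_mul_eq_iff_eq_mul₀ (pow_ne_zero _ (mul_ne_zero n1 n2)), ← mul_pow]
    congr 1
    have : (1 + W 1 * x) * (1 + W 2 * x) = 1 - x + x ^ 2 := by
      linear_combination x * w1 + x ^ 2 * w2
    rw [this]; ring
  have p1 := P_ne (pow_ball hp1 1 (by norm_num))
  have p2 := P_ne (pow_ball hp1 2 (by norm_num))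
  have p3 := P_ne (pow_ball hp1 3 (by norm_num))
  have p6 := P_ne (pow_ball hp1 6 (by norm_num))
  rw [phT, div_pow, inv_div, eq_div_iff (pow_ne_zero _ (mul_ne_zero p1 p6))]
  exact key

lemma Hyp.main (h : Hyp C0 C1 A0 A1) {p z : ℂ} (hz : 0 < z.im) (hp : B * ‖p‖ < 1 / 2) (hq : B * ‖e z‖ ≤ 1 / 2) :
    HasProd (fun x => cexp (el C0 C1 A0 A1 p (e z) x)) ((phT p)⁻¹ * (1 - t z * (p * phT p))) := by
  obtain ⟨S0, h0, e0⟩ := h.part0 (q := e z) hp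
  obtain ⟨S1, h1, e1⟩ := h.part1 hz hp hq
  have h0' : HasSum (fun x : ℕ × Fin 3 × ℕ => if x.2.2 = 0 then el C0 C1 A0 A1 p (e z) x else 0) S0 := by
    have hinj : Function.Injective (fun x : ℕ × Fin 3 => (x.1, x.2, 0) : ℕ × Fin 3 → ℕ × Fin 3 × ℕ) := by
      rintro ⟨a, b⟩ ⟨a', b'⟩ h; simpa using h
    rw [← hinj.hasSum_iff]
    · exact hs_congr h0 (fun x => by simp) rfl
    · rintro ⟨d, k, r⟩ hx
      rw [if_neg]
      rintro hr
      exact hx ⟨(d, k), by simp at hr; simp [hr]⟩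
  have h2 := (h0'.add h1).cexp
  rw [Complex.exp_add, e0, e1] at h2
  convert h2 using 1
  funext x
  simp only [Function.comp]
  split_ifs <;> simp

end C3A

/-- the `g`-twisted denominator identity for the class 3A of Co₀.
    With `A_s(n)` the Fourier coefficients of `(φ₀ + (−1)^s φ₁)/2` and `C_{0,s}(n)` the
    integer Fourier coefficients of `F_{0,0} = (f_NS − f̃_NS)/2` and `F_{0,1} = −(f_R+24)/2`,
    there is `Y > 0` such that for `Im σ, Im τ > Y` the product over `d ≥ 1`,
    `k ∈ {0,1,2}`, `r ≥ 0` of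
    `(1 − e^{2πik/3} p^d q^r)^{Ĉ₀(rd,k)} (1 + e^{2πik/3} p^d q^r)^{Ĉ₁(rd,k)}`
    (with `w^β := exp(β·Log w)`) converges (absolutely, i.e. unconditionally) to
    `p · (η(2σ)^{12} η(3σ)^{12}/(η(σ)^{12} η(6σ)^{12}) − 12 − φ₁(τ))`. -/
theorem statement13 (A0 A1 : ℕ → ℂ) (C00 C01 : ℕ → ℤ)
    (hA0 : ∀ τ : ℂ, 0 < τ.im →
      HasSum (fun n : ℕ => A0 n * Complex.exp (2 * Real.pi * Complex.I * τ) ^ n)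
        ((phi0 τ + phi1 τ) / 2))
    (hA1 : ∀ τ : ℂ, 0 < τ.im →
      HasSum (fun n : ℕ => A1 n * Complex.exp (2 * Real.pi * Complex.I * τ) ^ n)
        ((phi0 τ - phi1 τ) / 2))
    (h00 : ∀ τ : ℂ, 0 < τ.im →
      HasSum (fun n : ℕ => (C00 n : ℂ) * Complex.exp (2 * Real.pi * Complex.I * τ) ^ n)
        ((fNS τ - ftNS τ) / 2))
    (h01 : ∀ τ : ℂ, 0 < τ.im →
      HasSum (fun n : ℕ => (C01 n : ℂ) * Complex.exp (2 * Real.pi * Complex.I * τ) ^ n)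
        (-(fR τ + 24) / 2)) :
    ∃ Y > (0 : ℝ), ∀ σ τ : ℂ, Y < σ.im → Y < τ.im →
      HasProd (fun z : ℕ × Fin 3 × ℕ =>
        Complex.exp (Chat (fun n => (C00 n : ℂ)) A0 (z.2.2 * (z.1 + 1)) z.2.1 *
          Complex.log (1 - Complex.exp (2 * Real.pi * Complex.I * ((z.2.1 : ℕ) : ℂ) / 3) *
            Complex.exp (2 * Real.pi * Complex.I * σ) ^ (z.1 + 1) *
            Complex.exp (2 * Real.pi * Complex.I * τ) ^ z.2.2)) *
        Complex.exp (Chat (fun n => (C01 n : ℂ)) A1 (z.2.2 * (z.1 + 1)) z.2.1 *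
          Complex.log (1 + Complex.exp (2 * Real.pi * Complex.I * ((z.2.1 : ℕ) : ℂ) / 3) *
            Complex.exp (2 * Real.pi * Complex.I * σ) ^ (z.1 + 1) *
            Complex.exp (2 * Real.pi * Complex.I * τ) ^ z.2.2)))
        (Complex.exp (2 * Real.pi * Complex.I * σ) *
          (eta (2 * σ) ^ 12 * eta (3 * σ) ^ 12 / (eta σ ^ 12 * eta (6 * σ) ^ 12)
            - 12 - phi1 τ)) := by
  have hyp : C3A.Hyp (fun n => (C00 n : ℂ)) (fun n => (C01 n : ℂ)) A0 A1 :=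
    ⟨fun n => C3A.cT n A0 A1 hA0 hA1, fun n => C3A.cG n A0 A1 hA0 hA1,
      fun n => C3A.cU0 n (fun n => (C00 n : ℂ)) h00, fun n => C3A.cU1 n (fun n => (C01 n : ℂ)) h01⟩
  have small : ∀ z : ℂ, 2 < z.im → C3A.B * ‖C3A.e z‖ < 1 / 2 := by
    intro z hz
    have hpi := Real.pi_gt_three
    rw [C3A.norm_e, C3A.B, ← Real.exp_add]
    have h1 : 3 * Real.pi + -(2 * Real.pi * z.im) ≤ -1 := by nlinarith
    have h2 : Real.exp (-1) < 1 / 2 := by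
      rw [Real.exp_neg, one_div]
      apply inv_strictAnti₀ (by norm_num)
      have := Real.exp_one_gt_d9
      linarith
    exact (Real.exp_le_exp.2 h1).trans_lt h2
  refine ⟨2, by norm_num, fun σ τ hσ hτ => ?_⟩
  have hσ0 : 0 < σ.im := by linarith
  have hτ0 : 0 < τ.im := by linarith
  have key := hyp.main (p := C3A.e σ) hτ0 (small σ hσ) (small τ hτ).le
  have hval : C3A.e σ * (eta (2 * σ) ^ 12 * eta (3 * σ) ^ 12 / (eta σ ^ 12 * eta (6 * σ) ^ 12)
            - 12 - phi1 τ) =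
      (C3A.phT (C3A.e σ))⁻¹ * (1 - C3A.t τ * (C3A.e σ * C3A.phT (C3A.e σ))) := by
    have h1 : eta (2 * σ) ^ 12 * eta (3 * σ) ^ 12 / (eta σ ^ 12 * eta (6 * σ) ^ 12) = (C3A.t σ)⁻¹ := by
      rw [← C3A.t_eq, etaMG3A, inv_div]
    have hne := C3A.nice_T.ne _ (C3A.norm_e_lt hσ0)
    have he := C3A.e_ne σ
    rw [h1, C3A.phi1_eq hτ0, C3A.t_q σ]
    field_simp
    ring
  have hfun : (fun x => Complex.exp (C3A.el (fun n => (C00 n : ℂ)) (fun n => (C01 n : ℂ)) A0 A1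
      (C3A.e σ) (C3A.e τ) x)) = (fun z : ℕ × Fin 3 × ℕ =>
        Complex.exp (Chat (fun n => (C00 n : ℂ)) A0 (z.2.2 * (z.1 + 1)) z.2.1 *
          Complex.log (1 - Complex.exp (2 * Real.pi * Complex.I * ((z.2.1 : ℕ) : ℂ) / 3) *
            Complex.exp (2 * Real.pi * Complex.I * σ) ^ (z.1 + 1) *
            Complex.exp (2 * Real.pi * Complex.I * τ) ^ z.2.2)) *
        Complex.exp (Chat (fun n => (C01 n : ℂ)) A1 (z.2.2 * (z.1 + 1)) z.2.1 *
          Complex.log (1 + Complex.exp (2 * Real.pi * Complex.I * ((z.2.1 : ℕ) : ℂ) / 3) *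
            Complex.exp (2 * Real.pi * Complex.I * σ) ^ (z.1 + 1) *
            Complex.exp (2 * Real.pi * Complex.I * τ) ^ z.2.2))) := by
    funext z
    rw [C3A.el, Complex.exp_add]
    rfl
  rw [hfun, ← hval] at key
  exact key
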